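/- arXiv:math/0009113 — 5 statements merged into one kernel-verified Lean document; each statement's English description precedes it below -/
import Mathlib

section
/- Let n be a positive integer. The map (−n, x, y, z) ↦ (A, B, C) := (−n+x, (−n+x+y−z)/2, −n+y) is a bijection from the set of primitive root quadruples with smallest entry −n (i.e. primitive Descartes quadruples (−n,x,y,z) with −n ≤ 0 ≤ x ≤ y ≤ z and −n+x+y ≥ z and −n+x+y+z > 0) onto the set of integer triples (A,B,C) with 0 ≤ 2B ≤ A ≤ C, AC − B² = n², and gcd(A,B,C) = 1. In particular, the number of primitive root quadruples with smallest entry −n equals the number of GL(2,ℤ)-equivalence classes of primitive positive definite integral binary quadratic forms A·T² + 2B·TU + C·U² of discriminant −4n². -/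
/-- The set of primitive root quadruples `(-n, x, y, z)` with smallest entry `-n`,
encoded by the triple `(x,y,z)`: primitive Descartes quadruples with
`-n ≤ 0 ≤ x ≤ y ≤ z`, `-n + x + y ≥ z` and `-n + x + y + z > 0`. -/
def PrimRootSet (n : ℕ) : Set (ℤ × ℤ × ℤ) :=
  {q | 2 * ((n : ℤ) ^ 2 + q.1 ^ 2 + q.2.1 ^ 2 + q.2.2 ^ 2) =
        (-(n : ℤ) + q.1 + q.2.1 + q.2.2) ^ 2 ∧
      0 ≤ q.1 ∧ q.1 ≤ q.2.1 ∧ q.2.1 ≤ q.2.2 ∧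
      q.2.2 ≤ -(n : ℤ) + q.1 + q.2.1 ∧
      0 < -(n : ℤ) + q.1 + q.2.1 + q.2.2 ∧
      Int.gcd (Int.gcd (Int.gcd (-(n : ℤ)) q.1) q.2.1) q.2.2 = 1}

/-- The set of reduced primitive triples `(A,B,C)` with `0 ≤ 2B ≤ A ≤ C`,
`AC - B² = n²` and `gcd(A,B,C) = 1`; these are exactly the `GL(2,ℤ)`-reduced
primitive positive definite binary quadratic forms `A T² + 2B TU + C U²` of
discriminant `-4n²`, one per `GL(2,ℤ)`-equivalence class. -/
def ReducedFormSet (n : ℕ) : Set (ℤ × ℤ × ℤ) :=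
  {t | 0 ≤ 2 * t.2.1 ∧ 2 * t.2.1 ≤ t.1 ∧ t.1 ≤ t.2.2 ∧
      t.1 * t.2.2 - t.2.1 ^ 2 = (n : ℤ) ^ 2 ∧
      Int.gcd (Int.gcd t.1 t.2.1) t.2.2 = 1}

/-- Primitive positive definite integral binary quadratic forms
`A T² + 2B TU + C U²` of discriminant `-4n²`, encoded as triples `(A,B,C)`. -/
def FormSet (n : ℕ) : Set (ℤ × ℤ × ℤ) :=
  {f | 0 < f.1 ∧ (2 * f.2.1) ^ 2 - 4 * f.1 * f.2.2 = -(4 * (n : ℤ) ^ 2) ∧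
      Int.gcd (Int.gcd f.1 f.2.1) f.2.2 = 1}

/-- `GL(2,ℤ)`-equivalence of binary quadratic forms: `g` is obtained from `f`
by a unimodular (determinant `±1`) change of variables. -/
def FormRel (n : ℕ) (f g : FormSet n) : Prop :=
  ∃ p q r s : ℤ, (p * s - q * r) ^ 2 = 1 ∧
    (g : ℤ × ℤ × ℤ).1 = (f : ℤ × ℤ × ℤ).1 * p ^ 2 + 2 * (f : ℤ × ℤ × ℤ).2.1 * p * r +
      (f : ℤ × ℤ × ℤ).2.2 * r ^ 2 ∧
    (g : ℤ × ℤ × ℤ).2.1 = (f : ℤ × ℤ × ℤ).1 * p * q +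
      (f : ℤ × ℤ × ℤ).2.1 * (p * s + q * r) + (f : ℤ × ℤ × ℤ).2.2 * r * s ∧
    (g : ℤ × ℤ × ℤ).2.2 = (f : ℤ × ℤ × ℤ).1 * q ^ 2 + 2 * (f : ℤ × ℤ × ℤ).2.1 * q * s +
      (f : ℤ × ℤ × ℤ).2.2 * s ^ 2

theorem Int.gcd_gcd_eq_one_iff {a b c : ℤ} :
    Int.gcd (Int.gcd a b) c = 1 ↔ ∀ d : ℤ, d ∣ a → d ∣ b → d ∣ c → d ∣ 1 := by
  constructor
  · intro h d ha hb hc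
    have := Int.dvd_coe_gcd (Int.dvd_coe_gcd ha hb) hc
    rwa [h] at this
  · intro h
    have hab := Int.gcd_dvd_left (Int.gcd a b : ℤ) c
    have := h _ (hab.trans (Int.gcd_dvd_left a b)) (hab.trans (Int.gcd_dvd_right a b))
      (Int.gcd_dvd_right (Int.gcd a b : ℤ) c)
    exact_mod_cast Int.eq_one_of_dvd_one (by positivity) this

theorem Int.gcd_gcd_gcd_eq_one_iff {a b c e : ℤ} :
    Int.gcd (Int.gcd (Int.gcd a b) c) e = 1 ↔
      ∀ d : ℤ, d ∣ a → d ∣ b → d ∣ c → d ∣ e → d ∣ 1 := by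
  rw [Int.gcd_gcd_eq_one_iff]
  constructor
  · exact fun h d ha hb hc he => h d (Int.dvd_coe_gcd ha hb) hc he
  · exact fun h d hab hc he =>
      h d (hab.trans (Int.gcd_dvd_left a b)) (hab.trans (Int.gcd_dvd_right a b)) hc he

/-- With `x = A + n`, `y = C + n`, `z = n + A + C - 2B`, the root quadruple conditions on
`(-n, x, y, z)` are the reduction conditions on `(A, B, C)`. -/
theorem mem_primRootSet_iff_mem_reducedFormSet {n : ℕ} (hn : 0 < n) (A B C : ℤ) :
    (A + n, C + n, n + A + C - 2 * B) ∈ PrimRootSet n ↔ (A, B, C) ∈ ReducedFormSet n := by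
  have hn' : (0 : ℤ) < n := by exact_mod_cast hn
  simp only [PrimRootSet, ReducedFormSet, Set.mem_ofPred_eq, Int.gcd_gcd_eq_one_iff (a := A),
    Int.gcd_gcd_gcd_eq_one_iff]
  constructor
  · rintro ⟨h, h0, hxy, hyz, hz, hpos, hg⟩
    have hdisc : A * C - B ^ 2 = (n : ℤ) ^ 2 := by linarith
    refine ⟨by linarith, by linarith, by linarith, hdisc, fun d hA hB hC => ?_⟩
    have hdn : d ∣ (n : ℤ) := by
      rw [← Int.pow_dvd_pow_iff two_ne_zero, ← hdisc, pow_two, pow_two]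
      exact dvd_sub (mul_dvd_mul hA hC) (mul_dvd_mul hB hB)
    exact hg d (by simpa using hdn) (dvd_add hA hdn) (dvd_add hC hdn)
      (dvd_sub (dvd_add (dvd_add hdn hA) hC) (hB.mul_left 2))
  · rintro ⟨hB, hBA, hAC, hdisc, hg⟩
    refine ⟨by linarith, by linarith, by linarith, by linarith, by linarith, by linarith,
      fun d hdn hx hy _ => ?_⟩
    have hdn : d ∣ (n : ℤ) := by simpa using hdn
    have hA := (dvd_add_left hdn).1 hx
    have hC := (dvd_add_left hdn).1 hy
    refine hg d hA ?_ hC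
    rw [← Int.pow_dvd_pow_iff two_ne_zero,
      show B ^ 2 = A * C - (n : ℤ) ^ 2 by linarith, pow_two, pow_two]
    exact dvd_sub (mul_dvd_mul hA hC) (mul_dvd_mul hdn hdn)

theorem bijOn_primRootSet_reducedFormSet {n : ℕ} (hn : 0 < n) :
    Set.BijOn
      (fun q : ℤ × ℤ × ℤ =>
        (-(n : ℤ) + q.1, (-(n : ℤ) + q.1 + q.2.1 - q.2.2) / 2, -(n : ℤ) + q.2.1))
      (PrimRootSet n) (ReducedFormSet n) := by
  refine Set.InvOn.bijOn
    (f' := fun t => (t.1 + n, t.2.2 + n, n + t.1 + t.2.2 - 2 * t.2.1)) ⟨?_, ?_⟩ ?_ ?_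
  all_goals rintro ⟨a, b, c⟩ h
  rotate_left
  · ext <;> simp only [] <;> omega
  rotate_left
  · exact (mem_primRootSet_iff_mem_reducedFormSet hn a b c).2 h
  all_goals
    have heven : Even ((-(n : ℤ) + a + b + c) ^ 2) := by
      rw [← h.1]; exact even_two_mul _
    have heven' := (Int.even_pow.1 heven).1
    rw [Int.even_iff] at heven'
  · ext <;> simp only [] <;> omega
  · rw [← mem_primRootSet_iff_mem_reducedFormSet hn]
    convert h using 2
    · simp
    · ext <;> simp only [] <;> omega

theorem formRel_equivalence (n : ℕ) : Equivalence (FormRel n) where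
  refl f := ⟨1, 0, 0, 1, by norm_num, by ring, by ring, by ring⟩
  symm := by
    rintro f g ⟨p, q, r, s, hd, h1, h2, h3⟩
    refine ⟨s, -q, -r, p, by linear_combination hd, ?_, ?_, ?_⟩ <;> rw [h1, h2, h3]
    · linear_combination (-(f : ℤ × ℤ × ℤ).1) * hd
    · linear_combination (-(f : ℤ × ℤ × ℤ).2.1) * hd
    · linear_combination (-(f : ℤ × ℤ × ℤ).2.2) * hd
  trans := by
    rintro f g k ⟨p, q, r, s, hd, h1, h2, h3⟩ ⟨p', q', r', s', hd', h1', h2', h3'⟩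
    refine ⟨p * p' + q * r', p * q' + q * s', r * p' + s * r', r * q' + s * s', ?_, ?_, ?_, ?_⟩
    · linear_combination (p' * s' - q' * r') ^ 2 * hd + hd'
    · rw [h1', h1, h2, h3]; ring
    · rw [h2', h1, h2, h3]; ring
    · rw [h3', h1, h2, h3]; ring

theorem reducedFormSet_subset_formSet {n : ℕ} (hn : 0 < n) :
    ReducedFormSet n ⊆ FormSet n := by
  rintro ⟨A, B, C⟩ ⟨hB, hBA, hAC, hd, hg⟩
  simp only [] at *
  have hn' : (0 : ℤ) < (n : ℤ) ^ 2 := by positivity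
  refine ⟨?_, by simp only []; linarith, hg⟩
  by_contra! hA
  obtain rfl : A = 0 := le_antisymm hA (by linarith)
  nlinarith [sq_nonneg B]

section Minima

variable {A B C : ℤ}

/-- A reduced form takes values at least `C` off the line `y = 0`. -/
theorem le_reduced_form_of_right_ne_zero (hA : 0 ≤ A) (hB : 0 ≤ 2 * B) (hBA : 2 * B ≤ A)
    (hAC : A ≤ C) (x : ℤ) {y : ℤ} (hy : y ≠ 0) :
    C ≤ A * x ^ 2 + 2 * B * x * y + C * y ^ 2 := by
  have hy1 : 1 ≤ |y| := Int.one_le_abs hy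
  have hy2 : 1 ≤ y ^ 2 := by rw [← sq_abs]; nlinarith
  rcases eq_or_ne x 0 with rfl | hx
  · nlinarith
  have hx1 : 1 ≤ |x| := Int.one_le_abs hx
  have hxy : 1 ≤ |x| * |y| := by nlinarith
  have hcross : -(A * (|x| * |y|)) ≤ 2 * B * x * y := by
    have h1 : -(|x| * |y|) ≤ x * y := by rw [← abs_mul]; exact neg_abs_le _
    nlinarith
  have hA1 : 0 ≤ A * (|x| - |y|) ^ 2 := by positivity
  have hA2 : 0 ≤ A * (|x| * |y| - 1) := mul_nonneg hA (by linarith)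
  have hC : 0 ≤ (C - A) * (y ^ 2 - 1) := mul_nonneg (by linarith) (by linarith)
  have hexp : (|x| - |y|) ^ 2 = x ^ 2 - 2 * (|x| * |y|) + y ^ 2 := by
    rw [← sq_abs x, ← sq_abs y]; ring
  rw [hexp] at hA1
  linarith

/-- A reduced form takes values at least `A` off the origin. -/
theorem le_reduced_form_of_ne_zero (hA : 0 ≤ A) (hB : 0 ≤ 2 * B) (hBA : 2 * B ≤ A)
    (hAC : A ≤ C) {x y : ℤ} (hxy : x ≠ 0 ∨ y ≠ 0) :
    A ≤ A * x ^ 2 + 2 * B * x * y + C * y ^ 2 := by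
  rcases eq_or_ne y 0 with rfl | hy
  · have : 0 < x ^ 2 := by have := hxy.resolve_right (by simp); positivity
    nlinarith
  · exact hAC.trans (le_reduced_form_of_right_ne_zero hA hB hBA hAC x hy)

end Minima

theorem FormRel.le_of_mem_reducedFormSet {n : ℕ} {f g : FormSet n} (h : FormRel n f g)
    (hf : (f : ℤ × ℤ × ℤ) ∈ ReducedFormSet n) (hg : (g : ℤ × ℤ × ℤ) ∈ ReducedFormSet n) :
    (f : ℤ × ℤ × ℤ).1 ≤ (g : ℤ × ℤ × ℤ).1 ∧ (f : ℤ × ℤ × ℤ).2.2 ≤ (g : ℤ × ℤ × ℤ).2.2 := by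
  obtain ⟨p, q, r, s, hd, h1, -, h3⟩ := h
  obtain ⟨hB, hBA, hAC, -, -⟩ := hf
  have hA := f.2.1.le
  have hpr : p ≠ 0 ∨ r ≠ 0 := by
    by_contra! h0
    simp [h0.1, h0.2] at hd
  refine ⟨h1 ▸ le_reduced_form_of_ne_zero hA hB hBA hAC hpr, ?_⟩
  rcases eq_or_ne s 0 with rfl | hs
  · have hr : r ≠ 0 := by rintro rfl; simp at hd
    exact (h1 ▸ le_reduced_form_of_right_ne_zero hA hB hBA hAC p hr).trans hg.2.2.1
  · exact h3 ▸ le_reduced_form_of_right_ne_zero hA hB hBA hAC q hs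

theorem FormRel.eq_of_mem_reducedFormSet {n : ℕ} {f g : FormSet n} (h : FormRel n f g)
    (hf : (f : ℤ × ℤ × ℤ) ∈ ReducedFormSet n) (hg : (g : ℤ × ℤ × ℤ) ∈ ReducedFormSet n) :
    f = g := by
  obtain ⟨hA, hC⟩ := h.le_of_mem_reducedFormSet hf hg
  obtain ⟨hA', hC'⟩ := ((formRel_equivalence n).symm h).le_of_mem_reducedFormSet hg hf
  have hA := le_antisymm hA hA'
  have hC := le_antisymm hC hC'
  have hB : (f : ℤ × ℤ × ℤ).2.1 = (g : ℤ × ℤ × ℤ).2.1 := by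
    have hdf := hf.2.2.2.1
    have hdg := hg.2.2.2.1
    rw [← hA, ← hC] at hdg
    rw [← sq_eq_sq₀ (by linarith [hf.1]) (by linarith [hg.1])]
    linarith
  exact Subtype.ext (Prod.ext hA (Prod.ext hB hC))

section Moves

variable {n : ℕ} {A B C : ℤ}

theorem FormSet.right_pos (hn : 0 < n) (h : (A, B, C) ∈ FormSet n) : 0 < C := by
  obtain ⟨hA, hd, -⟩ := h
  simp only [] at hA hd
  have hn' : (0 : ℤ) < (n : ℤ) ^ 2 := by positivity
  have : 0 < A * C := by nlinarith [sq_nonneg B]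
  exact pos_of_mul_pos_right this hA.le

theorem FormSet.swap_mem (hn : 0 < n) (h : (A, B, C) ∈ FormSet n) : (C, B, A) ∈ FormSet n := by
  refine ⟨FormSet.right_pos hn h, ?_, Int.gcd_gcd_eq_one_iff.2 fun d hC hB hA =>
    Int.gcd_gcd_eq_one_iff.1 h.2.2 d hA hB hC⟩
  linear_combination h.2.1

theorem FormSet.neg_mem (h : (A, B, C) ∈ FormSet n) : (A, -B, C) ∈ FormSet n := by
  refine ⟨h.1, ?_, by simpa using h.2.2⟩
  linear_combination h.2.1

theorem FormSet.translate_mem (h : (A, B, C) ∈ FormSet n) (k : ℤ) :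
    (A, B + A * k, C + 2 * B * k + A * k ^ 2) ∈ FormSet n := by
  refine ⟨h.1, ?_, Int.gcd_gcd_eq_one_iff.2 fun d hA hB hC => ?_⟩
  · linear_combination h.2.1
  have hB' := (dvd_add_left (hA.mul_right k)).1 hB
  have hC' := (dvd_add_left ((hB'.mul_left 2).mul_right k)).1
    ((dvd_add_left (hA.mul_right (k ^ 2))).1 hC)
  exact Int.gcd_gcd_eq_one_iff.1 h.2.2 d hA hB' hC'

theorem mem_reducedFormSet_of_mem_formSet (h : (A, B, C) ∈ FormSet n) (hB : 0 ≤ B)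
    (hBA : 2 * B ≤ A) (hAC : A ≤ C) : (A, B, C) ∈ ReducedFormSet n := by
  refine ⟨by simpa using hB, hBA, hAC, ?_, h.2.2⟩
  have := h.2.1
  simp only [] at this ⊢
  linarith

end Moves

theorem exists_formRel_mem_reducedFormSet {n : ℕ} (hn : 0 < n) (f : FormSet n) :
    ∃ g : FormSet n, FormRel n f g ∧ (g : ℤ × ℤ × ℤ) ∈ ReducedFormSet n := by
  induction hm : (f : ℤ × ℤ × ℤ).1.toNat using Nat.strong_induction_on generalizing f with
  | _ m ih =>
  obtain ⟨⟨A, B, C⟩, hf⟩ := f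
  have hA : 0 < A := hf.1
  obtain ⟨k, hk₁, hk₂⟩ : ∃ k : ℤ, -A ≤ 2 * (B + A * k) ∧ 2 * (B + A * k) ≤ A := by
    refine ⟨-((2 * B + A) / (2 * A)), ?_, ?_⟩
    · linarith [Int.mul_ediv_self_le (x := 2 * B + A) (k := 2 * A) (by positivity)]
    · linarith [Int.lt_mul_ediv_self_add (x := 2 * B + A) (k := 2 * A) (by positivity)]
  have hf' := FormSet.translate_mem hf k
  have hrel : FormRel n ⟨_, hf⟩ ⟨_, hf'⟩ := by
    refine ⟨1, k, 0, 1, by norm_num, ?_, ?_, ?_⟩ <;> simp only [] <;> ring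
  set B' := B + A * k
  set C' := C + 2 * B * k + A * k ^ 2
  rcases lt_or_ge C' A with hCA | hAC
  · have hswap := FormSet.swap_mem hn hf'
    have hrel' : FormRel n ⟨_, hf'⟩ ⟨_, hswap⟩ := by
      refine ⟨0, 1, 1, 0, by norm_num, ?_, ?_, ?_⟩ <;> simp only [] <;> ring
    have hlt : C'.toNat < m := by
      simp only [] at hm
      omega
    obtain ⟨g, hg, hgr⟩ := ih _ hlt ⟨_, hswap⟩ rfl
    exact ⟨g, (formRel_equivalence n).trans hrel ((formRel_equivalence n).trans hrel' hg), hgr⟩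
  rcases le_total 0 B' with hB | hB
  · exact ⟨⟨_, hf'⟩, hrel, mem_reducedFormSet_of_mem_formSet hf' hB hk₂ hAC⟩
  · have hneg := FormSet.neg_mem hf'
    have hrel' : FormRel n ⟨_, hf'⟩ ⟨_, hneg⟩ := by
      refine ⟨1, 0, 0, -1, by norm_num, ?_, ?_, ?_⟩ <;> simp only [] <;> ring
    exact ⟨⟨_, hneg⟩, (formRel_equivalence n).trans hrel hrel',
      mem_reducedFormSet_of_mem_formSet hneg (by linarith) (by linarith) hAC⟩

theorem bijective_reducedFormSet_quot {n : ℕ} (hn : 0 < n) :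
    Function.Bijective fun t : ReducedFormSet n =>
      Quot.mk (FormRel n) ⟨t, reducedFormSet_subset_formSet hn t.2⟩ := by
  constructor
  · intro s t hst
    have hrel := Quot.eq.1 hst
    rw [(formRel_equivalence n).eqvGen_iff] at hrel
    exact Subtype.ext (Subtype.mk.inj (hrel.eq_of_mem_reducedFormSet s.2 t.2))
  · rintro ⟨f⟩
    obtain ⟨g, hg, hgr⟩ := exists_formRel_mem_reducedFormSet hn f
    exact ⟨⟨g, hgr⟩, (Quot.sound hg).symm⟩

/-- **Root quadruples with smallest entry `-n` correspond to reduced binary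
quadratic forms of discriminant `-4n²`.**  The map
`(-n,x,y,z) ↦ (A,B,C) = (-n+x, (-n+x+y-z)/2, -n+y)` is a bijection from the
primitive root quadruples with smallest entry `-n` onto the triples `(A,B,C)`
with `0 ≤ 2B ≤ A ≤ C`, `AC - B² = n²`, `gcd(A,B,C) = 1`.  In particular the
number of such root quadruples equals the number of `GL(2,ℤ)`-equivalence
classes of primitive positive definite integral binary quadratic forms of
discriminant `-4n²`. -/
theorem root_quadruples_biject_reduced_forms (n : ℕ) (hn : 0 < n) :
    Set.BijOn
      (fun q : ℤ × ℤ × ℤ =>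
        (-(n : ℤ) + q.1, (-(n : ℤ) + q.1 + q.2.1 - q.2.2) / 2, -(n : ℤ) + q.2.1))
      (PrimRootSet n) (ReducedFormSet n) ∧
    Nat.card (PrimRootSet n) = Nat.card (Quot (FormRel n)) := by
  have hbij := bijOn_primRootSet_reducedFormSet hn
  exact ⟨hbij, (Nat.card_congr (hbij.equiv _)).trans
    (Nat.card_eq_of_bijective _ (bijective_reducedFormSet_quot hn))⟩
end

section
/- For every integer n > 1, the number N*_root(−n) of primitive integer root quadruples (a,b,c,d) with a = −n equals (n/4)·∏_{p | n} (1 − χ₋₄(p)/p) + 2^{ω(n) − δ_n − 1}, where the product is over primes p dividing n, ω(n) is the number of distinct prime divisors of n, and δ_n = 1 if n ≡ 2 (mod 4) and δ_n = 0 otherwise. -/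
theorem Nat.card_subtype_prod_eq_mul {R A B : Type*} (e : R ≃ A × B) (T : R × R → Prop)
    (P : A × A → Prop) (Q : B × B → Prop)
    (h : ∀ x y, T (x, y) ↔ P ((e x).1, (e y).1) ∧ Q ((e x).2, (e y).2)) :
    Nat.card {x // T x} = Nat.card {x // P x} * Nat.card {x // Q x} := by
  rw [← Nat.card_prod]
  refine Nat.card_congr ((Equiv.subtypeEquiv ((e.prodCongr e).trans
    (Equiv.prodProdProdComm A B A B)) (q := fun z => P z.1 ∧ Q z.2) ?_).trans
    Equiv.subtypeProdEquivProd)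
  rintro ⟨x, y⟩
  exact h x y

/-- The number of points of `R × R` of invertible norm. -/
noncomputable def unitNormCount (R : Type*) [CommRing R] : ℕ :=
  Nat.card {x : R × R // IsUnit (x.1 ^ 2 + x.2 ^ 2)}

/-- The number of points of `R × R` of invertible norm whose square is real. -/
noncomputable def realSquareCount (R : Type*) [CommRing R] : ℕ :=
  Nat.card {x : R × R // IsUnit (x.1 ^ 2 + x.2 ^ 2) ∧ 2 * x.1 * x.2 = 0}

/-- The number of points of `R × R` of invertible norm whose square is imaginary. -/
noncomputable def imagSquareCount (R : Type*) [CommRing R] : ℕ :=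
  Nat.card {x : R × R // IsUnit (x.1 ^ 2 + x.2 ^ 2) ∧ x.1 ^ 2 - x.2 ^ 2 = 0}

theorem unitNormCount_mul {a b : ℕ} (h : a.Coprime b) :
    unitNormCount (ZMod (a * b)) = unitNormCount (ZMod a) * unitNormCount (ZMod b) := by
  refine Nat.card_subtype_prod_eq_mul (ZMod.chineseRemainder h).toEquiv _ _ _ fun x y => ?_
  rw [← isUnit_map_iff (ZMod.chineseRemainder h), Prod.isUnit_iff]
  simp

theorem realSquareCount_mul {a b : ℕ} (h : a.Coprime b) :
    realSquareCount (ZMod (a * b)) = realSquareCount (ZMod a) * realSquareCount (ZMod b) := by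
  refine Nat.card_subtype_prod_eq_mul (ZMod.chineseRemainder h).toEquiv _ _ _ fun x y => ?_
  rw [← isUnit_map_iff (ZMod.chineseRemainder h), Prod.isUnit_iff,
    ← (ZMod.chineseRemainder h).map_eq_zero_iff, Prod.ext_iff]
  simp only [map_add, map_mul, map_pow, map_ofNat, RingEquiv.toEquiv_eq_coe,
    RingEquiv.coe_toEquiv, Prod.fst_add, Prod.snd_add, Prod.pow_fst, Prod.pow_snd, Prod.fst_mul,
    Prod.snd_mul, Prod.fst_ofNat, Prod.snd_ofNat, Prod.fst_zero, Prod.snd_zero]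
  tauto

theorem ZMod.isUnit_prime_pow_iff {p : ℕ} [Fact p.Prime] (k : ℕ) (z : ZMod (p ^ (k + 1))) :
    IsUnit z ↔ ZMod.castHom (dvd_pow_self p k.succ_ne_zero) (ZMod p) z ≠ 0 := by
  obtain ⟨m, rfl⟩ := ZMod.natCast_zmod_surjective z
  rw [ZMod.isUnit_iff_coprime, Nat.coprime_pow_right_iff k.succ_pos, map_natCast, Ne,
    ZMod.natCast_eq_zero_iff, Nat.coprime_comm, Nat.Prime.coprime_iff_not_dvd Fact.out]

theorem Nat.card_subtype_comp_of_surjective {G H : Type*} [AddGroup G] [AddGroup H] [Finite G]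
    (f : G →+ H) (hf : Function.Surjective f) (P : H → Prop) :
    Nat.card {x // P (f x)} * Nat.card H = Nat.card {y // P y} * Nat.card G := by
  classical
  have e : G ≃ H × f.ker := AddSubgroup.addGroupEquivQuotientProdAddSubgroup (s := f.ker) |>.trans
    ((QuotientAddGroup.quotientKerEquivOfSurjective f hf).toEquiv.prodCongr (Equiv.refl _))
  have := Finite.of_surjective f hf
  have hfib (y : H) : Nat.card {x // f x = y} = Nat.card f.ker := by
    obtain ⟨x₀, rfl⟩ := hf y
    refine Nat.card_congr ⟨fun x => ⟨x.1 - x₀, ?_⟩, fun x => ⟨x.1 + x₀, ?_⟩, ?_, ?_⟩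
    · simp [AddMonoidHom.mem_ker, x.2]
    · have := x.2
      rw [AddMonoidHom.mem_ker] at this
      simp [this]
    · intro x; simp
    · intro x; simp
  have h1 : Nat.card {x // P (f x)} = Nat.card {y // P y} * Nat.card f.ker := by
    rw [← Nat.card_prod]
    have e1 : {x // P (f x)} ≃ Σ y : {y // P y}, {x // f x = y.1} :=
      (Equiv.sigmaSubtypeFiberEquivSubtype f fun _ => Iff.rfl).symm
    have := Fintype.ofFinite {y // P y}
    rw [Nat.card_congr e1, Nat.card_sigma, Nat.card_prod]
    simp [hfib, Nat.card_eq_fintype_card]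
  rw [h1, Nat.card_congr e, Nat.card_prod]
  ring

theorem unitNormCount_prime_pow {p : ℕ} [Fact p.Prime] (k : ℕ) :
    unitNormCount (ZMod (p ^ (k + 1))) = p ^ (2 * k) * unitNormCount (ZMod p) := by
  have hp : 0 < p := (Fact.out : p.Prime).pos
  set c := ZMod.castHom (dvd_pow_self p k.succ_ne_zero) (ZMod p)
  have hc : Function.Surjective c := ZMod.castHom_surjective _
  have := NeZero.of_pos (pow_pos hp (k + 1))
  have h := Nat.card_subtype_comp_of_surjective (c.toAddMonoidHom.prodMap c.toAddMonoidHom)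
    (hc.prodMap hc) (fun x => IsUnit (x.1 ^ 2 + x.2 ^ 2))
  simp only [Nat.card_prod, Nat.card_zmod] at h
  have h2 : unitNormCount (ZMod (p ^ (k + 1))) * (p * p) =
      unitNormCount (ZMod p) * (p ^ (k + 1) * p ^ (k + 1)) := by
    rw [unitNormCount, unitNormCount, ← h]
    congr 1
    refine Nat.card_congr (Equiv.subtypeEquivRight fun x => ?_)
    rw [ZMod.isUnit_prime_pow_iff, isUnit_iff_ne_zero]
    simp [c]
  apply Nat.eq_of_mul_eq_mul_right (Nat.mul_pos hp hp)
  rw [h2]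
  ring

theorem ZMod.isUnit_two_iff (z : ZMod 2) : IsUnit z ↔ z = 1 := by
  rw [isUnit_iff_ne_zero]
  revert z
  decide

theorem unitNormCount_two : unitNormCount (ZMod 2) = 2 := by
  rw [unitNormCount, Nat.card_congr (Equiv.subtypeEquivRight fun x => ZMod.isUnit_two_iff _),
    Nat.card_eq_fintype_card]
  decide

theorem unitNormCount_prime {p : ℕ} [hp : Fact p.Prime] :
    (unitNormCount (ZMod p) : ℤ) = (p - 1) * (p - ZMod.χ₄ p) := by
  classical
  rcases eq_or_ne p 2 with rfl | h2
  · rw [unitNormCount_two]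
    decide
  · have hsum : Nat.card {x : ZMod p × ZMod p // IsUnit (x.1 ^ 2 + x.2 ^ 2)} +
        Nat.card {x : ZMod p × ZMod p // ¬ IsUnit (x.1 ^ 2 + x.2 ^ 2)} = p * p := by
      rw [← Nat.card_sum, Nat.card_congr (Equiv.sumCompl _), Nat.card_prod, Nat.card_zmod]
    have hzero : (Nat.card {x : ZMod p × ZMod p // ¬ IsUnit (x.1 ^ 2 + x.2 ^ 2)} : ℤ) =
        p + (p - 1) * ZMod.χ₄ p := by
      have e : {x : ZMod p × ZMod p // ¬ IsUnit (x.1 ^ 2 + x.2 ^ 2)} ≃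
          Σ t : ZMod p, {s : ZMod p // s ^ 2 = -t ^ 2} :=
        ⟨fun x => ⟨x.1.2, x.1.1, by
            have := x.2
            rw [isUnit_iff_ne_zero, not_not] at this
            exact eq_neg_of_add_eq_zero_left this⟩,
          fun z => ⟨(z.2.1, z.1), by
            rw [isUnit_iff_ne_zero, not_not, z.2.2]; ring⟩,
          fun x => rfl, fun z => rfl⟩
      have hq (t : ZMod p) : (Nat.card {s : ZMod p // s ^ 2 = -t ^ 2} : ℤ) =
          quadraticChar (ZMod p) (-t ^ 2) + 1 := by
        rw [← quadraticChar_card_sqrts ((ZMod.ringChar_zmod_n p).substr h2)]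
        simp [Fintype.card_subtype]
      have hχ : ∀ t ∈ Finset.univ.erase (0 : ZMod p),
          quadraticChar (ZMod p) (-t ^ 2) + 1 = ZMod.χ₄ p + 1 := by
        intro t ht
        have ht0 : t ≠ 0 := Finset.ne_of_mem_erase ht
        have h1 := legendreSym.at_neg_one h2
        rw [legendreSym] at h1
        push_cast at h1
        rw [neg_eq_neg_one_mul, map_mul, quadraticChar_sq_one' ht0, h1, mul_one]
      rw [Nat.card_congr e, Nat.card_sigma]
      push_cast
      simp only [hq]
      rw [← Finset.add_sum_erase _ _ (Finset.mem_univ 0), Finset.sum_congr rfl hχ]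
      have hp1 := hp.out.one_le
      simp [Finset.card_erase_of_mem, ZMod.card, Nat.cast_sub hp1]
      ring
    have := congrArg (Nat.cast : ℕ → ℤ) hsum
    push_cast at this
    rw [unitNormCount]
    linarith

theorem unitNormCount_eq (n : ℕ) (hn : 0 < n) :
    (unitNormCount (ZMod n) : ℚ) =
      n.totient * (n * ∏ p ∈ n.primeFactors, (1 - ((ZMod.χ₄ (p : ZMod 4) : ℤ) : ℚ) / p)) := by
  induction n using Nat.recOnPosPrimePosCoprime with
  | prime_pow p k hp hk =>
    obtain ⟨k, rfl⟩ := Nat.exists_eq_add_one.mpr hk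
    have := Fact.mk hp
    have h := congrArg (Int.cast : ℤ → ℚ) (unitNormCount_prime (p := p))
    push_cast at h
    have hp0 : (p : ℚ) ≠ 0 := by exact_mod_cast hp.ne_zero
    rw [unitNormCount_prime_pow, Nat.primeFactors_prime_pow k.succ_ne_zero hp,
      Finset.prod_singleton, Nat.totient_prime_pow_succ hp]
    push_cast [Nat.cast_sub hp.one_le, h]
    field_simp
    ring
  | zero => omega
  | one =>
    have : unitNormCount (ZMod 1) = 1 := by
      rw [unitNormCount, Nat.card_eq_one_iff_unique]
      exact ⟨inferInstance, ⟨⟨0, isUnit_of_subsingleton _⟩⟩⟩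
    simp [this]
  | coprime a b ha hb hab iha ihb =>
    rw [unitNormCount_mul hab, Nat.cast_mul, iha (by omega), ihb (by omega),
      hab.primeFactors_mul, Finset.prod_union hab.disjoint_primeFactors, Nat.totient_mul hab]
    push_cast
    ring

theorem realSquareCount_prime_pow {p : ℕ} [Fact p.Prime] (k : ℕ)
    (h2 : (2 : ZMod (p ^ (k + 1))) ≠ 0) :
    realSquareCount (ZMod (p ^ (k + 1))) = 2 * (p ^ (k + 1)).totient *
      Nat.card {t : ZMod (p ^ (k + 1)) // ¬ IsUnit t ∧ 2 * t = 0} := by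
  have hp : 0 < p := (Fact.out : p.Prime).pos
  have := NeZero.of_pos (pow_pos hp (k + 1))
  have hu := ZMod.isUnit_prime_pow_iff (p := p) k
  set c := ZMod.castHom (dvd_pow_self p k.succ_ne_zero) (ZMod p)
  set R := ZMod (p ^ (k + 1))
  have hnorm {s t : R} (hs : IsUnit s) (ht : ¬ IsUnit t) : IsUnit (s ^ 2 + t ^ 2) := by
    rw [hu] at *
    simp only [not_not] at ht
    simpa [ht] using hs
  have hnorm' {s t : R} (hs : IsUnit s) (ht : ¬ IsUnit t) : IsUnit (t ^ 2 + s ^ 2) := by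
    rw [add_comm (t ^ 2)]
    exact hnorm hs ht
  let f : Bool × Rˣ × {t : R // ¬ IsUnit t ∧ 2 * t = 0} →
      {x : R × R // IsUnit (x.1 ^ 2 + x.2 ^ 2) ∧ 2 * x.1 * x.2 = 0} := fun z =>
    if z.1 then ⟨(z.2.1, z.2.2), hnorm z.2.1.isUnit z.2.2.2.1, by
        rw [mul_right_comm, z.2.2.2.2, zero_mul]⟩
      else ⟨(z.2.2, z.2.1), hnorm' z.2.1.isUnit z.2.2.2.1, by
        rw [z.2.2.2.2, zero_mul]⟩
  have hf : Function.Bijective f := by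
    constructor
    · rintro ⟨b, u, t⟩ ⟨b', u', t'⟩ h
      have hne : (u : R) ≠ t' := fun h => t'.2.1 (h ▸ u.isUnit)
      have hne' : (t : R) ≠ u' := fun h => t.2.1 (h ▸ u'.isUnit)
      cases b <;> cases b' <;>
        simp_all [f, Subtype.ext_iff, Units.ext_iff]
    · rintro ⟨⟨s, t⟩, hst, h0⟩
      dsimp only at hst h0
      by_cases hs : IsUnit s
      · have h2t : 2 * t = 0 := by
          rw [mul_right_comm] at h0
          exact (hs.mul_left_eq_zero).1 h0
        refine ⟨(true, hs.unit, ⟨t, fun ht => h2 ?_, h2t⟩), ?_⟩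
        · exact (ht.mul_left_eq_zero).1 h2t
        · simp [f]
      · have ht : IsUnit t := by
          rw [hu] at *
          rintro h
          simp only [not_not] at hs
          simp [hs, h] at hst
        have h2s : 2 * s = 0 := (ht.mul_left_eq_zero).1 h0
        exact ⟨(false, ht.unit, ⟨s, hs, h2s⟩), by simp [f]⟩
  rw [realSquareCount, ← Nat.card_congr (Equiv.ofBijective f hf), Nat.card_prod, Nat.card_prod,
    Nat.card_eq_fintype_card, Nat.card_eq_fintype_card, Fintype.card_bool,
    ZMod.card_units_eq_totient, mul_assoc]

theorem realSquareCount_odd_prime_pow {p : ℕ} (hp : p.Prime) (hp2 : p ≠ 2) (k : ℕ) :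
    realSquareCount (ZMod (p ^ (k + 1))) = 2 * (p ^ (k + 1)).totient := by
  have := Fact.mk hp
  have h2 : IsUnit (2 : ZMod (p ^ (k + 1))) := by
    have := (ZMod.isUnit_iff_coprime 2 (p ^ (k + 1))).2
      (Nat.Coprime.pow_right _ ((Nat.coprime_primes Nat.prime_two hp).2 hp2.symm))
    exact_mod_cast this
  have : Nontrivial (ZMod (p ^ (k + 1))) :=
    ZMod.nontrivial_iff.2 (Nat.one_lt_pow k.succ_ne_zero hp.one_lt).ne'
  rw [realSquareCount_prime_pow k h2.ne_zero]
  have : Nat.card {t : ZMod (p ^ (k + 1)) // ¬ IsUnit t ∧ 2 * t = 0} = 1 := by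
    rw [Nat.card_eq_one_iff_exists]
    refine ⟨⟨0, not_isUnit_zero, mul_zero _⟩, fun t => Subtype.ext ?_⟩
    exact (h2.mul_right_eq_zero).1 t.2.2
  rw [this, mul_one]

theorem realSquareCount_two_pow (k : ℕ) :
    realSquareCount (ZMod (2 ^ (k + 2))) = 4 * (2 ^ (k + 2)).totient := by
  have := Fact.mk Nat.prime_two
  have h4 : 1 ≤ 2 ^ k := Nat.one_le_two_pow
  have hlt : 2 ^ (k + 1) < 2 ^ (k + 2) := Nat.pow_lt_pow_right (by omega) (by omega)
  have hne : (((2 : ℕ) ^ (k + 1) : ℕ) : ZMod (2 ^ (k + 2))) ≠ 0 := by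
    rw [Ne, ZMod.natCast_eq_zero_iff]
    exact Nat.not_dvd_of_pos_of_lt (by positivity) hlt
  rw [realSquareCount_prime_pow (p := 2) (k + 1)]
  · have hset : {t : ZMod (2 ^ (k + 2)) | ¬ IsUnit t ∧ 2 * t = 0} =
        {0, (((2 : ℕ) ^ (k + 1) : ℕ) : ZMod (2 ^ (k + 2)))} := by
      ext t
      obtain ⟨m, rfl⟩ := ZMod.natCast_zmod_surjective t
      simp only [Set.mem_ofPred_eq, Set.mem_insert_iff, Set.mem_singleton_iff]
      have hunit : IsUnit (m : ZMod (2 ^ (k + 2))) ↔ ¬ 2 ∣ m := by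
        rw [ZMod.isUnit_iff_coprime, Nat.coprime_pow_right_iff (by omega), Nat.coprime_comm,
          Nat.Prime.coprime_iff_not_dvd Nat.prime_two]
      have htwo : (2 : ZMod (2 ^ (k + 2))) * m = 0 ↔ 2 ^ (k + 1) ∣ m := by
        have : (2 : ZMod (2 ^ (k + 2))) * m = ((2 * m : ℕ) : ZMod (2 ^ (k + 2))) := by push_cast; rfl
        rw [this, ZMod.natCast_eq_zero_iff, pow_succ' 2 (k + 1)]
        exact Nat.mul_dvd_mul_iff_left two_pos
      rw [hunit, htwo, ZMod.natCast_eq_zero_iff, ZMod.natCast_eq_natCast_iff']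
      constructor
      · rintro ⟨-, q, rfl⟩
        rcases Nat.even_or_odd' q with ⟨r, rfl | rfl⟩
        · left; exact ⟨r, by ring⟩
        · right
          have : 2 ^ (k + 1) * (2 * r + 1) = 2 ^ (k + 1) + 2 ^ (k + 2) * r := by ring
          rw [this, Nat.add_mul_mod_self_left]
      · have hd : 2 ∣ 2 ^ (k + 1) := dvd_pow_self 2 (by omega)
        have hd' : 2 ^ (k + 1) ∣ 2 ^ (k + 2) := pow_dvd_pow 2 (by omega)
        rintro (h | h)
        · exact ⟨not_not.2 ((hd.trans hd').trans h), hd'.trans h⟩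
        · have : 2 ^ (k + 1) ∣ m :=
            ((Nat.ModEq.dvd_iff h hd').2 dvd_rfl)
          exact ⟨not_not.2 (hd.trans this), this⟩
    have : Nat.card {t : ZMod (2 ^ (k + 2)) // ¬ IsUnit t ∧ 2 * t = 0} = 2 := by
      change Nat.card {t : ZMod (2 ^ (k + 2)) | ¬ IsUnit t ∧ 2 * t = 0} = 2
      rw [hset, Nat.card_coe_set_eq, Set.ncard_pair hne.symm]
    rw [this]
    ring
  · have : ((2 : ℕ) : ZMod (2 ^ (k + 2))) ≠ 0 := by
      rw [Ne, ZMod.natCast_eq_zero_iff]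
      exact Nat.not_dvd_of_pos_of_lt two_pos (by rw [pow_add]; omega)
    exact_mod_cast this

theorem realSquareCount_two : realSquareCount (ZMod 2) = 2 := by
  rw [realSquareCount, Nat.card_congr (Equiv.subtypeEquivRight fun x =>
    and_congr_left' (ZMod.isUnit_two_iff _)), Nat.card_eq_fintype_card]
  decide

theorem realSquareCount_eq (n : ℕ) (hn : 0 < n) :
    realSquareCount (ZMod n) =
      n.totient * 2 ^ (n.primeFactors.card + if 4 ∣ n then 1 else 0) := by
  induction n using Nat.recOnPosPrimePosCoprime with
  | prime_pow p k hp hk =>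
    rw [Nat.primeFactors_prime_pow hk.ne' hp, Finset.card_singleton]
    rcases eq_or_ne p 2 with rfl | h2
    · obtain rfl | ⟨k, rfl⟩ : k = 1 ∨ ∃ j, k = j + 2 := by
        rcases k with _ | _ | k <;> simp at *
      · rw [pow_one, realSquareCount_two]; decide
      · rw [realSquareCount_two_pow, if_pos ⟨2 ^ k, by ring⟩]; ring
    · obtain ⟨k, rfl⟩ := Nat.exists_eq_add_one.mpr hk
      have : ¬ 4 ∣ p ^ (k + 1) := fun h =>
        h2 ((Nat.prime_dvd_prime_iff_eq Nat.prime_two hp).1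
          (Nat.prime_two.dvd_of_dvd_pow ((by decide : 2 ∣ 4).trans h))).symm
      rw [realSquareCount_odd_prime_pow hp h2, if_neg this]; ring
  | zero => omega
  | one =>
    have : realSquareCount (ZMod 1) = 1 := by
      rw [realSquareCount, Nat.card_eq_one_iff_unique]
      exact ⟨inferInstance, ⟨⟨0, isUnit_of_subsingleton _, Subsingleton.elim _ _⟩⟩⟩
    simp [this]
  | coprime a b ha hb hab iha ihb =>
    have h4 : (if 4 ∣ a * b then 1 else 0) =
        (if 4 ∣ a then 1 else 0) + if 4 ∣ b then 1 else 0 := by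
      have key {a b : ℕ} (hab : a.Coprime b) (ha : 2 ∣ a) : 4 ∣ a * b ↔ 4 ∣ a := by
        refine Nat.Coprime.dvd_mul_right ?_
        have : Nat.Coprime 2 b := hab.coprime_dvd_left ha
        exact Nat.Coprime.pow_left 2 this
      by_cases h2 : 2 ∣ a
      · have hb2 : ¬ 4 ∣ b := fun h => by
          have := Nat.dvd_gcd h2 ((by decide : 2 ∣ 4).trans h)
          rw [hab.gcd_eq_one] at this; omega
        simp [key hab h2, hb2]
      · have ha4 : ¬ 4 ∣ a := fun h => h2 ((by decide : 2 ∣ 4).trans h)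
        have : 4 ∣ a * b ↔ 4 ∣ b := by
          refine Nat.Coprime.dvd_mul_left ?_
          exact Nat.Coprime.pow_left 2 ((Nat.Prime.coprime_iff_not_dvd Nat.prime_two).2 h2)
        simp [this, ha4]
    rw [realSquareCount_mul hab, iha (by omega), ihb (by omega), h4,
      hab.primeFactors_mul, Finset.card_union_of_disjoint hab.disjoint_primeFactors,
      Nat.totient_mul hab]
    ring

theorem imagSquareCount_of_even {n : ℕ} (h : 2 ∣ n) :
    imagSquareCount (ZMod n) = 0 := by
  rw [imagSquareCount, Nat.card_eq_zero]
  left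
  refine ⟨fun ⟨⟨s, t⟩, h1, h2⟩ => ?_⟩
  dsimp only at h1 h2
  have h3 : s ^ 2 + t ^ 2 = 2 * s ^ 2 := by linear_combination -h2
  rw [h3] at h1
  have h4 : IsUnit ((2 : ℕ) : ZMod n) := by
    exact_mod_cast isUnit_of_mul_isUnit_left h1
  rw [ZMod.isUnit_iff_coprime] at h4
  have := Nat.dvd_gcd dvd_rfl h
  rw [h4.gcd_eq_one] at this
  omega

theorem imagSquareCount_eq_realSquareCount {R : Type*} [CommRing R] (h : IsUnit (2 : R)) :
    imagSquareCount R = realSquareCount R := by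
  obtain ⟨c, hc⟩ := h.exists_right_inv
  have hc' (x : R) : 2 * (c * x) = x := by rw [← mul_assoc, hc, one_mul]
  let e : R × R ≃ R × R :=
    ⟨fun x => (x.1 + x.2, x.1 - x.2), fun x => (c * (x.1 + x.2), c * (x.1 - x.2)),
      fun x => Prod.ext (by dsimp only; linear_combination x.1 * hc)
        (by dsimp only; linear_combination x.2 * hc),
      fun x => Prod.ext (by dsimp only; linear_combination x.1 * hc)
        (by dsimp only; linear_combination x.2 * hc)⟩
  refine Nat.card_congr (Equiv.subtypeEquiv e ?_)
  rintro ⟨s, t⟩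
  have h1 : (s + t) ^ 2 + (s - t) ^ 2 = 2 * (s ^ 2 + t ^ 2) := by ring
  have h2 : 2 * (s + t) * (s - t) = 2 * (s ^ 2 - t ^ 2) := by ring
  simp only [e, Equiv.coe_fn_mk, h1, h2, IsUnit.mul_iff, h, true_and, h.mul_right_eq_zero]

theorem realSquareCount_add_imagSquareCount (n : ℕ) (hn : 1 < n) :
    ((realSquareCount (ZMod n) + imagSquareCount (ZMod n) : ℕ) : ℚ) = n.totient *
      (4 * (2 : ℚ) ^ ((n.primeFactors.card : ℤ) - (if n % 4 = 2 then 1 else 0) - 1)) := by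
  have h2 : (2 : ℚ) ≠ 0 := two_ne_zero
  by_cases he : 2 ∣ n
  · rw [imagSquareCount_of_even he, realSquareCount_eq n (by omega)]
    by_cases h4 : 4 ∣ n
    · rw [if_pos h4, if_neg (by omega)]
      push_cast
      rw [sub_zero, zpow_sub₀ h2, zpow_natCast]
      ring
    · rw [if_neg h4, if_pos (by omega)]
      push_cast
      rw [zpow_sub₀ h2, zpow_sub₀ h2, zpow_natCast]
      ring
  · have hu : IsUnit (2 : ZMod n) := by
      have := (ZMod.isUnit_iff_coprime 2 n).2 ((Nat.Prime.coprime_iff_not_dvd Nat.prime_two).2 he)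
      exact_mod_cast this
    rw [imagSquareCount_eq_realSquareCount hu, realSquareCount_eq n (by omega),
      if_neg (by omega), if_neg (by omega)]
    push_cast
    rw [sub_zero, zpow_sub₀ h2, zpow_natCast]
    ring

theorem Subgroup.card_fiber_inversion {G X : Type*} [CommGroup G] [Finite G] (S : Subgroup G)
    (f : G → X) (hsurj : Function.Surjective f)
    (hf : ∀ g h, f g = f h ↔ h / g ∈ S ∨ h * g ∈ S) :
    2 * Nat.card S * Nat.card X = Nat.card G + Nat.card {g : G // g ^ 2 ∈ S} := by
  classical
  have := Finite.of_surjective f hsurj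
  have := Fintype.ofFinite G
  have := Fintype.ofFinite X
  have hdiv (g : G) : ({h | h / g ∈ S} : Finset G).card = Nat.card S := by
    rw [← Fintype.card_subtype, ← Nat.card_eq_fintype_card]
    exact Nat.card_congr (Equiv.subtypeEquiv (Equiv.divRight g) fun h => Iff.rfl)
  have hmul (g : G) : ({h | h * g ∈ S} : Finset G).card = Nat.card S := by
    rw [← Fintype.card_subtype, ← Nat.card_eq_fintype_card]
    exact Nat.card_congr (Equiv.subtypeEquiv (Equiv.mulRight g) fun h => Iff.rfl)
  have hfiber (x : X) : ∑ g ∈ ({g | f g = x} : Finset G), (1 + if g ^ 2 ∈ S then 1 else 0) =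
      2 * Nat.card S := by
    obtain ⟨g, rfl⟩ := hsurj x
    have hset : ({h | f h = f g} : Finset G) =
        ({h | h / g ∈ S} : Finset G) ∪ ({h | h * g ∈ S} : Finset G) := by
      ext h
      simp only [Finset.mem_filter, Finset.mem_univ, true_and, Finset.mem_union]
      rw [eq_comm, hf]
    have hsq (h : G) (hh : h / g ∈ S ∨ h * g ∈ S) : h ^ 2 ∈ S ↔ g ^ 2 ∈ S := by
      rcases hh with hh | hh
      · have := S.pow_mem hh 2
        rw [div_pow] at this
        rw [← S.mul_mem_cancel_left (y := g ^ 2) this, div_mul_cancel]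
      · have := S.pow_mem hh 2
        rw [mul_pow] at this
        constructor
        · intro h2; exact (S.mul_mem_cancel_left h2).1 this
        · intro h2; exact (S.mul_mem_cancel_right h2).1 this
    have hsum : ∑ h ∈ ({h | f h = f g} : Finset G), (1 + if h ^ 2 ∈ S then 1 else 0) =
        ({h | f h = f g} : Finset G).card * (1 + if g ^ 2 ∈ S then 1 else 0) := by
      rw [Finset.sum_congr rfl fun h hh => ?_, Finset.sum_const, smul_eq_mul]
      rw [Finset.mem_filter, eq_comm, hf] at hh
      simp only [hsq h hh.2]
    rw [hsum, hset]
    by_cases hg : g ^ 2 ∈ S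
    · have heq : ({h | h * g ∈ S} : Finset G) = ({h | h / g ∈ S} : Finset G) := by
        ext h
        simp only [Finset.mem_filter, Finset.mem_univ, true_and]
        rw [← S.mul_mem_cancel_right (y := h / g) hg, pow_two, ← mul_assoc, div_mul_cancel]
      rw [heq, Finset.union_self, hdiv, if_pos hg]
      ring
    · have hdisj : Disjoint ({h | h / g ∈ S} : Finset G) ({h | h * g ∈ S} : Finset G) := by
        rw [Finset.disjoint_filter]
        intro h _ h1 h2
        apply hg
        have := S.div_mem h2 h1
        rwa [mul_div_div_cancel, ← pow_two] at this
      rw [Finset.card_union_of_disjoint hdisj, hdiv, hmul, if_neg hg]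
      ring
  have htotal := Finset.sum_fiberwise (s := (Finset.univ : Finset G)) (g := f)
    (f := fun g => 1 + if g ^ 2 ∈ S then 1 else 0)
  simp only [hfiber, Finset.sum_const, smul_eq_mul, Finset.sum_add_distrib, Finset.sum_boole,
    Nat.cast_id, ← Fintype.card_subtype, Finset.card_univ, mul_one] at htotal
  rw [Nat.card_eq_fintype_card (α := X), Nat.card_eq_fintype_card (α := G),
    Nat.card_eq_fintype_card (α := {g : G // g ^ 2 ∈ S}), ← htotal]
  ring

/-- The ring of Gaussian integers modulo `n`. -/
abbrev GaussMod (n : ℕ) : Type := QuadraticAlgebra (ZMod n) (-1) 0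

namespace GaussMod

open QuadraticAlgebra

variable {n : ℕ}

theorem im_inv_eq_zero {z : (GaussMod n)ˣ} (hz : z.val.im = 0) : z⁻¹.val.im = 0 := by
  have h := z.mul_inv
  have h1 := congrArg re h
  have h2 := congrArg im h
  simp only [re_mul, im_mul, hz, re_one, im_one] at h1 h2
  linear_combination (-z⁻¹.val.im) * h1 + z⁻¹.val.re * h2

theorem re_inv_eq_zero {z : (GaussMod n)ˣ} (hz : z.val.re = 0) : z⁻¹.val.re = 0 := by
  have h := z.mul_inv
  have h1 := congrArg re h
  have h2 := congrArg im h
  simp only [re_mul, im_mul, hz, re_one, im_one] at h1 h2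
  linear_combination (-z⁻¹.val.re) * h1 - z⁻¹.val.im * h2

/-- The units of `ℤ[i] / n` that are real or purely imaginary. -/
def axes (n : ℕ) : Subgroup (GaussMod n)ˣ where
  carrier := {z | z.val.re = 0 ∨ z.val.im = 0}
  one_mem' := Or.inr rfl
  mul_mem' := by
    rintro a b (ha | ha) (hb | hb) <;> simp [ha, hb]
  inv_mem' := Or.imp re_inv_eq_zero im_inv_eq_zero

theorem mem_axes {z : (GaussMod n)ˣ} : z ∈ axes n ↔ z.val.re = 0 ∨ z.val.im = 0 := Iff.rfl

theorem isUnit_iff {z : GaussMod n} : IsUnit z ↔ IsUnit (z.re ^ 2 + z.im ^ 2) := by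
  rw [isUnit_iff_norm_isUnit, norm_def]
  have : z.re * z.re + 0 * z.re * z.im - -1 * z.im * z.im = z.re ^ 2 + z.im ^ 2 := by ring
  rw [this]

/-- Units of `ℤ[i] / n` as pairs of residues of invertible norm. -/
noncomputable def unitsEquiv (n : ℕ) :
    (GaussMod n)ˣ ≃ {x : ZMod n × ZMod n // IsUnit (x.1 ^ 2 + x.2 ^ 2)} :=
  Equiv.ofBijective (fun z => ⟨(z.val.re, z.val.im), isUnit_iff.1 z.isUnit⟩) <| by
    constructor
    · intro z w h
      simp only [Subtype.mk.injEq, Prod.mk.injEq] at h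
      exact Units.ext (QuadraticAlgebra.ext h.1 h.2)
    · rintro ⟨⟨s, t⟩, h⟩
      exact ⟨(isUnit_iff.2 h : IsUnit (⟨s, t⟩ : GaussMod n)).unit, rfl⟩

theorem card_units : Nat.card (GaussMod n)ˣ = unitNormCount (ZMod n) :=
  Nat.card_congr (unitsEquiv n)

theorem card_sq_mem_axes (hn : 1 < n) : Nat.card {z : (GaussMod n)ˣ // z ^ 2 ∈ axes n} =
    realSquareCount (ZMod n) + imagSquareCount (ZMod n) := by
  classical
  have := NeZero.of_pos (zero_lt_one.trans hn)
  have : Fact (1 < n) := ⟨hn⟩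
  have e1 : {z : (GaussMod n)ˣ // z ^ 2 ∈ axes n} ≃ {x : ZMod n × ZMod n //
      (IsUnit (x.1 ^ 2 + x.2 ^ 2) ∧ 2 * x.1 * x.2 = 0) ∨
        (IsUnit (x.1 ^ 2 + x.2 ^ 2) ∧ x.1 ^ 2 - x.2 ^ 2 = 0)} := by
    refine (Equiv.subtypeEquiv (unitsEquiv n)
      (q := fun x => 2 * x.1.1 * x.1.2 = 0 ∨ x.1.1 ^ 2 - x.1.2 ^ 2 = 0) fun z => ?_).trans
      ((Equiv.subtypeSubtypeEquivSubtypeInter (fun x : ZMod n × ZMod n => IsUnit (x.1 ^ 2 + x.2 ^ 2))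
        (fun x => 2 * x.1 * x.2 = 0 ∨ x.1 ^ 2 - x.2 ^ 2 = 0)).trans
        (Equiv.subtypeEquivRight fun x => and_or_left))
    change (z ^ 2).val.re = 0 ∨ (z ^ 2).val.im = 0 ↔
      2 * z.val.re * z.val.im = 0 ∨ z.val.re ^ 2 - z.val.im ^ 2 = 0
    rw [or_comm, Units.val_pow_eq_pow_val, pow_two, re_mul, im_mul]
    refine or_congr (Eq.congr ?_ rfl) (Eq.congr ?_ rfl) <;> ring
  rw [Nat.card_congr e1, realSquareCount, imagSquareCount, ← Nat.card_sum]
  refine Nat.card_congr (subtypeOrEquiv _ _ ?_)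
  rw [Pi.disjoint_iff]
  intro x
  rw [Prop.disjoint_iff]
  rintro ⟨⟨h1, h2⟩, -, h3⟩
  have : (x.1 ^ 2 + x.2 ^ 2) ^ 2 = 0 := by
    linear_combination (x.1 ^ 2 - x.2 ^ 2) * h3 + 2 * x.1 * x.2 * h2
  exact (h1.pow 2).ne_zero this

theorem card_axes (hn : 1 < n) : Nat.card (axes n) = 2 * n.totient := by
  have := NeZero.of_pos (zero_lt_one.trans hn)
  have : Fact (1 < n) := ⟨hn⟩
  let f : Bool × (ZMod n)ˣ → axes n := fun x =>
    if x.1 then ⟨(isUnit_iff.2 (by simp) :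
        IsUnit (⟨x.2, 0⟩ : GaussMod n)).unit, Or.inr rfl⟩
      else ⟨(isUnit_iff.2 (by simp) :
        IsUnit (⟨0, x.2⟩ : GaussMod n)).unit, Or.inl rfl⟩
  have hf : Function.Bijective f := by
    constructor
    · rintro ⟨_ | _, u⟩ ⟨_ | _, u'⟩ h <;>
        simp [f, Subtype.ext_iff, Units.ext_iff, QuadraticAlgebra.ext_iff] at h
      · rw [Units.ext h]
      · rw [Units.ext h]
    · rintro ⟨z, hz⟩
      have hu := isUnit_iff.1 z.isUnit
      rcases hz with hz | hz
      · have hi : IsUnit z.val.im := by simpa [hz] using hu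
        refine ⟨(false, hi.unit), Subtype.ext (Units.ext ?_)⟩
        exact QuadraticAlgebra.ext hz.symm rfl
      · have hi : IsUnit z.val.re := by simpa [hz] using hu
        refine ⟨(true, hi.unit), Subtype.ext (Units.ext ?_)⟩
        exact QuadraticAlgebra.ext rfl hz.symm
  rw [← Nat.card_congr (Equiv.ofBijective f hf), Nat.card_prod, Nat.card_eq_fintype_card,
    Fintype.card_bool, Nat.card_eq_fintype_card, ZMod.card_units_eq_totient]

/-- Reduction modulo `n` of Gaussian integers. -/
def red (n : ℕ) : GaussianInt →+* GaussMod n where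
  toFun x := ⟨x.re, x.im⟩
  map_one' := by ext <;> simp
  map_zero' := by ext <;> simp
  map_add' x y := by ext <;> simp
  map_mul' x y := by ext <;> simp

@[simp] theorem red_re (x : GaussianInt) : (red n x).re = x.re := rfl

@[simp] theorem red_im (x : GaussianInt) : (red n x).im = x.im := rfl

theorem red_star (x : GaussianInt) : red n (star x) = star (red n x) := by ext <;> simp

theorem red_surjective : Function.Surjective (red n) := by
  intro z
  obtain ⟨a, ha⟩ := ZMod.intCast_surjective z.re
  obtain ⟨b, hb⟩ := ZMod.intCast_surjective z.im
  exact ⟨⟨a, b⟩, QuadraticAlgebra.ext ha hb⟩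

/-- A Gaussian integer is real relative to a unit `w` of `ℤ[i] / n` if it is congruent to a real
multiple of `w` modulo `n`. -/
def IsRealRel (w : (GaussMod n)ˣ) (x : GaussianInt) : Prop :=
  ∃ r : GaussMod n, r.im = 0 ∧ red n x = w * r

/-- A pair of Gaussian integers that is a basis of the lattice of all Gaussian integers that are
real relative to `w`. -/
structure IsFrame (w : (GaussMod n)ˣ) (u v : GaussianInt) : Prop where
  left : IsRealRel w u
  right : IsRealRel w v
  det : (star u * v).im = n ∨ (star u * v).im = -n

/-- A pair of Gaussian integers whose Gram matrix is reduced. -/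
structure IsReducedPair (u v : GaussianInt) : Prop where
  inner_nonneg : 0 ≤ (star u * v).re
  inner_le : 2 * (star u * v).re ≤ u.norm
  norm_le : u.norm ≤ v.norm

theorem IsRealRel.add {w : (GaussMod n)ˣ} {x y : GaussianInt} (hx : IsRealRel w x)
    (hy : IsRealRel w y) : IsRealRel w (x + y) := by
  obtain ⟨r, hr, hx⟩ := hx
  obtain ⟨s, hs, hy⟩ := hy
  exact ⟨r + s, by simp [hr, hs], by rw [map_add, hx, hy, mul_add]⟩

theorem IsRealRel.neg {w : (GaussMod n)ˣ} {x : GaussianInt} (hx : IsRealRel w x) :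
    IsRealRel w (-x) := by
  obtain ⟨r, hr, hx⟩ := hx
  exact ⟨-r, by simp [hr], by rw [map_neg, hx, mul_neg]⟩

theorem norm_mul_norm_eq (u v : GaussianInt) :
    u.norm * v.norm - (star u * v).re ^ 2 = (star u * v).im ^ 2 := by
  simp [Zsqrtd.norm_def]
  ring

theorem IsRealRel.dvd_det {w : (GaussMod n)ˣ} {x y : GaussianInt} (hx : IsRealRel w x)
    (hy : IsRealRel w y) : (n : ℤ) ∣ (star x * y).im := by
  obtain ⟨r, hr, hx⟩ := hx
  obtain ⟨s, hs, hy⟩ := hy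
  rw [← ZMod.intCast_zmod_eq_zero_iff_dvd, ← red_im, map_mul, red_star, hx, hy]
  simp [hr, hs]
  ring

theorem IsFrame.det_sq {w : (GaussMod n)ˣ} {u v : GaussianInt} (h : IsFrame w u v) :
    (star u * v).im ^ 2 = n ^ 2 := by
  rcases h.det with h | h <;> simp [h]

theorem IsFrame.exists_eq_combination (hn : 0 < n) {w : (GaussMod n)ˣ} {u v x : GaussianInt}
    (h : IsFrame w u v) (hx : IsRealRel w x) : ∃ a b : ℤ, x = a * u + b * v := by
  set δ := (star u * v).im with hδ
  have hn0 : (n : ℤ) ≠ 0 := by exact_mod_cast hn.ne'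
  have hδ0 : δ ≠ 0 := by
    rcases h.det with h | h <;> rw [← hδ] at h <;> omega
  have hdvd (z : ℤ) (hz : (n : ℤ) ∣ z) : δ ∣ z := by
    rcases h.det with h | h <;> rw [← hδ] at h
    · rwa [h]
    · rwa [h, neg_dvd]
  obtain ⟨a, ha⟩ := hdvd _ (hx.dvd_det h.right)
  obtain ⟨b, hb⟩ := hdvd _ (h.left.dvd_det hx)
  refine ⟨a, b, ?_⟩
  simp only [Zsqrtd.im_mul, Zsqrtd.re_star, Zsqrtd.im_star] at ha hb hδ
  ext
  · apply mul_left_cancel₀ hδ0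
    simp only [Zsqrtd.re_add, Zsqrtd.re_mul, Zsqrtd.re_intCast, Zsqrtd.im_intCast]
    linear_combination u.re * ha + v.re * hb + x.re * hδ
  · apply mul_left_cancel₀ hδ0
    simp only [Zsqrtd.im_add, Zsqrtd.im_mul, Zsqrtd.re_intCast, Zsqrtd.im_intCast]
    linear_combination u.im * ha + v.im * hb + x.im * hδ

theorem norm_combination (u v : GaussianInt) (a b : ℤ) :
    ((a : GaussianInt) * u + b * v).norm =
      a ^ 2 * u.norm + 2 * a * b * (star u * v).re + b ^ 2 * v.norm := by
  simp [Zsqrtd.norm_def]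
  ring

theorem det_combination (u v : GaussianInt) (a b c d : ℤ) :
    (star ((a : GaussianInt) * u + b * v) * (c * u + d * v)).im =
      (a * d - b * c) * (star u * v).im := by
  simp
  ring

theorem IsReducedPair.norm_right_le {u v : GaussianInt} (h : IsReducedPair u v) (a b : ℤ)
    (hb : b ≠ 0) : v.norm ≤ ((a : GaussianInt) * u + b * v).norm := by
  obtain ⟨h0, h1, h2⟩ := h
  rw [norm_combination]
  set A := u.norm
  set B := (star u * v).re
  set C := v.norm
  have hA : 0 ≤ A := by omega
  rcases le_or_gt 0 (a * b) with hab | hab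
  · have : 1 ≤ b ^ 2 := Int.one_le_abs hb |> fun h => by nlinarith [sq_abs b]
    nlinarith [mul_nonneg hab h0, mul_nonneg (sq_nonneg a) hA]
  · have hstep : a ^ 2 * A + a * b * A + b ^ 2 * C ≤ a ^ 2 * A + 2 * a * b * B + b ^ 2 * C := by
      nlinarith
    refine le_trans ?_ hstep
    have hb1 : 1 ≤ b ^ 2 := Int.one_le_abs hb |> fun h => by nlinarith [sq_abs b]
    have hq : 1 ≤ a ^ 2 + a * b + b ^ 2 := by
      have : 0 < 4 * (a ^ 2 + a * b + b ^ 2) := by nlinarith [sq_nonneg (2 * a + b)]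
      omega
    nlinarith

theorem IsReducedPair.norm_left_le {u v : GaussianInt} (h : IsReducedPair u v) (a b : ℤ)
    (hab : a ≠ 0 ∨ b ≠ 0) : u.norm ≤ ((a : GaussianInt) * u + b * v).norm := by
  by_cases hb : b = 0
  · subst hb
    have ha : a ≠ 0 := by tauto
    have : 1 ≤ a ^ 2 := Int.one_le_abs ha |> fun h => by nlinarith [sq_abs a]
    rw [norm_combination]
    nlinarith [GaussianInt.norm_nonneg u]
  · exact h.norm_le.trans (h.norm_right_le a b hb)

theorem IsFrame.norm_le_norm (hn : 0 < n) {w : (GaussMod n)ˣ} {u v u' v' : GaussianInt}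
    (h : IsFrame w u v) (hr : IsReducedPair u v) (h' : IsFrame w u' v')
    (hr' : IsReducedPair u' v') : u.norm ≤ u'.norm ∧ v.norm ≤ v'.norm := by
  obtain ⟨a, b, hu⟩ := h.exists_eq_combination hn h'.left
  obtain ⟨c, d, hv⟩ := h.exists_eq_combination hn h'.right
  have hdet := det_combination u v a b c d
  rw [← hu, ← hv] at hdet
  have h0 : a * d - b * c ≠ 0 := by
    intro h0
    have h1 := h'.det_sq
    rw [hdet, h0, zero_mul] at h1
    have : (n : ℤ) ≠ 0 := by exact_mod_cast hn.ne'
    exact this (pow_eq_zero_iff two_ne_zero |>.1 (by linarith))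
  constructor
  · rw [hu]
    refine hr.norm_left_le a b ?_
    by_contra! hab
    exact h0 (by rw [hab.1, hab.2]; ring)
  · by_cases hd : d = 0
    · refine le_trans ?_ hr'.norm_le
      rw [hu]
      refine hr.norm_right_le a b ?_
      rintro rfl
      exact h0 (by rw [hd]; ring)
    · rw [hv]
      exact hr.norm_right_le c d hd

theorem IsFrame.gram_unique (hn : 0 < n) {w : (GaussMod n)ˣ} {u v u' v' : GaussianInt}
    (h : IsFrame w u v) (hr : IsReducedPair u v) (h' : IsFrame w u' v')
    (hr' : IsReducedPair u' v') :
    u.norm = u'.norm ∧ (star u * v).re = (star u' * v').re ∧ v.norm = v'.norm := by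
  obtain ⟨h1, h2⟩ := h.norm_le_norm hn hr h' hr'
  obtain ⟨h3, h4⟩ := h'.norm_le_norm hn hr' h hr
  have hu := le_antisymm h1 h3
  have hv := le_antisymm h2 h4
  refine ⟨hu, ?_, hv⟩
  have e := norm_mul_norm_eq u v
  have e' := norm_mul_norm_eq u' v'
  rw [h.det_sq] at e
  rw [h'.det_sq] at e'
  rw [← sq_eq_sq₀ hr.inner_nonneg hr'.inner_nonneg]
  rw [hu, hv] at e
  linarith

theorem exists_isFrame (hn : 1 < n) (w : (GaussMod n)ˣ) : ∃ u v, IsFrame w u v := by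
  have : Fact (1 < n) := ⟨hn⟩
  obtain ⟨z, hz⟩ := red_surjective w.val
  have hunit := isUnit_iff.1 w.isUnit
  rw [← hz, red_re, red_im] at hunit
  have hg : (Int.gcd z.re z.im : ℤ) ≠ 0 := by
    intro h
    have h' := Int.gcd_eq_zero_iff.1 (by exact_mod_cast h)
    rw [h'.1, h'.2] at hunit
    simp at hunit
  obtain ⟨p, hp⟩ := Int.gcd_dvd_left z.re z.im
  obtain ⟨q, hq⟩ := Int.gcd_dvd_right z.re z.im
  have hbez := Int.gcd_eq_gcd_ab z.re z.im
  set g : ℤ := (Int.gcd z.re z.im : ℤ)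
  set s := Int.gcdA z.re z.im
  set t := Int.gcdB z.re z.im
  have hpq : p * s + q * t = 1 := by
    apply mul_left_cancel₀ hg
    rw [hp, hq] at hbez
    linarith
  have hgu : IsUnit (g : ZMod n) := by
    have h1 : ((z.re : ZMod n)) ^ 2 + (z.im : ZMod n) ^ 2 = g * (g * (p ^ 2 + q ^ 2)) := by
      rw [hp, hq]
      push_cast
      ring
    rw [h1] at hunit
    exact isUnit_of_mul_isUnit_left hunit
  obtain ⟨c, hc⟩ := hgu.exists_right_inv
  refine ⟨⟨p, q⟩, ⟨-n * t, n * s⟩, ⟨⟨c, 0⟩, rfl, ?_⟩, ⟨0, rfl, ?_⟩, Or.inl ?_⟩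
  · rw [← hz]
    ext
    · simp [hp]
      linear_combination (-(p : ZMod n)) * hc
    · simp [hq]
      linear_combination (-(q : ZMod n)) * hc
  · ext <;> simp
  · simp
    linear_combination (n : ℤ) * hpq

theorem exists_reduced_isFrame (hn : 1 < n) (w : (GaussMod n)ˣ) :
    ∃ u v, IsFrame w u v ∧ IsReducedPair u v := by
  let P : Set (GaussianInt × GaussianInt) := {x | IsFrame w x.1 x.2}
  have hP : P.Nonempty := by
    obtain ⟨u, v, h⟩ := exists_isFrame hn w
    exact ⟨(u, v), h⟩
  let m : GaussianInt × GaussianInt → ℕ := fun x => (x.1.norm + x.2.norm).toNat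
  obtain ⟨⟨u, v⟩, huv, hmin⟩ := exists_minimalFor_of_wellFoundedLT (· ∈ P) m hP
  have hmin' {x y : GaussianInt} (h : IsFrame w x y) : u.norm + v.norm ≤ x.norm + y.norm := by
    have h1 := hmin (j := (x, y)) h
    have := GaussianInt.norm_nonneg u
    have := GaussianInt.norm_nonneg v
    have := GaussianInt.norm_nonneg x
    have := GaussianInt.norm_nonneg y
    by_contra! h2
    have h3 := h1 (Int.toNat_le_toNat h2.le)
    simp only [m] at h3
    omega
  obtain ⟨u, v, huv, hmin', hle⟩ : ∃ u v, IsFrame w u v ∧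
      (∀ x y, IsFrame w x y → u.norm + v.norm ≤ x.norm + y.norm) ∧ u.norm ≤ v.norm := by
    rcases le_total u.norm v.norm with h | h
    · exact ⟨u, v, huv, fun x y => hmin', h⟩
    · refine ⟨v, u, ⟨huv.right, huv.left, ?_⟩, fun x y hxy => ?_, h⟩
      · have h1 : (star v * u).im = -(star u * v).im := by
          simp
          ring
        have := huv.det
        dsimp only at this
        omega
      · have := hmin' hxy
        omega
  obtain ⟨u, v, huv, hmin', hle, hnn⟩ : ∃ u v, IsFrame w u v ∧
      (∀ x y, IsFrame w x y → u.norm + v.norm ≤ x.norm + y.norm) ∧ u.norm ≤ v.norm ∧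
      0 ≤ (star u * v).re := by
    rcases le_total 0 (star u * v).re with h | h
    · exact ⟨u, v, huv, hmin', hle, h⟩
    · refine ⟨u, -v, ⟨huv.left, huv.right.neg, ?_⟩, ?_, ?_, ?_⟩
      · have := huv.det
        rw [mul_neg, Zsqrtd.im_neg]
        omega
      · rwa [Zsqrtd.norm_neg]
      · rwa [Zsqrtd.norm_neg]
      · rw [mul_neg, Zsqrtd.re_neg]
        omega
  refine ⟨u, v, huv, hnn, ?_, hle⟩
  have hframe : IsFrame w u (v + -u) := by
    refine ⟨huv.left, huv.right.add huv.left.neg, ?_⟩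
    have : (star u * (v + -u)).im = (star u * v).im := by
      simp
      ring
    rw [this]
    exact huv.det
  have h1 := hmin' _ _ hframe
  have h2 : (v + -u).norm = v.norm - 2 * (star u * v).re + u.norm := by
    simp [Zsqrtd.norm_def]
    ring
  omega

theorem exists_bezout {A B C N : ℤ} (h : A * C - B ^ 2 = N ^ 2)
    (hprim : ∀ p : ℕ, p.Prime → (p : ℤ) ∣ A → (p : ℤ) ∣ B → ¬ (p : ℤ) ∣ C) :
    ∃ x y z : ℤ, x * A + y * (2 * B) + z * C = 1 := by
  have hg : Int.gcd (Int.gcd A (2 * B)) C = 1 := by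
    by_contra hne
    obtain ⟨p, hp, hpg⟩ := Nat.exists_prime_and_dvd hne
    have hpg' : (p : ℤ) ∣ (Int.gcd (Int.gcd A (2 * B)) C : ℤ) := by exact_mod_cast hpg
    have hAB := hpg'.trans (Int.gcd_dvd_left _ _)
    have hC := hpg'.trans (Int.gcd_dvd_right _ _)
    have hA := hAB.trans (Int.gcd_dvd_left _ _)
    have hB := hAB.trans (Int.gcd_dvd_right _ _)
    rcases (Nat.prime_iff_prime_int.1 hp).dvd_or_dvd hB with h2 | hB
    · have hp2 : p = 2 := (Nat.prime_dvd_prime_iff_eq hp Nat.prime_two).1 (by exact_mod_cast h2)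
      subst hp2
      refine hprim 2 hp hA ?_ hC
      obtain ⟨a, rfl⟩ := hA
      obtain ⟨c, rfl⟩ := hC
      rcases Int.even_or_odd' B with ⟨b, rfl | rfl⟩
      · exact ⟨b, rfl⟩
      · exfalso
        rcases Int.even_or_odd' N with ⟨m, rfl | rfl⟩ <;> ring_nf at h <;> omega
    · exact hprim p hp hA hB hC
  have h1 := Int.gcd_eq_gcd_ab (Int.gcd A (2 * B)) C
  have h2 := Int.gcd_eq_gcd_ab A (2 * B)
  rw [hg] at h1
  refine ⟨Int.gcdA A (2 * B) * Int.gcdA (Int.gcd A (2 * B)) C,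
    Int.gcdB A (2 * B) * Int.gcdA (Int.gcd A (2 * B)) C, Int.gcdB (Int.gcd A (2 * B)) C, ?_⟩
  push_cast at h1
  linear_combination (-Int.gcdA (Int.gcd A (2 * B)) C) * h2 - h1

theorem IsFrame.exists_bezout (hn : 0 < n) {w : (GaussMod n)ˣ} {u v : GaussianInt}
    (h : IsFrame w u v) :
    ∃ x y z : ℤ, x * u.norm + y * (2 * (star u * v).re) + z * v.norm = 1 := by
  have hgram := norm_mul_norm_eq u v
  rw [h.det_sq] at hgram
  refine GaussMod.exists_bezout hgram fun p hp hA hB hC => ?_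
  have hpn : (p : ℤ) ∣ n := by
    refine (Nat.prime_iff_prime_int.1 hp).dvd_of_dvd_pow (n := 2) ?_
    rw [← hgram]
    exact dvd_sub (hA.mul_right _) (dvd_pow hB two_ne_zero)
  obtain ⟨z, hz⟩ := red_surjective w.val
  obtain ⟨a, b, hab⟩ := h.exists_eq_combination hn (x := z) ⟨1, rfl, by rw [hz, mul_one]⟩
  have hpz : (p : ℤ) ∣ z.norm := by
    rw [hab, norm_combination]
    exact dvd_add (dvd_add (hA.mul_left _) (hB.mul_left _)) (hC.mul_left _)
  have hunit := isUnit_iff.1 w.isUnit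
  have hnorm : z.norm = z.re ^ 2 + z.im ^ 2 := by
    rw [Zsqrtd.norm_def]
    ring
  rw [← hz, red_re, red_im, ← Int.cast_pow, ← Int.cast_pow, ← Int.cast_add, ← hnorm,
    ZMod.coe_int_isUnit_iff_isCoprime] at hunit
  exact (Nat.prime_iff_prime_int.1 hp).not_isUnit (hunit.isUnit_of_dvd' hpn hpz)

theorem star_mul_self_eq_norm (u : GaussianInt) : star u * u = (u.norm : ℤ) := by
  rw [Zsqrtd.norm_eq_mul_conj, mul_comm]

theorem exists_mul_eq_of_gram_eq {u v u' v' : GaussianInt} (hu : u.norm = u'.norm)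
    (hv : v.norm = v'.norm) (huv : star u * v = star u' * v') {x y z : ℤ}
    (hbez : x * u.norm + y * (2 * (star u * v).re) + z * v.norm = 1) :
    ∃ ε : GaussianInt, ε * u = u' ∧ ε * v = v' := by
  have e1 := star_mul_self_eq_norm u
  have e2 := star_mul_self_eq_norm u'
  have e3 : star v * u = star v' * u' := by
    have := congrArg star huv
    simpa only [star_mul, star_star] using this
  have e5 := star_mul_self_eq_norm v
  have e6 := star_mul_self_eq_norm v'
  rw [← hu] at e2
  rw [← hv] at e6
  have hre : star u * v + star v * u = 2 * ((star u * v).re : ℤ) := by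
    ext
    · simp
      ring
    · simp
      ring
  have hb : (x : GaussianInt) * (u.norm : ℤ) + y * (star u * v + star v * u) +
      z * (v.norm : ℤ) = 1 := by
    rw [hre]
    exact_mod_cast hbez
  refine ⟨x * u' * star u + y * (u' * star v + v' * star u) + z * v' * star v, ?_, ?_⟩
  · linear_combination (x * u' + y * v') * e1 - y * v' * e2 + z * v' * e3 + z * u' * e6
      - y * u' * huv + u' * hb
  · linear_combination x * u' * huv + x * v' * e2 + (y * u' + z * v') * e5 - y * u' * e6
      - y * v' * e3 + v' * hb

theorem eq_zero_or_eq_zero_of_norm_eq_one {ε : GaussianInt} (h : ε.norm = 1) :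
    ε.re = 0 ∨ ε.im = 0 := by
  rw [Zsqrtd.norm_def] at h
  by_contra! h0
  have h1 : 1 ≤ ε.re * ε.re := by
    have := mul_self_pos.2 h0.1
    omega
  have h2 : 1 ≤ ε.im * ε.im := by
    have := mul_self_pos.2 h0.2
    omega
  linarith

theorem IsFrame.norm_pos (hn : 0 < n) {w : (GaussMod n)ˣ} {u v : GaussianInt}
    (h : IsFrame w u v) : 0 < u.norm := by
  have hgram := norm_mul_norm_eq u v
  rw [h.det_sq] at hgram
  refine lt_of_le_of_ne (GaussianInt.norm_nonneg u) fun h0 => ?_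
  rw [← h0] at hgram
  have : 0 < (n : ℤ) ^ 2 := by positivity
  nlinarith [sq_nonneg (star u * v).re]

theorem IsFrame.inv_mul_mem_axes (hn : 0 < n) {w w' : (GaussMod n)ˣ} {u v u' v' : GaussianInt}
    (h : IsFrame w u v) (h' : IsFrame w' u' v') (hu : u.norm = u'.norm) (hv : v.norm = v'.norm)
    (huv : star u * v = star u' * v') : w'⁻¹ * w ∈ axes n := by
  obtain ⟨x, y, z, hbez⟩ := h.exists_bezout hn
  obtain ⟨ε, hεu, hεv⟩ := exists_mul_eq_of_gram_eq hu hv huv hbez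
  have hε : ε.norm = 1 := by
    have := congrArg Zsqrtd.norm hεu
    rw [Zsqrtd.norm_mul, ← hu] at this
    exact mul_right_cancel₀ (h.norm_pos hn).ne' (by rw [this, one_mul])
  have hεunit : IsUnit ε := Zsqrtd.norm_eq_one_iff.1 (by rw [hε]; rfl)
  let η : (GaussMod n)ˣ := Units.map (red n).toMonoidHom hεunit.unit
  have hη : η.val = red n ε := rfl
  have hηmem : η ∈ axes n := by
    rw [mem_axes, hη, red_re, red_im]
    exact (eq_zero_or_eq_zero_of_norm_eq_one hε).imp (fun h => by rw [h, Int.cast_zero])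
      fun h => by rw [h, Int.cast_zero]
  obtain ⟨r, hr, hru⟩ := h.left
  obtain ⟨q, hq, hqv⟩ := h.right
  obtain ⟨r', hr', hru'⟩ := h'.left
  obtain ⟨q', hq', hqv'⟩ := h'.right
  have hρ (t t' : GaussMod n) (ht : red n ε * (w * t) = w' * t') :
      (w'⁻¹ * w * η).val * t = t' := by
    rw [Units.val_mul, Units.val_mul, hη, mul_assoc, mul_assoc, mul_left_comm _ (red n ε), ht,
      Units.inv_mul_cancel_left]
  have hρr := congrArg im (hρ r r' (by rw [← hru, ← hru', ← hεu, map_mul]))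
  have hρq := congrArg im (hρ q q' (by rw [← hqv, ← hqv', ← hεv, map_mul]))
  simp only [im_mul, hr, hq, hr', hq', mul_zero, zero_mul, zero_add, add_zero] at hρr hρq
  have hur := congrArg re hru
  have hui := congrArg im hru
  have hvr := congrArg re hqv
  have hvi := congrArg im hqv
  simp only [red_re, red_im, re_mul, im_mul, hr, hq, mul_zero, zero_mul, zero_add, add_zero]
    at hur hui hvr hvi
  have hbez' := congrArg (Int.cast : ℤ → ZMod n) hbez
  simp only [Zsqrtd.norm_def, Zsqrtd.re_mul, Zsqrtd.re_star, Zsqrtd.im_star] at hbez'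
  push_cast at hbez'
  rw [hur, hui, hvr, hvi] at hbez'
  have hmem : w'⁻¹ * w * η ∈ axes n := by
    right
    set ρ := (w'⁻¹ * w * η).val
    set N := (w.val.re ^ 2 + w.val.im ^ 2)
    linear_combination (-ρ.im) * hbez' + N * (x * r.re + 2 * y * q.re) * hρr + N * z * q.re * hρq
  exact ((axes n).mul_mem_cancel_right hηmem).1 hmem

theorem IsRealRel.conj {w : (GaussMod n)ˣ} {x : GaussianInt} (hx : IsRealRel w x) :
    IsRealRel w⁻¹ (star x) := by
  obtain ⟨r, hr, hx⟩ := hx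
  refine ⟨w * red n (star x), ?_, by rw [Units.inv_mul_cancel_left]⟩
  rw [red_star, hx]
  simp [hr]
  ring

theorem det_star (u v : GaussianInt) : (star (star u) * star v).im = -(star u * v).im := by
  simp
  ring

theorem inner_star (u v : GaussianInt) : (star (star u) * star v).re = (star u * v).re := by
  simp

theorem IsFrame.conj {w : (GaussMod n)ˣ} {u v : GaussianInt} (h : IsFrame w u v) :
    IsFrame w⁻¹ (star u) (star v) := by
  refine ⟨h.left.conj, h.right.conj, ?_⟩
  rw [det_star, neg_inj, neg_eq_iff_eq_neg]
  exact h.det.symm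

theorem IsReducedPair.conj {u v : GaussianInt} (h : IsReducedPair u v) :
    IsReducedPair (star u) (star v) := by
  obtain ⟨h0, h1, h2⟩ := h
  constructor <;> simpa only [inner_star, Zsqrtd.norm_conj]

/-- The triple `T` is the Gram matrix of a reduced basis of the lattice attached to `w`. -/
def IsReducedGram (w : (GaussMod n)ˣ) (T : ℤ × ℤ × ℤ) : Prop :=
  ∃ u v, IsFrame w u v ∧ IsReducedPair u v ∧ (u.norm, (star u * v).re, v.norm) = T

theorem IsReducedGram.inv {w : (GaussMod n)ˣ} {T : ℤ × ℤ × ℤ} (h : IsReducedGram w T) :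
    IsReducedGram w⁻¹ T := by
  obtain ⟨u, v, hf, hr, rfl⟩ := h
  exact ⟨_, _, hf.conj, hr.conj, by rw [inner_star, Zsqrtd.norm_conj, Zsqrtd.norm_conj]⟩

theorem IsReducedGram.mul {w s : (GaussMod n)ˣ} {T : ℤ × ℤ × ℤ} (h : IsReducedGram w T)
    (hs : s ∈ axes n) : IsReducedGram (w * s) T := by
  obtain ⟨u, v, hf, hr, rfl⟩ := h
  rcases hs with hs | hs
  · have hreal {x : GaussianInt} (hx : IsRealRel w x) : IsRealRel (w * s) (⟨0, 1⟩ * x) := by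
      obtain ⟨r, hr, hx⟩ := hx
      refine ⟨s⁻¹ * (red n ⟨0, 1⟩ * r), ?_, ?_⟩
      · simp [hr, re_inv_eq_zero hs]
      · rw [map_mul, hx, Units.val_mul, mul_assoc, Units.mul_inv_cancel_left]
        ring
    have hmul : star (⟨0, 1⟩ * u : GaussianInt) * (⟨0, 1⟩ * v) = star u * v := by
      ext <;> simp <;> ring
    have hnorm (x : GaussianInt) : (⟨0, 1⟩ * x : GaussianInt).norm = x.norm := by
      rw [Zsqrtd.norm_mul]
      simp [Zsqrtd.norm_def]
    refine ⟨⟨0, 1⟩ * u, ⟨0, 1⟩ * v, ⟨hreal hf.left, hreal hf.right, ?_⟩, ?_, ?_⟩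
    · rw [hmul]
      exact hf.det
    · obtain ⟨h0, h1, h2⟩ := hr
      constructor <;> simpa only [hmul, hnorm]
    · rw [hmul, hnorm, hnorm]
  · have hreal {x : GaussianInt} (hx : IsRealRel w x) : IsRealRel (w * s) x := by
      obtain ⟨r, hr, hx⟩ := hx
      refine ⟨s⁻¹ * r, ?_, ?_⟩
      · simp [hr, im_inv_eq_zero hs]
      · rw [hx, Units.val_mul, mul_assoc, Units.mul_inv_cancel_left]
    exact ⟨u, v, ⟨hreal hf.left, hreal hf.right, hf.det⟩, hr, rfl⟩

theorem IsReducedGram.div_mem_or_mul_mem (hn : 0 < n) {w w' : (GaussMod n)ˣ} {T : ℤ × ℤ × ℤ}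
    (h : IsReducedGram w T) (h' : IsReducedGram w' T) : w' / w ∈ axes n ∨ w' * w ∈ axes n := by
  obtain ⟨u, v, hf, hr, rfl⟩ := h
  obtain ⟨u', v', hf', hr', heq⟩ := h'
  simp only [Prod.mk.injEq] at heq
  obtain ⟨hu, huv, hv⟩ := heq
  have hdet : (star u * v).im = (star u' * v').im ∨ (star u * v).im = -(star u' * v').im := by
    rcases hf.det with h | h <;> rcases hf'.det with h' | h' <;> rw [h, h'] <;> simp
  rcases hdet with hdet | hdet
  · left
    have := hf.inv_mul_mem_axes hn hf' hu.symm hv.symm (Zsqrtd.ext huv.symm hdet)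
    rw [← inv_mem_iff]
    simpa [div_eq_mul_inv, mul_comm] using this
  · right
    have := hf.inv_mul_mem_axes hn hf'.conj (by rw [Zsqrtd.norm_conj, hu])
      (by rw [Zsqrtd.norm_conj, hv])
      (Zsqrtd.ext (by rw [inner_star, huv]) (by rw [det_star, hdet]))
    rwa [inv_inv] at this

theorem exists_gram {A B C N : ℤ} (hA : 0 < A) (h : A * C - B ^ 2 = N ^ 2) {x y z : ℤ}
    (hbez : x * A + y * (2 * B) + z * C = 1) :
    ∃ u v : GaussianInt, u.norm = A ∧ star u * v = ⟨B, N⟩ ∧ v.norm = C := by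
  set D : GaussianInt := ⟨B, N⟩ with hD
  have hDD : D * star D = A * C := by
    rw [← Zsqrtd.norm_eq_mul_conj, Zsqrtd.norm_def]
    have : D.re * D.re - -1 * D.im * D.im = A * C := by
      simp only [hD]
      linear_combination -h
    rw [this]
    push_cast
    rfl
  have hDadd : D + star D = 2 * B := by
    ext
    · simp [hD]
      ring
    · simp [hD]
  have hbez' : (x : GaussianInt) * A + y * (2 * B) + z * C = 1 := by exact_mod_cast hbez
  set g : GaussianInt := EuclideanDomain.gcd (A : GaussianInt) D with hg
  obtain ⟨s, hs⟩ := EuclideanDomain.gcd_dvd_left (A : GaussianInt) D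
  obtain ⟨t, ht⟩ := EuclideanDomain.gcd_dvd_right (A : GaussianInt) D
  have hab := EuclideanDomain.gcd_eq_gcd_ab (A : GaussianInt) D
  rw [← hg] at hs ht hab
  set a := EuclideanDomain.gcdA (A : GaussianInt) D
  set b := EuclideanDomain.gcdB (A : GaussianInt) D
  have hstarA : star (A : GaussianInt) = A := by ext <;> simp
  have hs' : (A : GaussianInt) = star g * star s := by
    rw [← hstarA, hs, star_mul, mul_comm]
  have ht' : star D = star g * star t := by
    rw [ht, star_mul, mul_comm]
  have hab' : star g = A * star a + star D * star b := by
    rw [hab, star_add, star_mul, star_mul, hstarA]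
    ring
  have hdvd : (A : GaussianInt) ∣ (g.norm : ℤ) := by
    rw [Zsqrtd.norm_eq_mul_conj]
    refine ⟨A * a * star a + a * star D * star b + star a * D * b + C * b * star b, ?_⟩
    rw [hab']
    nth_rewrite 1 [hab]
    linear_combination b * star b * hDD
  have hdvd' : ((g.norm : ℤ) : GaussianInt) ∣ A := by
    rw [Zsqrtd.norm_eq_mul_conj]
    refine ⟨x * (s * star s) + y * (star s * t + s * star t) + z * (t * star t), ?_⟩
    have e1 : g * star g * (s * star s) = A * A := by
      nth_rewrite 1 [hs]
      rw [hs']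
      ring
    have e2 : g * star g * (star s * t) = A * D := by
      rw [hs', ht]
      ring
    have e3 : g * star g * (s * star t) = A * star D := by
      rw [hs, ht']
      ring
    have e4 : g * star g * (t * star t) = D * star D := by
      linear_combination (-star D) * ht - g * t * ht'
    linear_combination (-x) * e1 - y * e2 - y * e3 - z * e4 - z * hDD - A * y * hDadd - A * hbez'
  have hnorm : g.norm = A :=
    Int.dvd_antisymm (GaussianInt.norm_nonneg g) hA.le ((Zsqrtd.intCast_dvd_intCast _ _).1 hdvd')
      ((Zsqrtd.intCast_dvd_intCast _ _).1 hdvd)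
  refine ⟨star g, t, by rw [Zsqrtd.norm_conj, hnorm], by rw [star_star, ht], ?_⟩
  have := congrArg Zsqrtd.norm ht
  rw [Zsqrtd.norm_mul, hnorm, Zsqrtd.norm_def] at this
  simp only [hD] at this
  apply mul_left_cancel₀ hA.ne'
  linear_combination -this - h

theorem exists_isCoprime_form {A B C : ℤ} {x y z : ℤ} (hbez : x * A + y * (2 * B) + z * C = 1)
    {n : ℕ} (hn : 0 < n) :
    ∃ a b : ℤ, IsCoprime (a ^ 2 * A + 2 * a * b * B + b ^ 2 * C) (n : ℤ) := by
  classical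
  have hprod (P : ℕ → Prop) [DecidablePred P] {p : ℕ} (hp : p ∈ n.primeFactors) :
      (p : ℤ) ∣ ((∏ q ∈ n.primeFactors with P q, q : ℕ) : ℤ) ↔ P p := by
    have hpp := Nat.prime_of_mem_primeFactors hp
    rw [Int.natCast_dvd_natCast, hpp.prime.dvd_finsetProd_iff]
    constructor
    · rintro ⟨q, hq, hpq⟩
      rw [Finset.mem_filter] at hq
      rw [(Nat.prime_dvd_prime_iff_eq hpp (Nat.prime_of_mem_primeFactors hq.1)).1 hpq]
      exact hq.2
    · exact fun h => ⟨p, Finset.mem_filter.2 ⟨hp, h⟩, dvd_rfl⟩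
  let P (q : ℕ) : Prop := (q : ℤ) ∣ A ∧ ¬ (q : ℤ) ∣ C
  let Q (q : ℕ) : Prop := ¬ (q : ℤ) ∣ A
  let a : ℤ := ((∏ q ∈ n.primeFactors with P q, q : ℕ) : ℤ)
  let b : ℤ := ((∏ q ∈ n.primeFactors with Q q, q : ℕ) : ℤ)
  refine ⟨a, b, ?_⟩
  rw [Int.isCoprime_iff_gcd_eq_one]
  by_contra hne
  obtain ⟨p, hp, hpg⟩ := Nat.exists_prime_and_dvd hne
  have hpg' : (p : ℤ) ∣ (Int.gcd (a ^ 2 * A + 2 * a * b * B + b ^ 2 * C) (n : ℤ) : ℤ) := by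
    exact_mod_cast hpg
  have hpf := hpg'.trans (Int.gcd_dvd_left _ _)
  have hpn : p ∈ n.primeFactors := Nat.mem_primeFactors.2
    ⟨hp, Int.natCast_dvd_natCast.1 (hpg'.trans (Int.gcd_dvd_right _ _)), hn.ne'⟩
  have ha : (p : ℤ) ∣ a ↔ (p : ℤ) ∣ A ∧ ¬ (p : ℤ) ∣ C := hprod P hpn
  have hb : (p : ℤ) ∣ b ↔ ¬ (p : ℤ) ∣ A := hprod Q hpn
  have hpi := Nat.prime_iff_prime_int.1 hp
  by_cases hA : (p : ℤ) ∣ A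
  · have hb' : ¬ (p : ℤ) ∣ b := fun h => hb.1 h hA
    by_cases hC : (p : ℤ) ∣ C
    · have ha' : ¬ (p : ℤ) ∣ a := fun h => (ha.1 h).2 hC
      have h2B : (p : ℤ) ∣ a * (b * (2 * B)) := by
        rw [show a * (b * (2 * B)) =
          a ^ 2 * A + 2 * a * b * B + b ^ 2 * C - a ^ 2 * A - b ^ 2 * C by ring]
        exact dvd_sub (dvd_sub hpf (hA.mul_left _)) (hC.mul_left _)
      have hB := (hpi.dvd_or_dvd ((hpi.dvd_or_dvd h2B).resolve_left ha')).resolve_left hb'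
      exact hpi.not_dvd_one (hbez ▸ dvd_add (dvd_add (hA.mul_left x) (hB.mul_left y))
        (hC.mul_left z))
    · have ha' : (p : ℤ) ∣ a := ha.2 ⟨hA, hC⟩
      have : (p : ℤ) ∣ b ^ 2 * C := by
        rw [show b ^ 2 * C =
          a ^ 2 * A + 2 * a * b * B + b ^ 2 * C - a * (a * A + 2 * b * B) by ring]
        exact dvd_sub hpf (ha'.mul_right _)
      exact (hpi.dvd_or_dvd this).elim (fun h => hb' (hpi.dvd_of_dvd_pow h)) hC
  · have hb' : (p : ℤ) ∣ b := hb.2 hA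
    have ha' : ¬ (p : ℤ) ∣ a := fun h => hA (ha.1 h).1
    have : (p : ℤ) ∣ a ^ 2 * A := by
      rw [show a ^ 2 * A =
        a ^ 2 * A + 2 * a * b * B + b ^ 2 * C - b * (2 * a * B + b * C) by ring]
      exact dvd_sub hpf (hb'.mul_right _)
    exact (hpi.dvd_or_dvd this).elim (fun h => ha' (hpi.dvd_of_dvd_pow h)) hA

theorem isRealRel_of_dvd {w : (GaussMod n)ˣ} {z x : GaussianInt} (hz : red n z = w)
    (h : (n : ℤ) ∣ (star z * x).im) : IsRealRel w x := by
  refine ⟨w⁻¹ * red n x, ?_, by rw [Units.mul_inv_cancel_left]⟩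
  set r := w⁻¹.val * red n x with hr
  have hx : red n x = w * r := by rw [hr, Units.mul_inv_cancel_left]
  rw [← ZMod.intCast_zmod_eq_zero_iff_dvd, ← red_im, map_mul, red_star, hz, hx] at h
  have hunit := isUnit_iff.1 w.isUnit
  apply hunit.mul_left_cancel
  rw [mul_zero]
  refine Eq.trans ?_ h
  simp
  ring

/-- The reduced primitive positive definite forms `A X² + 2 B X Y + C Y²` of determinant `n²`, up
to the sign of `B`, where primitivity refers to the coefficients `A`, `2 B`, `C`. -/
def reducedForms (n : ℕ) : Set (ℤ × ℤ × ℤ) :=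
  {T | T.1 * T.2.2 - T.2.1 ^ 2 = n ^ 2 ∧ 0 ≤ T.2.1 ∧ 2 * T.2.1 ≤ T.1 ∧ T.1 ≤ T.2.2 ∧
    ∃ x y z : ℤ, x * T.1 + y * (2 * T.2.1) + z * T.2.2 = 1}

theorem fst_pos_of_mem_reducedForms (hn : 0 < n) {T : ℤ × ℤ × ℤ} (hT : T ∈ reducedForms n) :
    0 < T.1 := by
  obtain ⟨hdet, h0, h1, -⟩ := hT
  have : 0 < (n : ℤ) ^ 2 := by positivity
  refine lt_of_le_of_ne (by linarith) fun h => ?_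
  rw [← h] at hdet
  nlinarith [sq_nonneg T.2.1]

theorem IsReducedGram.mem_reducedForms (hn : 0 < n) {w : (GaussMod n)ˣ} {T : ℤ × ℤ × ℤ}
    (h : IsReducedGram w T) : T ∈ reducedForms n := by
  obtain ⟨u, v, hf, hr, rfl⟩ := h
  exact ⟨(norm_mul_norm_eq u v).trans hf.det_sq, hr.inner_nonneg, hr.inner_le, hr.norm_le,
    hf.exists_bezout hn⟩

theorem exists_isReducedGram (hn : 0 < n) {T : ℤ × ℤ × ℤ} (hT : T ∈ reducedForms n) :
    ∃ w : (GaussMod n)ˣ, IsReducedGram w T := by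
  have hpos := fst_pos_of_mem_reducedForms hn hT
  obtain ⟨A, B, C⟩ := T
  obtain ⟨hdet, h0, h1, h2, x, y, z, hbez⟩ := hT
  dsimp only at hdet h0 h1 h2 hbez hpos
  obtain ⟨u, v, hu, huv, hv⟩ := exists_gram hpos hdet hbez
  obtain ⟨a, b, hab⟩ := exists_isCoprime_form hbez hn
  have hre : (star u * v).re = B := by rw [huv]
  have him : (star u * v).im = n := by rw [huv]
  set t : GaussianInt := a * u + b * v with ht
  have htnorm : t.norm = a ^ 2 * A + 2 * a * b * B + b ^ 2 * C := by
    rw [ht, norm_combination, hu, hre, hv]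
  have hunit : IsUnit (red n t) := by
    rw [isUnit_iff, red_re, red_im, ← Int.cast_pow, ← Int.cast_pow, ← Int.cast_add,
      ZMod.coe_int_isUnit_iff_isCoprime]
    have : t.re ^ 2 + t.im ^ 2 = t.norm := by
      rw [Zsqrtd.norm_def]
      ring
    rw [this, htnorm]
    exact hab.symm
  refine ⟨hunit.unit, u, v, ⟨isRealRel_of_dvd (z := t) rfl ⟨-b, ?_⟩,
    isRealRel_of_dvd (z := t) rfl ⟨a, ?_⟩, Or.inl him⟩, ⟨?_, ?_, ?_⟩, ?_⟩
  · rw [← him, ht]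
    simp
    ring
  · rw [← him, ht]
    simp
    ring
  · rwa [hre]
  · rwa [hre, hu]
  · rwa [hu, hv]
  · rw [hu, hre, hv]

theorem exists_isReducedGram_of_unit (hn : 1 < n) (w : (GaussMod n)ˣ) :
    ∃ T : ℤ × ℤ × ℤ, IsReducedGram w T := by
  obtain ⟨u, v, hf, hr⟩ := exists_reduced_isFrame hn w
  exact ⟨_, u, v, hf, hr, rfl⟩

theorem IsReducedGram.unique (hn : 0 < n) {w : (GaussMod n)ˣ} {T T' : ℤ × ℤ × ℤ}
    (h : IsReducedGram w T) (h' : IsReducedGram w T') : T = T' := by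
  obtain ⟨u, v, hf, hr, rfl⟩ := h
  obtain ⟨u', v', hf', hr', rfl⟩ := h'
  obtain ⟨h1, h2, h3⟩ := hf.gram_unique hn hr hf' hr'
  rw [h1, h2, h3]

theorem card_reducedForms (hn : 1 < n) :
    4 * n.totient * Nat.card (reducedForms n) =
      unitNormCount (ZMod n) + (realSquareCount (ZMod n) + imagSquareCount (ZMod n)) := by
  have hn0 : 0 < n := zero_lt_one.trans hn
  have := NeZero.of_pos hn0
  have := Finite.of_equiv _ (unitsEquiv n).symm
  choose T hT using exists_isReducedGram_of_unit hn
  have hcard := Subgroup.card_fiber_inversion (axes n)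
    (fun w => (⟨T w, (hT w).mem_reducedForms hn0⟩ : reducedForms n)) ?_ ?_
  · rw [card_axes hn, card_units, card_sq_mem_axes hn] at hcard
    rw [← hcard]
    ring
  · rintro ⟨F, hF⟩
    obtain ⟨w, hw⟩ := exists_isReducedGram hn0 hF
    exact ⟨w, Subtype.ext ((hT w).unique hn0 hw)⟩
  · intro w w'
    rw [Subtype.mk.injEq]
    constructor
    · intro h
      exact (hT w).div_mem_or_mul_mem hn0 (h ▸ hT w')
    · rintro (h | h)
      · have := (hT w).mul h
        rw [mul_div_cancel] at this
        exact this.unique hn0 (hT w')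
      · have := (hT w).inv.mul h
        rw [mul_comm w', inv_mul_cancel_left] at this
        exact this.unique hn0 (hT w')

/-- The root quadruple attached to a reduced form. -/
def toQuadruple (n : ℕ) (T : ℤ × ℤ × ℤ) : ℤ × ℤ × ℤ :=
  (T.1 + n, T.2.2 + n, n + T.1 + T.2.2 - 2 * T.2.1)

theorem toQuadruple_injective : Function.Injective (toQuadruple n) := by
  rintro ⟨A, B, C⟩ ⟨A', B', C'⟩ h
  simp only [toQuadruple, Prod.mk.injEq] at h ⊢
  omega

theorem mem_reducedForms_iff (hn : 0 < n) (T : ℤ × ℤ × ℤ) :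
    T ∈ reducedForms n ↔ toQuadruple n T ∈ PrimRootSet n := by
  obtain ⟨A, B, C⟩ := T
  constructor
  · intro hT
    have hpos := fst_pos_of_mem_reducedForms hn hT
    obtain ⟨hdet, h0, h1, h2, x, y, z, hbez⟩ := hT
    dsimp only at hdet h0 h1 h2 hbez hpos
    refine ⟨?_, ?_, ?_, ?_, ?_, ?_, ?_⟩ <;> simp only [toQuadruple]
    · linear_combination (-4) * hdet
    · omega
    · omega
    · omega
    · omega
    · omega
    · by_contra hne
      obtain ⟨p, hp, hpg⟩ := Nat.exists_prime_and_dvd hne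
      simp only [Int.gcd, Nat.dvd_gcd_iff, Int.natAbs_natCast, ← Int.natCast_dvd,
        Int.natAbs_neg] at hpg
      obtain ⟨⟨⟨hpn, hpx⟩, hpy⟩, hpz⟩ := hpg
      have hpn : (p : ℤ) ∣ n := Int.natCast_dvd_natCast.2 hpn
      have hA := (dvd_add_left hpn).1 hpx
      have hC := (dvd_add_left hpn).1 hpy
      have hB := (dvd_sub_right (dvd_add (dvd_add hpn hA) hC)).1 hpz
      exact (Nat.prime_iff_prime_int.1 hp).not_dvd_one
        (hbez ▸ dvd_add (dvd_add (hA.mul_left x) (hB.mul_left y)) (hC.mul_left z))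
  · rintro ⟨hdesc, h0, h1, h2, h3, h4, hgcd⟩
    simp only [toQuadruple] at hdesc h0 h1 h2 h3 h4 hgcd
    have hdet : A * C - B ^ 2 = (n : ℤ) ^ 2 := by linarith
    refine ⟨hdet, by dsimp only; omega, by dsimp only; omega, by dsimp only; omega,
      exists_bezout hdet fun p hp hA hB hC => ?_⟩
    have hpn : (p : ℤ) ∣ n := by
      refine (Nat.prime_iff_prime_int.1 hp).dvd_of_dvd_pow (n := 2) ?_
      rw [← hdet]
      exact dvd_sub (hA.mul_right _) (dvd_pow hB two_ne_zero)
    refine hp.not_dvd_one (hgcd ▸ ?_)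
    rw [← Int.natCast_dvd_natCast]
    refine Int.dvd_coe_gcd (Int.dvd_coe_gcd (Int.dvd_coe_gcd ?_ ?_) ?_) ?_
    · exact hpn.neg_right
    · exact dvd_add hA hpn
    · exact dvd_add hC hpn
    · exact dvd_sub (dvd_add (dvd_add hpn hA) hC) (hB.mul_left 2)

theorem exists_toQuadruple_eq {q : ℤ × ℤ × ℤ} (hq : q ∈ PrimRootSet n) :
    ∃ T, toQuadruple n T = q := by
  obtain ⟨x, y, z⟩ := q
  have hdesc := hq.1
  dsimp only at hdesc
  have heven : Even (-(n : ℤ) + x + y + z) := by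
    rw [← Int.even_pow' two_ne_zero, ← hdesc]
    exact even_two_mul _
  obtain ⟨k, hk⟩ := heven
  refine ⟨(x - n, k - z, y - n), ?_⟩
  simp only [toQuadruple, Prod.mk.injEq]
  omega

theorem card_primRootSet (hn : 0 < n) : Nat.card (PrimRootSet n) = Nat.card (reducedForms n) := by
  have : PrimRootSet n = toQuadruple n '' reducedForms n := by
    ext q
    constructor
    · intro hq
      obtain ⟨T, rfl⟩ := exists_toQuadruple_eq hq
      exact ⟨T, (mem_reducedForms_iff hn T).2 hq, rfl⟩
    · rintro ⟨T, hT, rfl⟩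
      exact (mem_reducedForms_iff hn T).1 hT
  rw [this, Nat.card_image_of_injective toQuadruple_injective]

end GaussMod

/-- **Exact formula for the number of primitive root quadruples.**
For `n > 1`,
`N*_root(-n) = (n/4) ∏_{p ∣ n} (1 - χ₋₄(p)/p) + 2^(ω(n) - δₙ - 1)`,
where `ω(n)` is the number of distinct prime factors of `n` and `δₙ = 1` iff
`n ≡ 2 (mod 4)`. -/
theorem card_primitive_root_quadruples (n : ℕ) (hn : 1 < n) :
    (Nat.card (PrimRootSet n) : ℚ) =
      (n : ℚ) / 4 * ∏ p ∈ n.primeFactors, (1 - ((ZMod.χ₄ (p : ZMod 4) : ℤ) : ℚ) / p) +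
        (2 : ℚ) ^ ((n.primeFactors.card : ℤ) - (if n % 4 = 2 then 1 else 0) - 1) := by
  have hcard := congrArg (Nat.cast : ℕ → ℚ) (GaussMod.card_reducedForms hn)
  rw [Nat.cast_add, realSquareCount_add_imagSquareCount n hn,
    unitNormCount_eq n (zero_lt_one.trans hn), ← GaussMod.card_primRootSet (zero_lt_one.trans hn)]
    at hcard
  push_cast at hcard
  have htot : (4 * (n.totient : ℚ)) ≠ 0 := by
    have := (Nat.totient_pos.2 (zero_lt_one.trans hn)).ne'
    positivity
  apply mul_left_cancel₀ htot
  rw [hcard]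
  ring
end

section
/- There are positive constants C₁ and C₂ such that for all integers n ≥ 3, C₁·n/log log n < N*_root(−n) < C₂·n·log log n, where N*_root(−n) is the number of primitive integer root quadruples (a,b,c,d) with a = −n. -/
section

open Finset

theorem Real.tsum_rpow_neg_le {δ : ℝ} (hδ : 0 < δ) :
    ∑' m : ℕ, (m : ℝ) ^ (-(1 + δ)) ≤ 1 + 1 / δ := by
  have key : ∀ N : ℕ, ∑ m ∈ range (N + 2), (m : ℝ) ^ (-(1 + δ)) ≤
      1 + 1 / δ - ((N : ℝ) + 1) ^ (-δ) / δ := by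
    intro N
    induction N with
    | zero =>
      have : -δ + -1 ≠ 0 := by linarith
      simp [sum_range_succ, Real.zero_rpow this]
    | succ N ih =>
      rw [sum_range_succ]
      have h1 : (0 : ℝ) < (N : ℝ) + 1 := by positivity
      have h2 : (0 : ℝ) < (N : ℝ) + 2 := by positivity
      have hs : ((N : ℝ) + 2) ^ (-(1 + δ)) = ((N : ℝ) + 2) ^ (-δ) / (N + 2) := by
        rw [show -(1 + δ) = -δ - 1 by ring, Real.rpow_sub_one h2.ne']
      have hq : 1 + δ / (N + 2) ≤ (((N : ℝ) + 1) / (N + 2)) ^ (-δ) := by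
        have hpos : 0 < ((N : ℝ) + 1) / (N + 2) := by positivity
        rw [Real.rpow_def_of_pos hpos]
        have hl := Real.log_le_sub_one_of_pos hpos
        have he := Real.add_one_le_exp (Real.log (((N : ℝ) + 1) / (N + 2)) * -δ)
        have : ((N : ℝ) + 1) / (N + 2) - 1 = - (1 / (N + 2)) := by field_simp; ring
        rw [this] at hl
        have := mul_le_mul_of_nonneg_left hl hδ.le
        have h3 : δ * -(1 / ((N : ℝ) + 2)) = - (δ / (N + 2)) := by ring
        linarith
      rw [Real.div_rpow h1.le h2.le, le_div_iff₀ (Real.rpow_pos_of_pos h2 _)] at hq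
      have hq' : ((N : ℝ) + 2) ^ (-(1 + δ)) ≤
          (((N : ℝ) + 1) ^ (-δ) - ((N : ℝ) + 2) ^ (-δ)) / δ := by
        rw [le_div_iff₀ hδ, hs]
        have : (1 + δ / ((N : ℝ) + 2)) * ((N : ℝ) + 2) ^ (-δ) =
          ((N : ℝ) + 2) ^ (-δ) + ((N : ℝ) + 2) ^ (-δ) / (N + 2) * δ := by ring
        linarith
      have e1 : (((N + 1 : ℕ) : ℝ) + 1) = (N : ℝ) + 2 := by push_cast; ring
      have e2 : ((N + 2 : ℕ) : ℝ) = (N : ℝ) + 2 := by push_cast; ring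
      rw [e1, e2]
      rw [sub_div] at hq'
      linarith
  have hnn : ∀ m : ℕ, 0 ≤ (m : ℝ) ^ (-(1 + δ)) := fun m ↦ Real.rpow_nonneg m.cast_nonneg _
  refine Real.tsum_le_of_sum_range_le hnn fun N ↦ ?_
  calc _ ≤ ∑ m ∈ range (N + 2), (m : ℝ) ^ (-(1 + δ)) :=
        sum_le_sum_of_subset_of_nonneg (range_mono (by lia)) fun _ _ _ ↦ hnn _
    _ ≤ _ := key N
    _ ≤ _ := by
      have : 0 ≤ ((N : ℝ) + 1) ^ (-δ) / δ := by positivity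
      linarith

theorem Nat.sum_primesBelow_log_div_le (K : ℕ) :
    ∑ p ∈ K.primesBelow, Real.log p / p ≤ 2 * Real.log K := by
  rcases Nat.eq_zero_or_pos K with rfl | hK
  · simp
  have hdvd : ∏ p ∈ K.primesBelow, p ^ (K / p) ∣ K.factorial := by
    refine Finset.prod_dvd_of_isRelPrime ?_ ?_
    · intro p hp q hq hpq
      have hp := (Nat.mem_primesBelow.1 hp)
      have hq := (Nat.mem_primesBelow.1 hq)
      exact Nat.coprime_iff_isRelPrime.1 (Nat.Coprime.pow _ _
        ((Nat.coprime_primes hp.2 hq.2).2 hpq))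
    · intro p hp
      have hp := (Nat.mem_primesBelow.1 hp)
      rw [hp.2.pow_dvd_factorial_iff (Nat.lt_succ_self (Nat.log p K))]
      refine le_trans (by simp) (single_le_sum (f := fun i ↦ K / p ^ i) (fun _ _ ↦ Nat.zero_le _)
        (mem_Ico.2 ⟨le_refl 1, ?_⟩))
      have := Nat.log_pos hp.2.one_lt hp.1.le
      lia
  have hle : ∏ p ∈ K.primesBelow, p ^ (K / p) ≤ K ^ K :=
    (Nat.le_of_dvd (Nat.factorial_pos _) hdvd).trans (Nat.factorial_le_pow _)
  have hR : ∏ p ∈ K.primesBelow, (p : ℝ) ^ (K / p) ≤ (K : ℝ) ^ K := by exact_mod_cast hle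
  have hlog := Real.log_le_log (prod_pos fun p hp ↦
    pow_pos (Nat.cast_pos.2 (Nat.mem_primesBelow.1 hp).2.pos) _) hR
  rw [Real.log_prod fun p hp ↦ (pow_pos (Nat.cast_pos.2 (Nat.mem_primesBelow.1 hp).2.pos) _).ne',
    Real.log_pow] at hlog
  have hKR : (0 : ℝ) < K := Nat.cast_pos.2 hK
  have : ∑ p ∈ K.primesBelow, Real.log p / p * (K / 2) ≤ K * Real.log K := by
    refine le_trans (sum_le_sum fun p hp ↦ ?_) hlog
    have hp := Nat.mem_primesBelow.1 hp
    have hpR : (0 : ℝ) < p := Nat.cast_pos.2 hp.2.pos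
    rw [Real.log_pow]
    have h1 : 1 ≤ K / p := (Nat.one_le_div_iff hp.2.pos).2 hp.1.le
    have h2 := Nat.div_add_mod K p
    have h3 := Nat.mod_lt K hp.2.pos
    have h4 : K ≤ 2 * (p * (K / p)) := by nlinarith
    have h5 : (K : ℝ) ≤ 2 * (p * (K / p : ℕ)) := by exact_mod_cast h4
    have h6 : (K : ℝ) / 2 / p ≤ (K / p : ℕ) := by
      rw [div_le_iff₀ hpR]; linarith
    have h7 : 0 ≤ Real.log p := Real.log_natCast_nonneg p
    calc Real.log p / p * (K / 2) = K / 2 / p * Real.log p := by ring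
      _ ≤ _ := mul_le_mul_of_nonneg_right h6 h7
  rw [← sum_mul] at this
  nlinarith

theorem Real.one_sub_inv_inv_le_mul_exp {x δ : ℝ} (hx : 2 ≤ x) (hδ : 0 < δ) :
    (1 - 1 / x)⁻¹ ≤ (1 - x ^ (-(1 + δ)))⁻¹ * Real.exp (2 * (δ * (Real.log x / x))) := by
  have hx0 : 0 < x := by linarith
  have h1 : 1 / x ≤ 1 / 2 := one_div_le_one_div_of_le (by norm_num) hx
  have hs : x ^ (-(1 + δ)) = x ^ (-δ) / x := by
    rw [show -(1 + δ) = -δ - 1 by ring, Real.rpow_sub_one hx0.ne']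
  have hd1 : x ^ (-δ) < 1 := Real.rpow_lt_one_of_one_lt_of_neg (by linarith) (by linarith)
  have hd2 : 1 - δ * Real.log x ≤ x ^ (-δ) := by
    rw [Real.rpow_def_of_pos hx0]
    have := Real.add_one_le_exp (Real.log x * -δ)
    linarith
  have hlt : x ^ (-(1 + δ)) < 1 / x := by
    rw [hs]; gcongr
  have hge : 1 / x - x ^ (-(1 + δ)) ≤ δ * (Real.log x / x) := by
    rw [hs, ← sub_div, ← mul_div_assoc]
    gcongr
    linarith
  have he := Real.add_one_le_exp (2 * (δ * (Real.log x / x)))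
  have hlx : 0 ≤ δ * (Real.log x / x) := by
    have : 0 ≤ Real.log x := Real.log_nonneg (by linarith)
    positivity
  rw [inv_mul_eq_div, inv_eq_one_div, div_le_div_iff₀ (by linarith) (by linarith)]
  nlinarith

theorem Nat.prod_primesBelow_inv_le {K : ℕ} (hK : 2 ≤ K) :
    ∏ p ∈ K.primesBelow, (1 - 1 / (p : ℝ))⁻¹ ≤ (1 + Real.log K) * Real.exp 4 := by
  have hl : 0 < Real.log K := Real.log_pos (by exact_mod_cast hK)
  set δ : ℝ := 1 / Real.log K with hδ
  have hδ0 : 0 < δ := by positivity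
  let f : ℕ →* ℝ :=
    { toFun := fun m ↦ (m : ℝ) ^ (-(1 + δ))
      map_one' := by simp
      map_mul' := fun a b ↦ by
        simp only [Nat.cast_mul]
        exact Real.mul_rpow a.cast_nonneg b.cast_nonneg }
  have hf : ∀ m : ℕ, f m = (m : ℝ) ^ (-(1 + δ)) := fun _ ↦ rfl
  have hsum : Summable f := by
    have := (Real.summable_nat_rpow (p := -(1 + δ))).2 (by linarith)
    exact this
  have hprod := EulerProduct.prod_primesBelow_geometric_eq_tsum_smoothNumbers hsum K
  have hz : ∏ p ∈ K.primesBelow, (1 - (p : ℝ) ^ (-(1 + δ)))⁻¹ ≤ 1 + Real.log K := by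
    have h1 : ∑' m : ↥(Nat.smoothNumbers K), f m ≤ ∑' m : ℕ, f m :=
      hsum.tsum_subtype_le _ _ (fun m ↦ Real.rpow_nonneg m.cast_nonneg _)
    have h2 := Real.tsum_rpow_neg_le hδ0
    have h3 : 1 / δ = Real.log K := by rw [hδ, one_div_one_div]
    rw [h3] at h2
    exact hprod.le.trans (h1.trans h2)
  have hpos : ∀ p ∈ K.primesBelow, 0 ≤ (1 - (p : ℝ) ^ (-(1 + δ)))⁻¹ := fun p hp ↦ by
    have : (1 : ℝ) < p := by exact_mod_cast (Nat.mem_primesBelow.1 hp).2.one_lt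
    have := Real.rpow_lt_one_of_one_lt_of_neg this (z := -(1 + δ)) (by linarith)
    rw [inv_nonneg]; linarith
  calc ∏ p ∈ K.primesBelow, (1 - 1 / (p : ℝ))⁻¹
      ≤ ∏ p ∈ K.primesBelow, ((1 - (p : ℝ) ^ (-(1 + δ)))⁻¹ *
          Real.exp (2 * (δ * (Real.log p / p)))) := by
        refine prod_le_prod (fun p hp ↦ ?_) fun p hp ↦ ?_
        · have : (1 : ℝ) < p := by exact_mod_cast (Nat.mem_primesBelow.1 hp).2.one_lt
          have : 1 / (p : ℝ) < 1 := by rw [div_lt_one (by linarith)]; exact this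
          rw [inv_nonneg]; linarith
        · exact Real.one_sub_inv_inv_le_mul_exp
            (by exact_mod_cast (Nat.mem_primesBelow.1 hp).2.two_le) hδ0
    _ = (∏ p ∈ K.primesBelow, (1 - (p : ℝ) ^ (-(1 + δ)))⁻¹) *
          Real.exp (2 * (δ * ∑ p ∈ K.primesBelow, Real.log p / p)) := by
        rw [prod_mul_distrib, ← Real.exp_sum, mul_sum, mul_sum]
    _ ≤ (1 + Real.log K) * Real.exp 4 := by
        refine mul_le_mul hz (Real.exp_le_exp.2 ?_) (Real.exp_pos _).le (by linarith)
        have := mul_le_mul_of_nonneg_left (Nat.sum_primesBelow_log_div_le K) hδ0.le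
        have h3 : δ * (2 * Real.log K) = 2 := by rw [hδ]; field_simp
        linarith

theorem Nat.card_primeFactors_mul_log_two_le {n : ℕ} (hn : n ≠ 0) :
    (#n.primeFactors : ℝ) * Real.log 2 ≤ Real.log n := by
  have h : 2 ^ #n.primeFactors ≤ n :=
    (pow_card_le_prod _ _ _ fun p hp ↦ (Nat.prime_of_mem_primeFactors hp).two_le).trans
      (Nat.le_of_dvd (Nat.pos_of_ne_zero hn) (Nat.prod_primeFactors_dvd n))
  have h' : (2 : ℝ) ^ #n.primeFactors ≤ n := by exact_mod_cast h
  have := Real.log_le_log (by positivity) h'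
  rwa [Real.log_pow] at this

theorem Nat.self_le_mul_totient {n K : ℕ} (hn : n ≠ 0) (hK : 2 ≤ K) (hnK : Real.log n ≤ K) :
    (n : ℝ) ≤ (1 + Real.log K) * Real.exp 8 * n.totient := by
  have htot : (n.totient : ℝ) = n * ∏ p ∈ n.primeFactors, (1 - 1 / (p : ℝ)) := by
    have := congrArg (Rat.cast : ℚ → ℝ) (Nat.totient_eq_mul_prod_factors n)
    push_cast at this
    simpa using this
  have hp2 : ∀ p ∈ n.primeFactors, (2 : ℝ) ≤ p := fun p hp ↦ by
    exact_mod_cast (Nat.prime_of_mem_primeFactors hp).two_le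
  have hhalf : ∀ p : ℝ, 2 ≤ p → 1 / p ≤ 1 / 2 := fun p hp ↦
    one_div_le_one_div_of_le (by norm_num) hp
  have hprod : ∏ p ∈ n.primeFactors, (1 - 1 / (p : ℝ))⁻¹ ≤ (1 + Real.log K) * Real.exp 8 := by
    have hl : 0 < Real.log K := Real.log_pos (by exact_mod_cast hK)
    have hKR : (0 : ℝ) < K := by positivity
    rw [← prod_filter_mul_prod_filter_not n.primeFactors (· < K),
      show (8 : ℝ) = 4 + 4 by norm_num, Real.exp_add, ← mul_assoc]
    refine mul_le_mul ?_ ?_ (prod_nonneg fun p hp ↦ ?_) (by positivity)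
    · refine le_trans ?_ (Nat.prod_primesBelow_inv_le hK)
      refine prod_le_prod_of_subset_of_one_le ?_ (fun p hp ↦ ?_) fun p hp _ ↦ ?_
      · intro p hp
        rw [mem_filter] at hp
        exact Nat.mem_primesBelow.2 ⟨hp.2, Nat.prime_of_mem_primeFactors hp.1⟩
      · have := hhalf p (hp2 p (mem_filter.1 hp).1)
        rw [inv_nonneg]; linarith
      · have h2 : (2 : ℝ) ≤ p := by exact_mod_cast (Nat.mem_primesBelow.1 hp).2.two_le
        have := hhalf p h2
        have h0 : 0 ≤ 1 / (p : ℝ) := by positivity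
        rw [one_le_inv₀ (by linarith)]; linarith
    · have hterm : ∀ p ∈ n.primeFactors.filter (¬ · < K),
          (1 - 1 / (p : ℝ))⁻¹ ≤ Real.exp (2 / K) := by
        intro p hp
        rw [mem_filter, not_lt] at hp
        have h2 := hp2 p hp.1
        have hh := hhalf p h2
        have hpK : 1 / (p : ℝ) ≤ 1 / K := one_div_le_one_div_of_le hKR (by exact_mod_cast hp.2)
        have h0 : 0 ≤ 1 / (p : ℝ) := by positivity
        have he := Real.add_one_le_exp (2 / (K : ℝ))
        have : 2 / (K : ℝ) = 2 * (1 / K) := by ring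
        rw [inv_le_iff_one_le_mul₀ (by linarith)]
        nlinarith
      refine (prod_le_prod (fun p hp ↦ ?_) hterm).trans ?_
      · have := hhalf p (hp2 p (mem_filter.1 hp).1)
        rw [inv_nonneg]; linarith
      · rw [prod_const, ← Real.exp_nat_mul]
        refine Real.exp_le_exp.2 ?_
        have h1 := Nat.card_primeFactors_mul_log_two_le hn
        have h2 : (#(n.primeFactors.filter (¬ · < K)) : ℝ) ≤ #n.primeFactors := by
          exact_mod_cast card_filter_le _ _
        have h3 : 1 / 2 ≤ Real.log 2 := by linarith [Real.log_two_gt_d9]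
        rw [mul_div_assoc', div_le_iff₀ hKR]
        have h4 : (0 : ℝ) ≤ #n.primeFactors := by positivity
        nlinarith
    · have := hhalf p (hp2 p (mem_filter.1 hp).1)
      rw [inv_nonneg]; linarith
  have hPpos : 0 < ∏ p ∈ n.primeFactors, (1 - 1 / (p : ℝ)) := prod_pos fun p hp ↦ by
    have := hhalf p (hp2 p hp)
    linarith
  rw [prod_inv_distrib, inv_le_iff_one_le_mul₀ hPpos] at hprod
  rw [htot]
  have hn0 : (0 : ℝ) ≤ n := by positivity
  nlinarith

theorem Nat.exists_self_le_mul_log_log_mul_totient :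
    ∃ C : ℝ, 0 < C ∧ ∀ n : ℕ, 3 ≤ n →
      0 < Real.log (Real.log n) ∧ (n : ℝ) ≤ C * Real.log (Real.log n) * n.totient := by
  have hlog3 : 1 < Real.log 3 := by
    rw [Real.lt_log_iff_exp_lt (by norm_num)]
    linarith [Real.exp_one_lt_d9]
  have hc : 0 < Real.log (Real.log 3) := Real.log_pos hlog3
  set c := Real.log (Real.log 3)
  refine ⟨(1 + 3 / c) * Real.exp 8, by positivity, fun n hn ↦ ?_⟩
  have h3n : Real.log 3 ≤ Real.log n := Real.log_le_log (by norm_num) (by exact_mod_cast hn)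
  have hcn : c ≤ Real.log (Real.log n) := Real.log_le_log (by linarith) h3n
  refine ⟨by linarith, ?_⟩
  have hK := Nat.self_le_mul_totient (n := n) (K := ⌈Real.log n⌉₊) (by lia)
    (by
      have : 1 < ⌈Real.log n⌉₊ := Nat.lt_ceil.2 (by push_cast; linarith)
      lia) (Nat.le_ceil _)
  refine hK.trans ?_
  have h1 : Real.log ⌈Real.log n⌉₊ ≤ 2 + Real.log (Real.log n) := by
    have hle : (⌈Real.log n⌉₊ : ℝ) ≤ 2 * Real.log n := by
      have := Nat.ceil_lt_add_one (a := Real.log n) (by linarith)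
      linarith
    have hpos : (0 : ℝ) < ⌈Real.log n⌉₊ := by
      have := Nat.le_ceil (Real.log n)
      linarith
    have := Real.log_le_log hpos hle
    rw [Real.log_mul (by norm_num) (by linarith)] at this
    linarith [Real.log_two_lt_d9]
  have h2 : 3 ≤ 3 / c * Real.log (Real.log n) := by
    rw [div_mul_eq_mul_div, le_div_iff₀ hc]; linarith
  have h3 : 1 + Real.log ⌈Real.log n⌉₊ ≤ (1 + 3 / c) * Real.log (Real.log n) := by linarith
  have h4 := mul_le_mul_of_nonneg_right h3 (Real.exp_pos 8).le
  calc _ ≤ (1 + 3 / c) * Real.log (Real.log n) * Real.exp 8 * n.totient :=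
        mul_le_mul_of_nonneg_right h4 (by positivity)
    _ = _ := by ring

theorem Nat.totient_mul_le (a b : ℕ) : (a * b).totient ≤ a.totient * b := by
  rcases Nat.eq_zero_or_pos (a * b) with h | h
  · simp [h]
  have ha : 0 < a := Nat.pos_of_mul_pos_right h
  have hQ : ((a * b).totient : ℚ) ≤ a.totient * b := by
    rw [Nat.totient_eq_mul_prod_factors, Nat.totient_eq_mul_prod_factors a]
    have hle : ∏ p ∈ (a * b).primeFactors, (1 - (p : ℚ)⁻¹) ≤
        ∏ p ∈ a.primeFactors, (1 - (p : ℚ)⁻¹) :=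
      prod_le_prod_of_subset_of_le_one (Nat.primeFactors_mono (Nat.dvd_mul_right a b) h.ne')
        (fun p hp ↦ sub_nonneg.2 (Nat.cast_inv_le_one p)) fun p hp _ ↦ by simp
    have := mul_le_mul_of_nonneg_left hle (by positivity : (0 : ℚ) ≤ a * b)
    push_cast
    linarith
  exact_mod_cast hQ

theorem Nat.sum_divisors_mul_totient_le (n : ℕ) : (∑ d ∈ n.divisors, d) * n.totient ≤ n ^ 2 := by
  calc (∑ d ∈ n.divisors, d) * n.totient = ∑ d ∈ n.divisors, d * n.totient := sum_mul _ _ _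
    _ ≤ ∑ d ∈ n.divisors, n * d.totient := by
        refine sum_le_sum fun d hd ↦ ?_
        obtain ⟨e, rfl⟩ := Nat.dvd_of_mem_divisors hd
        have := Nat.mul_le_mul_left d (Nat.totient_mul_le d e)
        linarith
    _ = n ^ 2 := by rw [← mul_sum, Nat.sum_totient, sq]

/-- Triples `(A, B, C)` such that `A x² + 2 B x y + C y²` is a primitive form of determinant `n²`,
reduced for the action of `GL₂(ℤ)`. -/
def ReducedForms (n : ℕ) : Set (ℤ × ℤ × ℤ) :=
  {f | f.1 * f.2.2 = f.2.1 ^ 2 + (n : ℤ) ^ 2 ∧ 0 ≤ f.2.1 ∧ 2 * f.2.1 ≤ f.1 ∧ f.1 ≤ f.2.2 ∧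
    0 < f.1 ∧ ∃ k l m : ℤ, k * f.1 + l * (2 * f.2.1) + m * f.2.2 = 1}

theorem exists_bezout_of_forall_prime {a b c : ℤ}
    (h : ∀ p : ℕ, p.Prime → (p : ℤ) ∣ a → (p : ℤ) ∣ b → (p : ℤ) ∣ c → False) :
    ∃ k l m : ℤ, k * a + l * b + m * c = 1 := by
  have hg : Int.gcd (Int.gcd a b) c = 1 := by
    by_contra hne
    obtain ⟨p, hp, hpd⟩ := Nat.exists_prime_and_dvd hne
    have hpd' := Int.natCast_dvd_natCast.2 hpd
    have h1 := hpd'.trans (Int.gcd_dvd_left _ _)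
    exact h p hp (h1.trans (Int.gcd_dvd_left _ _)) (h1.trans (Int.gcd_dvd_right _ _))
      (hpd'.trans (Int.gcd_dvd_right _ _))
  have h1 := Int.gcd_eq_gcd_ab a b
  have h2 := Int.gcd_eq_gcd_ab (Int.gcd a b) c
  rw [hg] at h2
  refine ⟨Int.gcdA a b * Int.gcdA (Int.gcd a b) c, Int.gcdB a b * Int.gcdA (Int.gcd a b) c,
    Int.gcdB (Int.gcd a b) c, ?_⟩
  push_cast at h2
  linear_combination -h2 - Int.gcdA (Int.gcd a b) c * h1

theorem Nat.Prime.intCast_dvd_of_dvd_form {p : ℕ} (hp : p.Prime) {A B C N : ℤ}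
    (hdet : A * C = B ^ 2 + N ^ 2) (hA : (p : ℤ) ∣ A) (hB2 : (p : ℤ) ∣ 2 * B)
    (hC : (p : ℤ) ∣ C) : (p : ℤ) ∣ N := by
  rcases hp.eq_two_or_odd' with rfl | hodd
  · obtain ⟨a, ha⟩ := hA
    obtain ⟨c, hc⟩ := hC
    push_cast at *
    rw [ha, hc] at hdet
    rcases Int.even_or_odd' N with ⟨t, ht | ht⟩
    · exact ⟨t, ht⟩
    · exfalso
      rcases Int.even_or_odd' B with ⟨s, hs | hs⟩ <;> rw [hs, ht] at hdet <;> ring_nf at hdet <;>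
        omega
  · have h4 : (p : ℤ) ∣ (2 * N) ^ 2 := by
      have : (2 * N) ^ 2 = 4 * C * A - (2 * B) * (2 * B) := by
        linear_combination -4 * hdet
      rw [this]
      exact _root_.dvd_sub (hA.mul_left _) (hB2.mul_left _)
    have h2 := (Nat.prime_iff_prime_int.1 hp).dvd_of_dvd_pow h4
    rcases (Nat.prime_iff_prime_int.1 hp).dvd_or_dvd h2 with h | h
    · have : p ∣ 2 := by exact_mod_cast h
      rw [Nat.prime_dvd_prime_iff_eq hp Nat.prime_two] at this
      subst this
      exact absurd hodd (by decide)
    · exact h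

theorem mem_primRootSet_of_mem_reducedForms {n : ℕ} (hn : 0 < n) {A B C : ℤ}
    (h : (A, B, C) ∈ ReducedForms n) :
    (A + n, C + n, A + C - 2 * B + n) ∈ PrimRootSet n := by
  obtain ⟨hdet, hB, hBA, hAC, hA, k, l, m, hklm⟩ := h
  simp only at hdet hB hBA hAC hA hklm
  refine ⟨?_, ?_, ?_, ?_, ?_, ?_, ?_⟩ <;> simp only
  · linear_combination -4 * hdet
  · positivity
  · linarith
  · linarith
  · linarith
  · have : (0 : ℤ) < n := by exact_mod_cast hn
    linarith
  · by_contra hne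
    obtain ⟨p, hp, hpd⟩ := Nat.exists_prime_and_dvd hne
    have hpd' := Int.natCast_dvd_natCast.2 hpd
    have h4 := hpd'.trans (Int.gcd_dvd_right _ _)
    have h123 := hpd'.trans (Int.gcd_dvd_left _ _)
    have h3 := h123.trans (Int.gcd_dvd_right _ _)
    have h12 := h123.trans (Int.gcd_dvd_left _ _)
    have h1 := (h12.trans (Int.gcd_dvd_left _ _))
    have h2 := h12.trans (Int.gcd_dvd_right _ _)
    rw [dvd_neg] at h1
    have hpA := (Int.dvd_add_left h1).1 h2
    have hpC := (Int.dvd_add_left h1).1 h3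
    have hpB : (p : ℤ) ∣ 2 * B := by
      have := (Int.dvd_add_left h1).1 h4
      have := (Int.dvd_sub (Int.dvd_add hpA hpC) this)
      rwa [sub_sub_cancel] at this
    have : (p : ℤ) ∣ 1 := by
      rw [← hklm]
      exact dvd_add (dvd_add (hpA.mul_left _) (hpB.mul_left _)) (hpC.mul_left _)
    exact hp.one_lt.ne' (by exact_mod_cast Int.eq_one_of_dvd_one (by positivity) this)

theorem exists_mem_reducedForms_of_mem_primRootSet {n : ℕ} (hn : 0 < n) {x y z : ℤ}
    (h : (x, y, z) ∈ PrimRootSet n) :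
    ∃ B, (x - n, B, y - n) ∈ ReducedForms n ∧ z = (x - n) + (y - n) - 2 * B + n := by
  obtain ⟨heq, hx, hxy, hyz, hz, hs, hg⟩ := h
  simp only at heq hx hxy hyz hz hs hg
  have hnZ : (0 : ℤ) < n := by exact_mod_cast hn
  have hE : (x + y - n - z) ^ 2 = 4 * ((x - n) * (y - n) - n ^ 2) := by linear_combination heq
  have heven : 2 ∣ x + y - n - z := by
    have : (2 : ℤ) ∣ (x + y - n - z) ^ 2 := by
      rw [hE]; exact ⟨2 * ((x - n) * (y - n) - n ^ 2), by ring⟩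
    exact Int.prime_two.dvd_of_dvd_pow this
  obtain ⟨B, hB⟩ := heven
  have hdet : (x - n) * (y - n) = B ^ 2 + (n : ℤ) ^ 2 := by
    rw [hB] at hE
    linarith
  refine ⟨B, ⟨hdet, ?_, ?_, ?_, ?_, ?_⟩, by linarith⟩
  · simp only; linarith
  · simp only; linarith
  · simp only; linarith
  · simp only
    have h0 : 0 ≤ x - n := by linarith
    rcases h0.lt_or_eq with h | h
    · exact h
    · rw [← h] at hdet
      nlinarith
  · refine exists_bezout_of_forall_prime fun p hp hA hB2 hC ↦ ?_
    simp only at hA hB2 hC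
    have hpn : (p : ℤ) ∣ n := hp.intCast_dvd_of_dvd_form hdet hA hB2 hC
    have hpx : (p : ℤ) ∣ x := by simpa using dvd_add hA hpn
    have hpy : (p : ℤ) ∣ y := by simpa using dvd_add hC hpn
    have hpz : (p : ℤ) ∣ z := by
      have : z = x + y - n - 2 * B := by linarith
      rw [this]
      exact dvd_sub (dvd_sub (dvd_add hpx hpy) hpn) hB2
    have hpg : p ∣ Int.gcd (Int.gcd (Int.gcd (-(n : ℤ)) x) y) z :=
      Int.dvd_gcd (Int.natCast_dvd_natCast.2 (Int.dvd_gcd (Int.natCast_dvd_natCast.2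
        (Int.dvd_gcd (by simpa using hpn) hpx)) hpy)) hpz
    rw [hg] at hpg
    exact hp.one_lt.ne' (Nat.dvd_one.1 hpg)

theorem card_primRootSet {n : ℕ} (hn : 0 < n) :
    Nat.card (PrimRootSet n) = Nat.card (ReducedForms n) := by
  have himg : PrimRootSet n = (fun f : ℤ × ℤ × ℤ ↦
      (f.1 + (n : ℤ), f.2.2 + (n : ℤ), f.1 + f.2.2 - 2 * f.2.1 + (n : ℤ))) '' ReducedForms n := by
    ext ⟨x, y, z⟩
    constructor
    · intro h
      obtain ⟨B, hB, hz⟩ := exists_mem_reducedForms_of_mem_primRootSet hn h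
      exact ⟨_, hB, by simp [hz]⟩
    · rintro ⟨⟨A, B, C⟩, h, heq⟩
      rw [← heq]
      exact mem_primRootSet_of_mem_reducedForms hn h
  rw [himg]
  refine Nat.card_image_of_injective ?_ _
  rintro ⟨A, B, C⟩ ⟨A', B', C'⟩ h
  simp only [Prod.mk.injEq] at h ⊢
  omega

/-- The pairs of residues modulo `n` whose sum of squares is invertible. -/
def unitPairs (n : ℕ) [NeZero n] : Finset (ZMod n × ZMod n) :=
  {x | IsUnit (x.1 ^ 2 + x.2 ^ 2)}

theorem mem_unitPairs {n : ℕ} [NeZero n] {x : ZMod n × ZMod n} :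
    x ∈ unitPairs n ↔ IsUnit (x.1 ^ 2 + x.2 ^ 2) := by
  simp [unitPairs]

theorem sub_one_sq_le_card_unitPairs (p : ℕ) [hp : Fact p.Prime] :
    (p - 1) ^ 2 ≤ #(unitPairs p) := by
  obtain ⟨B, hB, hcard⟩ : ∃ B : Finset (ZMod p × ZMod p),
      (∀ x, x ∉ unitPairs p → x ∈ B) ∧ #B ≤ p + (p - 1) := by
    by_cases hI : IsSquare (-1 : ZMod p)
    · obtain ⟨I, hI⟩ := hI
      refine ⟨univ.image (fun a ↦ (a, I * a)) ∪ (univ.erase 0).image (fun a ↦ (a, -(I * a))),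
        fun x hx ↦ ?_, (card_union_le _ _).trans (add_le_add (card_image_le.trans ?_)
          (card_image_le.trans ?_))⟩
      · obtain ⟨a, b⟩ := x
        rw [mem_unitPairs, isUnit_iff_ne_zero, not_not] at hx
        have h : (b - I * a) * (b + I * a) = 0 := by
          simp only at hx
          linear_combination hx + a ^ 2 * hI
        rw [mem_union, mem_image, mem_image]
        rcases mul_eq_zero.1 h with h | h
        · exact Or.inl ⟨a, mem_univ _, by rw [sub_eq_zero.1 h]⟩
        · rcases eq_or_ne a 0 with rfl | ha
          · exact Or.inl ⟨0, mem_univ _, by simpa using h.symm⟩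
          · exact Or.inr ⟨a, by simpa using ha, by rw [eq_neg_of_add_eq_zero_left h]⟩
      · simp [ZMod.card]
      · simp [ZMod.card]
    · refine ⟨{0}, fun x hx ↦ ?_, by simp; have := hp.out.two_le; lia⟩
      obtain ⟨a, b⟩ := x
      rw [mem_unitPairs, isUnit_iff_ne_zero, not_not] at hx
      simp only at hx
      have hb : b = 0 := by
        by_contra hb
        refine hI ⟨a / b, ?_⟩
        field_simp
        linear_combination -hx
      subst hb
      have ha : a = 0 := by simpa using hx
      subst ha
      simp
  have hle : #(univ \ unitPairs p) ≤ p + (p - 1) :=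
    (card_le_card fun x hx ↦ hB x (by simpa using hx)).trans hcard
  have hsum := card_sdiff_add_card_eq_card (subset_univ (unitPairs p))
  rw [card_univ, Fintype.card_prod, ZMod.card] at hsum
  obtain ⟨q, hq⟩ : ∃ q, p = q + 1 := ⟨p - 1, by have := hp.out.two_le; lia⟩
  have hq' : p - 1 = q := by lia
  rw [hq'] at hle ⊢
  generalize #(univ \ unitPairs p) = u at hle hsum
  generalize #(unitPairs p) = w at hsum ⊢
  subst hq
  nlinarith

theorem card_unitPairs_mul_of_coprime {m k : ℕ} [NeZero m] [NeZero k] [NeZero (m * k)]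
    (h : m.Coprime k) : #(unitPairs (m * k)) = #(unitPairs m) * #(unitPairs k) := by
  rw [← card_product]
  let e := ZMod.chineseRemainder h
  refine card_bij' (fun x _ ↦ (((e x.1).1, (e x.2).1), ((e x.1).2, (e x.2).2)))
    (fun y _ ↦ (e.symm (y.1.1, y.2.1), e.symm (y.1.2, y.2.2))) ?_ ?_ ?_ ?_
  · intro x hx
    rw [mem_unitPairs] at hx
    have := hx.map e
    simpa [mem_unitPairs, Prod.isUnit_iff] using this
  · intro y hy
    rw [mem_product, mem_unitPairs, mem_unitPairs] at hy
    rw [mem_unitPairs, ← MulEquiv.isUnit_map e]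
    simpa [Prod.isUnit_iff] using hy
  · intro x hx
    simp
  · intro y hy
    simp

theorem mul_card_unitPairs_le {p m : ℕ} [NeZero m] [NeZero (p * m)] (hpm : p ∣ m) :
    p ^ 2 * #(unitPairs m) ≤ #(unitPairs (p * m)) := by
  have hm : 0 < m := Nat.pos_of_ne_zero (NeZero.ne m)
  have hc : #((range p ×ˢ range p) ×ˢ unitPairs m) = p ^ 2 * #(unitPairs m) := by
    simp [card_product, sq]
  rw [← hc]
  refine card_le_card_of_injOn (fun y ↦ (((y.2.1.val + m * y.1.1 : ℕ) : ZMod (p * m)),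
    ((y.2.2.val + m * y.1.2 : ℕ) : ZMod (p * m)))) ?_ ?_
  · intro y hy
    simp only [coe_product, Set.mem_prod, mem_coe, mem_unitPairs] at hy
    simp only [mem_coe, mem_unitPairs]
    have h : IsUnit (((y.2.1.val + m * y.1.1) ^ 2 + (y.2.2.val + m * y.1.2) ^ 2 : ℕ) : ZMod m) := by
      simpa using hy.2
    rw [ZMod.isUnit_iff_coprime] at h
    have h' := (ZMod.isUnit_iff_coprime _ (p * m)).2
      (Nat.Coprime.mul_right (h.coprime_dvd_right hpm) h)
    simpa using h'
  · rintro ⟨⟨i, j⟩, ⟨a, b⟩⟩ hy ⟨⟨i', j'⟩, ⟨a', b'⟩⟩ hy' heq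
    simp only [coe_product, Set.mem_prod, mem_coe, mem_range] at hy hy'
    have key : ∀ (c c' : ZMod m) (k k' : ℕ), k < p → k' < p →
        ((c.val + m * k : ℕ) : ZMod (p * m)) = ((c'.val + m * k' : ℕ) : ZMod (p * m)) →
        k = k' ∧ c = c' := by
      intro c c' k k' hk hk' h
      have hlt : ∀ (c : ZMod m) (k : ℕ), k < p → c.val + m * k < p * m := by
        intro c k hk
        have := c.val_lt
        nlinarith
      rw [ZMod.natCast_eq_natCast_iff'] at h
      rw [Nat.mod_eq_of_lt (hlt c k hk), Nat.mod_eq_of_lt (hlt c' k' hk')] at h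
      have h1 := congrArg (· / m) h
      have h2 := congrArg (· % m) h
      simp only [Nat.add_mul_div_left _ _ hm, Nat.add_mul_mod_self_left,
        Nat.div_eq_of_lt (ZMod.val_lt _), Nat.mod_eq_of_lt (ZMod.val_lt _), zero_add] at h1 h2
      exact ⟨h1, ZMod.val_injective m h2⟩
    simp only [Prod.mk.injEq] at heq
    obtain ⟨h1, h2⟩ := key _ _ _ _ hy.1.1 hy'.1.1 heq.1
    obtain ⟨h3, h4⟩ := key _ _ _ _ hy.1.2 hy'.1.2 heq.2
    simp [h1, h2, h3, h4]

theorem totient_sq_le_card_unitPairs (n : ℕ) [NeZero n] : n.totient ^ 2 ≤ #(unitPairs n) := by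
  have main : ∀ n : ℕ, ∀ hn : n ≠ 0, n.totient ^ 2 ≤ #(@unitPairs n ⟨hn⟩) := by
    intro n
    induction n using induction_on_primes with
    | zero => exact fun h ↦ absurd rfl h
    | one =>
      intro hn
      have : 0 < #(@unitPairs 1 ⟨hn⟩) :=
        card_pos.2 ⟨(0, 0), mem_unitPairs.2 (isUnit_of_subsingleton _)⟩
      simpa using this
    | prime_mul p m hp ih =>
      intro hn
      have hm : m ≠ 0 := right_ne_zero_of_mul hn
      have : NeZero m := ⟨hm⟩
      have : NeZero (p * m) := ⟨hn⟩
      have : Fact p.Prime := ⟨hp⟩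
      have ih := ih hm
      by_cases hpm : p ∣ m
      · rw [Nat.totient_mul_of_prime_of_dvd hp hpm, mul_pow]
        exact (Nat.mul_le_mul_left _ ih).trans (mul_card_unitPairs_le hpm)
      · rw [Nat.totient_mul_of_prime_of_not_dvd hp hpm, mul_pow,
          card_unitPairs_mul_of_coprime ((Nat.Prime.coprime_iff_not_dvd hp).2 hpm)]
        exact Nat.mul_le_mul (sub_one_sq_le_card_unitPairs p) ih
  exact main n (NeZero.ne n)

theorem GaussianInt.exists_norm_eq_and_dvd {A B C N k l m : ℤ} (hA : 0 < A)
    (hdet : A * C = B ^ 2 + N ^ 2) (h : k * A + l * (2 * B) + m * C = 1) :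
    ∃ α : GaussianInt, α.norm = A ∧ α ∣ (⟨B, N⟩ : GaussianInt) := by
  let ω : GaussianInt := ⟨B, N⟩
  have hω : ω * star ω = A * C := by
    have := (Zsqrtd.norm_eq_mul_conj ω).symm
    rw [this]
    have h2 : ω.norm = A * C := by
      rw [hdet, Zsqrtd.norm_def]; ring
    rw [h2]; push_cast; rfl
  have hω' : ω + star ω = 2 * B := by
    ext <;> simp [ω]
    ring
  let α := EuclideanDomain.gcd (A : GaussianInt) ω
  have hαA : α ∣ (A : GaussianInt) := EuclideanDomain.gcd_dvd_left _ _
  have hαω : α ∣ ω := EuclideanDomain.gcd_dvd_right _ _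
  have hsA : star (A : GaussianInt) = A := by simp
  have hαA' : star α ∣ (A : GaussianInt) := by
    obtain ⟨c, hc⟩ := hαA
    exact ⟨star c, by rw [← hsA, hc, star_mul']⟩
  have hαω' : star α ∣ star ω := by
    obtain ⟨c, hc⟩ := hαω
    exact ⟨star c, by rw [hc, star_mul']⟩
  have hn : ((α.norm : ℤ) : GaussianInt) = α * star α := Zsqrtd.norm_eq_mul_conj α
  have h1 : (A : GaussianInt) ∣ (α.norm : ℤ) := by
    obtain ⟨x, y, hxy⟩ : ∃ x y : GaussianInt, α = A * x + ω * y :=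
      ⟨_, _, EuclideanDomain.gcd_eq_gcd_ab _ _⟩
    rw [hn, hxy]
    refine ⟨x * (A * star x + star ω * star y) + y * (ω * star x) + C * (y * star y), ?_⟩
    rw [star_add, star_mul', star_mul', hsA]
    linear_combination (y * star y) * hω
  have h2 : ((α.norm : ℤ) : GaussianInt) ∣ A := by
    have e : (A : GaussianInt) = k * (A * A) + l * (A * star ω + ω * A) + m * (ω * star ω) := by
      have h' : (k : GaussianInt) * A + l * (2 * B) + m * C = 1 := by exact_mod_cast h
      linear_combination (-(A : GaussianInt)) * h' - l * A * hω' - m * hω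
    rw [hn, e]
    exact dvd_add (dvd_add ((mul_dvd_mul hαA hαA').mul_left _)
      ((dvd_add (mul_dvd_mul hαA hαω') (mul_dvd_mul hαω hαA')).mul_left _))
      ((mul_dvd_mul hαω hαω').mul_left _)
  rw [Zsqrtd.intCast_dvd_intCast] at h1 h2
  exact ⟨α, Int.dvd_antisymm (GaussianInt.norm_nonneg α) hA.le h2 h1, hαω⟩

theorem eq_of_coprime_of_ediv_eq {g : ℕ} {u v B B' x y x' y' N q : ℤ} (hg : 0 < g)
    (huv : IsCoprime u v) (hB : B = g * (u * x - v * y)) (hB' : B' = g * (u * x' - v * y'))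
    (hN : N = g * (u * y + v * x)) (hN' : N = g * (u * y' + v * x'))
    (hq : B / (g * (u ^ 2 + v ^ 2)) = q) (hq' : B' / (g * (u ^ 2 + v ^ 2)) = q) : B = B' := by
  obtain ⟨s, t, hst⟩ := huv
  have h0 : u * (y - y') + v * (x - x') = 0 := by
    have : (g : ℤ) * (u * (y - y') + v * (x - x')) = 0 := by linear_combination hN' - hN
    exact (mul_eq_zero.1 this).resolve_left (by exact_mod_cast hg.ne')
  have hdvd : (g : ℤ) * (u ^ 2 + v ^ 2) ∣ B - B' := by
    refine ⟨s * (x - x') - t * (y - y'), ?_⟩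
    have hX : u * (s * (x - x') - t * (y - y')) = x - x' := by
      linear_combination (x - x') * hst - t * h0
    have hY : v * (s * (x - x') - t * (y - y')) = - (y - y') := by
      linear_combination -(y - y') * hst + s * h0
    linear_combination hB - hB' - g * u * hX - g * v * hY
  have hm : B % (g * (u ^ 2 + v ^ 2)) = B' % (g * (u ^ 2 + v ^ 2)) :=
    (Int.modEq_iff_dvd.2 hdvd).symm
  have h1 := Int.mul_ediv_add_emod B (g * (u ^ 2 + v ^ 2))
  have h2 := Int.mul_ediv_add_emod B' (g * (u ^ 2 + v ^ 2))
  rw [hq] at h1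
  rw [hq'] at h2
  linarith

/-- `k = ⟨g, u, v, q⟩` encodes the Gaussian integer `g (u + v i)` with `u, v` coprime that divides
`B + n i` and has norm `A`, together with a quotient of `B`. -/
def IsCodeOf (n : ℕ) (f : ℤ × ℤ × ℤ) (k : Σ _ : ℕ, ℤ × ℤ × ℕ) : Prop :=
  f.1 = k.1 ^ 2 * (k.2.1 ^ 2 + k.2.2.1 ^ 2) ∧ IsCoprime k.2.1 k.2.2.1 ∧
    f.2.1 / (k.1 * (k.2.1 ^ 2 + k.2.2.1 ^ 2)) = k.2.2.2 ∧
    ∃ x y : ℤ, f.2.1 = k.1 * (k.2.1 * x - k.2.2.1 * y) ∧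
      (n : ℤ) = k.1 * (k.2.1 * y + k.2.2.1 * x)

theorem IsCodeOf.injective {n : ℕ} (hn : 0 < n) {f f' : ℤ × ℤ × ℤ} {k : Σ _ : ℕ, ℤ × ℤ × ℕ}
    (hf : f ∈ ReducedForms n) (hf' : f' ∈ ReducedForms n) (h : IsCodeOf n f k)
    (h' : IsCodeOf n f' k) : f = f' := by
  obtain ⟨hA, huv, hq, x, y, hB, hN⟩ := h
  obtain ⟨hA', -, hq', x', y', hB', hN'⟩ := h'
  have hg : 0 < k.1 := by
    rcases Nat.eq_zero_or_pos k.1 with h | h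
    · rw [h] at hN
      simp at hN
      lia
    · exact h
  have hBB := eq_of_coprime_of_ediv_eq hg huv hB hB' hN hN' hq hq'
  have hAA := hA.trans hA'.symm
  have hCC : f.2.2 = f'.2.2 := by
    have h1 := hf.1
    have h2 := hf'.1
    rw [← hAA, ← hBB, ← h1] at h2
    exact (mul_left_cancel₀ hf.2.2.2.2.1.ne' h2).symm
  exact Prod.ext hAA (Prod.ext hBB hCC)

/-- A finite set containing a code of every reduced form. -/
noncomputable def codes (n : ℕ) : Finset (Σ _ : ℕ, ℤ × ℤ × ℕ) :=
  (n.divisors.filter fun g ↦ g ^ 2 ≤ 2 * n).sigma fun g ↦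
    Icc (-(Nat.sqrt (2 * n / g ^ 2) : ℤ)) (Nat.sqrt (2 * n / g ^ 2)) ×ˢ
      Icc (-(Nat.sqrt (2 * n / g ^ 2) : ℤ)) (Nat.sqrt (2 * n / g ^ 2)) ×ˢ range g

theorem exists_mem_codes {n : ℕ} (hn : 0 < n) {f : ℤ × ℤ × ℤ} (hf : f ∈ ReducedForms n) :
    ∃ k ∈ codes n, IsCodeOf n f k := by
  obtain ⟨A, B, C⟩ := f
  obtain ⟨hdet, hB, hBA, hAC, hA, k, l, m, hklm⟩ := hf
  simp only at hdet hB hBA hAC hA hklm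
  obtain ⟨⟨u₀, v₀⟩, hnorm, ⟨x, y⟩, hxy⟩ := GaussianInt.exists_norm_eq_and_dvd hA hdet hklm
  have hnorm : A = u₀ ^ 2 + v₀ ^ 2 := by
    rw [← hnorm, Zsqrtd.norm_def]; ring
  have hBx : B = u₀ * x - v₀ * y := by
    have := congrArg Zsqrtd.re hxy
    simp only [Zsqrtd.re_mul] at this
    linarith
  have hNx : (n : ℤ) = u₀ * y + v₀ * x := by
    have := congrArg Zsqrtd.im hxy
    simp only [Zsqrtd.im_mul] at this
    linarith
  have hA2 : A ≤ 2 * n := by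
    have : (0 : ℤ) < n := by exact_mod_cast hn
    nlinarith
  have hgpos : 0 < Int.gcd u₀ v₀ := by
    rw [Int.gcd_pos_iff]
    by_contra! hne
    rw [hne.1, hne.2] at hnorm
    lia
  obtain ⟨g, u, v, hg, huv, hu, hv⟩ := Int.exists_gcd_one' hgpos
  subst hu hv
  have hcop : IsCoprime u v := Int.isCoprime_iff_gcd_eq_one.2 huv
  have hgZ : (0 : ℤ) < g := by exact_mod_cast hg
  have hN0 : 0 < u ^ 2 + v ^ 2 := by
    by_contra! hle
    have : A = g ^ 2 * (u ^ 2 + v ^ 2) := by rw [hnorm]; ring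
    nlinarith [sq_nonneg (g : ℤ)]
  have hAg : A = g ^ 2 * (u ^ 2 + v ^ 2) := by rw [hnorm]; ring
  have hd0 : 0 < g * (u ^ 2 + v ^ 2) := by positivity
  have hq0 : 0 ≤ B / (g * (u ^ 2 + v ^ 2)) := Int.ediv_nonneg hB hd0.le
  have hqg : B / (g * (u ^ 2 + v ^ 2)) < g := by
    rw [Int.ediv_lt_iff_lt_mul hd0]
    nlinarith
  have hle : g ^ 2 * (u ^ 2 + v ^ 2).toNat ≤ 2 * n := by
    zify
    rw [Int.toNat_of_nonneg hN0.le]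
    linarith
  have hle' : (u ^ 2 + v ^ 2).toNat ≤ 2 * n / g ^ 2 := by
    rw [Nat.le_div_iff_mul_le (by positivity)]
    linarith
  have hbound : ∀ w : ℤ, w ^ 2 ≤ u ^ 2 + v ^ 2 →
      w ∈ Icc (-(Nat.sqrt (2 * n / g ^ 2) : ℤ)) (Nat.sqrt (2 * n / g ^ 2)) := by
    intro w hw
    have h1 : w.natAbs ≤ Nat.sqrt (2 * n / g ^ 2) := by
      rw [Nat.le_sqrt']
      refine le_trans ?_ hle'
      zify
      rw [sq_abs, Int.toNat_of_nonneg hN0.le]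
      exact hw
    rw [mem_Icc]
    lia
  refine ⟨⟨g, u, v, (B / (g * (u ^ 2 + v ^ 2))).toNat⟩, ?_, ?_, hcop, ?_, x, y, ?_, ?_⟩
  · simp only [codes, mem_sigma, mem_filter, Nat.mem_divisors, mem_product, mem_range]
    refine ⟨⟨⟨?_, hn.ne'⟩, ?_⟩, hbound u (by nlinarith), hbound v (by nlinarith), by lia⟩
    · exact Int.natCast_dvd_natCast.1 ⟨u * y + v * x, by rw [hNx]; ring⟩
    · have : 1 ≤ (u ^ 2 + v ^ 2).toNat := by lia
      nlinarith
  · exact hAg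
  · simp only
    rw [Int.toNat_of_nonneg hq0]
  · simp only; rw [hBx]; ring
  · simp only; rw [hNx]; ring

theorem card_codes_le (n : ℕ) : #(codes n) ≤ 18 * ∑ d ∈ n.divisors, d := by
  rw [codes, card_sigma, ← Nat.sum_div_divisors, mul_sum]
  refine (sum_le_sum fun g hg ↦ ?_).trans (sum_le_sum_of_subset (filter_subset _ _))
  rw [mem_filter, Nat.mem_divisors] at hg
  obtain ⟨⟨⟨e, rfl⟩, hn⟩, hg2⟩ := hg
  have hg0 : 0 < g := Nat.pos_of_ne_zero (left_ne_zero_of_mul hn)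
  set M := Nat.sqrt (2 * (g * e) / g ^ 2) with hM
  have hM1 : 1 ≤ M := by
    rw [hM, Nat.le_sqrt', Nat.le_div_iff_mul_le (by positivity)]
    linarith
  have hM2 : M ^ 2 ≤ 2 * (g * e) / g ^ 2 := Nat.sqrt_le' _
  rw [Nat.le_div_iff_mul_le (by positivity)] at hM2
  have hM3 : M ^ 2 * g ≤ 2 * e := by
    refine Nat.le_of_mul_le_mul_left ?_ hg0
    linarith
  have hcard : #(Icc (-(M : ℤ)) M) = 2 * M + 1 := by
    rw [Int.card_Icc]; lia
  rw [card_product, card_product, hcard, card_range, Nat.mul_div_cancel_left _ hg0]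
  nlinarith

theorem finite_reducedForms_and_card_le {n : ℕ} (hn : 0 < n) :
    (ReducedForms n).Finite ∧ Nat.card (ReducedForms n) ≤ 18 * ∑ d ∈ n.divisors, d := by
  choose! F hF hF' using fun f (hf : f ∈ ReducedForms n) ↦ exists_mem_codes hn hf
  have hinj : Set.InjOn F (ReducedForms n) := fun f hf f' hf' h ↦
    (hF' f hf).injective hn hf hf' (h ▸ hF' f' hf')
  have hmaps : Set.MapsTo F (ReducedForms n) (codes n : Set _) := hF
  have hfin := Set.Finite.of_injOn hmaps hinj (codes n).finite_toSet
  refine ⟨hfin, ?_⟩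
  rw [Nat.card_coe_set_eq]
  refine le_trans ?_ (card_codes_le n)
  rw [← Set.ncard_coe_finset]
  exact Set.ncard_le_ncard_of_injOn F hmaps hinj (codes n).finite_toSet

/-- The lattice of integer vectors that are proportional to `(a, b)` modulo `n`. -/
def proportionalLattice {n : ℕ} (a b : ZMod n) : AddSubgroup (ℤ × ℤ) where
  carrier := {w | a * (w.2 : ZMod n) = b * (w.1 : ZMod n)}
  zero_mem' := by simp
  add_mem' := by
    intro w w' h h'
    simp only [Set.mem_ofPred_eq, Prod.fst_add, Prod.snd_add, Int.cast_add, mul_add] at *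
    rw [h, h']
  neg_mem' := by
    intro w h
    simp only [Set.mem_ofPred_eq, Prod.fst_neg, Prod.snd_neg, Int.cast_neg, mul_neg] at *
    rw [h]

theorem mem_proportionalLattice {n : ℕ} {a b : ZMod n} {x y : ℤ} :
    (x, y) ∈ proportionalLattice a b ↔ a * (y : ZMod n) = b * (x : ZMod n) := Iff.rfl

/-- `(u, v), (x, y)` is a pair of vectors of `L` of determinant `±N` whose Gram matrix is
reduced. -/
structure IsReducedPair (L : AddSubgroup (ℤ × ℤ)) (N : ℤ) (Q : (ℤ × ℤ) × ℤ × ℤ) : Prop where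
  fst_mem : Q.1 ∈ L
  snd_mem : Q.2 ∈ L
  det : Q.1.1 * Q.2.2 - Q.1.2 * Q.2.1 = N ∨ Q.1.1 * Q.2.2 - Q.1.2 * Q.2.1 = -N
  inner_nonneg : 0 ≤ Q.1.1 * Q.2.1 + Q.1.2 * Q.2.2
  inner_le : 2 * (Q.1.1 * Q.2.1 + Q.1.2 * Q.2.2) ≤ Q.1.1 ^ 2 + Q.1.2 ^ 2
  le_snd : Q.1.1 ^ 2 + Q.1.2 ^ 2 ≤ Q.2.1 ^ 2 + Q.2.2 ^ 2

theorem exists_isReducedPair {L : AddSubgroup (ℤ × ℤ)} {N : ℤ} {u v x y : ℤ}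
    (h : (u, v) ∈ L) (h' : (x, y) ∈ L) (hdet : u * y - v * x = N ∨ u * y - v * x = -N) :
    ∃ Q, IsReducedPair L N Q := by
  induction hk : (u ^ 2 + v ^ 2 + x ^ 2 + y ^ 2).toNat using Nat.strong_induction_on
    generalizing u v x y with
  | _ k ih =>
    wlog hle : u ^ 2 + v ^ 2 ≤ x ^ 2 + y ^ 2 generalizing u v x y
    · refine this h' h ?_ ?_ (by linarith)
      · rcases hdet with h | h
        · exact Or.inr (by linarith)
        · exact Or.inl (by linarith)
      · rw [← hk]; congr 1; ring
    wlog hB : 0 ≤ u * x + v * y generalizing x y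
    · refine this (x := -x) (y := -y) (L.neg_mem h') ?_ ?_ ?_ ?_
      · rcases hdet with h | h
        · exact Or.inr (by linarith)
        · exact Or.inl (by linarith)
      · rw [← hk]; congr 1; ring
      · linarith
      · linarith
    by_cases hBA : 2 * (u * x + v * y) ≤ u ^ 2 + v ^ 2
    · exact ⟨((u, v), (x, y)), h, h', hdet, hB, hBA, hle⟩
    · push Not at hBA
      refine ih _ ?_ h (L.sub_mem h' h) ?_ rfl
      · have : u ^ 2 + v ^ 2 + (x - u) ^ 2 + (y - v) ^ 2 < u ^ 2 + v ^ 2 + x ^ 2 + y ^ 2 := by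
          linarith
        have h0 : 0 ≤ u ^ 2 + v ^ 2 + (x - u) ^ 2 + (y - v) ^ 2 := by positivity
        lia
      · rcases hdet with h | h
        · exact Or.inl (by linarith)
        · exact Or.inr (by linarith)

theorem exists_isReducedPair_proportionalLattice {n : ℕ} (hn : 1 < n) {a b : ZMod n}
    (hab : IsUnit (a ^ 2 + b ^ 2)) : ∃ Q, IsReducedPair (proportionalLattice a b) n Q := by
  have : NeZero n := ⟨by lia⟩
  have : Nontrivial (ZMod n) := by
    have : Fact (1 < n) := ⟨hn⟩
    infer_instance
  have hpos : 0 < Int.gcd (a.val : ℤ) (b.val : ℤ) := by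
    rw [Int.gcd_pos_iff]
    by_contra! hne
    have ha : a = 0 := (ZMod.val_eq_zero a).1 (by exact_mod_cast hne.1)
    have hb : b = 0 := (ZMod.val_eq_zero b).1 (by exact_mod_cast hne.2)
    simp [ha, hb] at hab
  obtain ⟨g, u, v, hg, huv, hu, hv⟩ := Int.exists_gcd_one' hpos
  have ha : a = u * g := by
    have := congrArg (Int.cast : ℤ → ZMod n) hu
    simpa using this
  have hb : b = v * g := by
    have := congrArg (Int.cast : ℤ → ZMod n) hv
    simpa using this
  obtain ⟨s, t, hst⟩ := Int.isCoprime_iff_gcd_eq_one.2 huv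
  refine exists_isReducedPair (u := u) (v := v) (x := - (n * t)) (y := n * s)
    ?_ ?_ (Or.inl ?_)
  · rw [mem_proportionalLattice, ha, hb]; ring
  · rw [mem_proportionalLattice]; simp
  · linear_combination (n : ℤ) * hst

theorem exists_eq_combination_of_det {n : ℕ} {a b : ZMod n} {Q : (ℤ × ℤ) × ℤ × ℤ} (hn : n ≠ 0)
    (h : Q.1 ∈ proportionalLattice a b) (h' : Q.2 ∈ proportionalLattice a b)
    (hdet : Q.1.1 * Q.2.2 - Q.1.2 * Q.2.1 = n ∨ Q.1.1 * Q.2.2 - Q.1.2 * Q.2.1 = -n) :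
    ∃ s t : ℤ, a = ((s * Q.1.1 + t * Q.2.1 : ℤ) : ZMod n) ∧
      b = ((s * Q.1.2 + t * Q.2.2 : ℤ) : ZMod n) := by
  obtain ⟨⟨u, v⟩, x, y⟩ := Q
  simp only at h h' hdet ⊢
  obtain ⟨a, rfl⟩ := ZMod.intCast_surjective a
  obtain ⟨b, rfl⟩ := ZMod.intCast_surjective b
  rw [mem_proportionalLattice] at h h'
  have h1 : ((a * y - b * x : ℤ) : ZMod n) = 0 := by push_cast; rw [h', sub_self]
  have h2 : ((a * v - b * u : ℤ) : ZMod n) = 0 := by push_cast; rw [h, sub_self]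
  rw [ZMod.intCast_zmod_eq_zero_iff_dvd] at h1 h2
  obtain ⟨c, hc⟩ := h1
  obtain ⟨d, hd⟩ := h2
  have hnZ : (n : ℤ) ≠ 0 := by exact_mod_cast hn
  rcases hdet with hdet | hdet
  · refine ⟨c, -d, ?_, ?_⟩ <;> congr 1 <;> refine mul_left_cancel₀ hnZ ?_
    · linear_combination u * hc - x * hd - a * hdet
    · linear_combination v * hc - y * hd - b * hdet
  · refine ⟨-c, d, ?_, ?_⟩ <;> congr 1 <;> refine mul_left_cancel₀ hnZ ?_
    · linear_combination -u * hc + x * hd + a * hdet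
    · linear_combination -v * hc + y * hd + b * hdet

/-- The coefficients of the quadratic form attached to a pair of vectors. -/
def gramForm (Q : (ℤ × ℤ) × ℤ × ℤ) : ℤ × ℤ × ℤ :=
  (Q.1.1 ^ 2 + Q.1.2 ^ 2, Q.1.1 * Q.2.1 + Q.1.2 * Q.2.2, Q.2.1 ^ 2 + Q.2.2 ^ 2)

theorem IsReducedPair.gramForm_mem {n : ℕ} (hn : n ≠ 0) {a b : ZMod n}
    (hab : IsUnit (a ^ 2 + b ^ 2)) {Q : (ℤ × ℤ) × ℤ × ℤ}
    (hQ : IsReducedPair (proportionalLattice a b) n Q) : gramForm Q ∈ ReducedForms n := by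
  obtain ⟨s, t, ha, hb⟩ := exists_eq_combination_of_det hn hQ.fst_mem hQ.snd_mem hQ.det
  obtain ⟨-, -, hdet, hB, hBA, hAC⟩ := hQ
  obtain ⟨⟨u, v⟩, x, y⟩ := Q
  simp only at hdet hB hBA hAC ha hb
  have hdet2 : (u * y - v * x) ^ 2 = (n : ℤ) ^ 2 := by
    rcases hdet with h | h <;> rw [h]
    ring
  have hdet' : (u ^ 2 + v ^ 2) * (x ^ 2 + y ^ 2) = (u * x + v * y) ^ 2 + (n : ℤ) ^ 2 := by
    rw [← hdet2]; ring
  refine ⟨hdet', hB, hBA, hAC, ?_, ?_⟩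
  · simp only [gramForm]
    by_contra! hle
    have h0 : u ^ 2 + v ^ 2 = 0 := le_antisymm hle (by positivity)
    have : 0 < (n : ℤ) := by lia
    rw [h0] at hdet'
    nlinarith [sq_nonneg (u * x + v * y)]
  · refine exists_bezout_of_forall_prime fun p hp hA hB hC ↦ ?_
    simp only [gramForm] at hA hB hC
    have hpn := hp.intCast_dvd_of_dvd_form hdet' hA hB hC
    have hval : a ^ 2 + b ^ 2 = ((s ^ 2 * (u ^ 2 + v ^ 2) + s * t * (2 * (u * x + v * y)) +
        t ^ 2 * (x ^ 2 + y ^ 2) : ℤ) : ZMod n) := by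
      rw [ha, hb]; push_cast; ring
    rw [hval, ZMod.coe_int_isUnit_iff_isCoprime] at hab
    have hpz := dvd_add (dvd_add (hA.mul_left (s ^ 2)) (hB.mul_left (s * t))) (hC.mul_left (t ^ 2))
    exact (Nat.prime_iff_prime_int.1 hp).not_isUnit (hab.isUnit_of_dvd' hpn hpz)

theorem exists_unit_smul_eq {n : ℕ} (hn : n ≠ 0) {a b a' b' : ZMod n}
    (hab : IsUnit (a ^ 2 + b ^ 2)) (hab' : IsUnit (a' ^ 2 + b' ^ 2)) {Q : (ℤ × ℤ) × ℤ × ℤ}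
    (hQ : IsReducedPair (proportionalLattice a b) n Q)
    (hQ' : IsReducedPair (proportionalLattice a' b') n Q) :
    ∃ w : (ZMod n)ˣ, (a', b') = (w * a, w * b) := by
  obtain ⟨s, t, ha, hb⟩ := exists_eq_combination_of_det hn hQ'.fst_mem hQ'.snd_mem hQ'.det
  have h1 : a * Q.1.2 = b * Q.1.1 := hQ.fst_mem
  have h2 : a * Q.2.2 = b * Q.2.1 := hQ.snd_mem
  have hprop : a * b' = b * a' := by
    rw [ha, hb]
    push_cast
    linear_combination s * h1 + t * h2
  obtain ⟨c, hc⟩ := hab.exists_right_inv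
  set w := (a * a' + b * b') * c with hw
  have e1 : a' = w * a := by
    rw [hw]; linear_combination -a' * hc - b * c * hprop
  have e2 : b' = w * b := by
    rw [hw]; linear_combination -b' * hc + a * c * hprop
  have hwu : IsUnit w := by
    rw [e1, e2, show (w * a) ^ 2 + (w * b) ^ 2 = w * (w * (a ^ 2 + b ^ 2)) by ring] at hab'
    exact isUnit_of_mul_isUnit_left hab'
  exact ⟨hwu.unit, by rw [e1, e2]; rfl⟩

theorem eq_mul_of_gram_eq {R : Type*} [CommRing R] {k l m a a' b b' c c' d d' : R}
    (h : k * (a * a') + l * (a' * b + a * b') + m * (b * b') = 1) (hcc : c * c' = a * a')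
    (hdd : d * d' = b * b') (hcd : c' * d = a' * b) (hcd' : c * d' = a * b') :
    a = (k * (a * c') + l * (c' * b + a * d') + m * (b * d')) * c ∧
      b = (k * (a * c') + l * (c' * b + a * d') + m * (b * d')) * d :=
  ⟨by linear_combination -a * h - k * a * hcc - l * b * hcc - l * a * hcd' - m * b * hcd',
    by linear_combination -b * h - k * a * hcd - l * b * hcd - l * a * hdd - m * b * hdd⟩

theorem exists_rotation_of_gramForm_eq {Q Q' : (ℤ × ℤ) × ℤ × ℤ} (hA : 0 < (gramForm Q).1)
    (hprim : ∃ k l m : ℤ,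
      k * (gramForm Q).1 + l * (2 * (gramForm Q).2.1) + m * (gramForm Q).2.2 = 1)
    (hform : gramForm Q' = gramForm Q)
    (hdet : Q'.1.1 * Q'.2.2 - Q'.1.2 * Q'.2.1 = Q.1.1 * Q.2.2 - Q.1.2 * Q.2.1) :
    ∃ p ∈ Icc (-1 : ℤ) 1, ∃ q ∈ Icc (-1 : ℤ) 1,
      Q = ((p * Q'.1.1 - q * Q'.1.2, p * Q'.1.2 + q * Q'.1.1),
        (p * Q'.2.1 - q * Q'.2.2, p * Q'.2.2 + q * Q'.2.1)) := by
  obtain ⟨⟨u, v⟩, x, y⟩ := Q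
  obtain ⟨⟨u', v'⟩, x', y'⟩ := Q'
  obtain ⟨k, l, m, h⟩ := hprim
  simp only [gramForm, Prod.mk.injEq] at *
  obtain ⟨h1, h2, h3⟩ := hform
  obtain ⟨e1, e2⟩ := eq_mul_of_gram_eq (R := GaussianInt) (k := k) (l := l) (m := m) (a := ⟨u, v⟩)
    (a' := ⟨u, -v⟩) (b := ⟨x, y⟩) (b' := ⟨x, -y⟩) (c := ⟨u', v'⟩) (c' := ⟨u', -v'⟩) (d := ⟨x', y'⟩)
    (d' := ⟨x', -y'⟩)
    (by
      ext <;> simp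
      · linear_combination h
      · ring)
    (by ext <;> simp <;> linarith) (by ext <;> simp <;> linarith)
    (by ext <;> simp <;> linarith) (by ext <;> simp <;> linarith)
  generalize (k * ((⟨u, v⟩ : GaussianInt) * ⟨u', -v'⟩) +
    l * (⟨u', -v'⟩ * ⟨x, y⟩ + ⟨u, v⟩ * ⟨x', -y'⟩)
    + m * (⟨x, y⟩ * ⟨x', -y'⟩) : GaussianInt) = w at e1 e2
  obtain ⟨p, q⟩ := w
  rw [Zsqrtd.ext_iff] at e1 e2
  simp only [Zsqrtd.re_mul, Zsqrtd.im_mul] at e1 e2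
  have hpq : p ^ 2 + q ^ 2 = 1 := by
    have : (p ^ 2 + q ^ 2) * (u ^ 2 + v ^ 2) = 1 * (u ^ 2 + v ^ 2) := by
      nth_rewrite 1 [← h1]
      rw [e1.1, e1.2]; ring
    exact mul_right_cancel₀ hA.ne' this
  refine ⟨p, ?_, q, ?_, ?_⟩
  · rw [mem_Icc]; constructor <;> nlinarith
  · rw [mem_Icc]; constructor <;> nlinarith
  · refine ⟨⟨?_, ?_⟩, ?_, ?_⟩
    · linarith [e1.1]
    · linarith [e1.2]
    · linarith [e2.1]
    · linarith [e2.2]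

theorem totient_le_card_reducedForms {n : ℕ} (hn : 1 < n) :
    n.totient ≤ 18 * Nat.card (ReducedForms n) := by
  have hn0 : n ≠ 0 := by lia
  have : NeZero n := ⟨hn0⟩
  have hfin := (finite_reducedForms_and_card_le (n := n) (by lia)).1
  choose! F hF using fun (x : ZMod n × ZMod n) (hx : x ∈ unitPairs n) ↦
    exists_isReducedPair_proportionalLattice hn (mem_unitPairs.1 hx)
  have hfst : #(unitPairs n) ≤ n.totient * #((unitPairs n).image F) := by
    refine card_le_mul_card_image _ _ fun Q hQ ↦ ?_
    obtain ⟨x, hx, rfl⟩ := mem_image.1 hQ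
    rw [← ZMod.card_units_eq_totient, ← card_univ]
    refine (card_le_card fun x' hx' ↦ ?_).trans
      (card_image_le (f := fun w : (ZMod n)ˣ ↦ ((w : ZMod n) * x.1, (w : ZMod n) * x.2)))
    rw [mem_filter] at hx'
    obtain ⟨w, hw⟩ := exists_unit_smul_eq hn0 (mem_unitPairs.1 hx) (mem_unitPairs.1 hx'.1)
      (hF x hx) (hx'.2 ▸ hF x' hx'.1)
    exact mem_image.2 ⟨w, mem_univ _, hw.symm⟩
  let G : (ℤ × ℤ) × ℤ × ℤ → (ℤ × ℤ × ℤ) × Bool :=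
    fun Q ↦ (gramForm Q, decide (0 < Q.1.1 * Q.2.2 - Q.1.2 * Q.2.1))
  have hmem : ∀ x ∈ unitPairs n, gramForm (F x) ∈ ReducedForms n := fun x hx ↦
    (hF x hx).gramForm_mem hn0 (mem_unitPairs.1 hx)
  have hsnd : #((unitPairs n).image F) ≤ 9 * #(((unitPairs n).image F).image G) := by
    refine card_le_mul_card_image _ _ fun f hf ↦ ?_
    obtain ⟨Q', hQ', rfl⟩ := mem_image.1 hf
    obtain ⟨x', hx', rfl⟩ := mem_image.1 hQ'
    have h9 : #(Icc (-1 : ℤ) 1 ×ˢ Icc (-1 : ℤ) 1) = 9 := by simp [card_product]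
    rw [← h9]
    refine (card_le_card fun Q hQ ↦ ?_).trans (card_image_le (f := fun r : ℤ × ℤ ↦
      ((r.1 * (F x').1.1 - r.2 * (F x').1.2, r.1 * (F x').1.2 + r.2 * (F x').1.1),
        (r.1 * (F x').2.1 - r.2 * (F x').2.2, r.1 * (F x').2.2 + r.2 * (F x').2.1))))
    rw [mem_filter] at hQ
    obtain ⟨hQ, hG⟩ := hQ
    obtain ⟨x, hx, rfl⟩ := mem_image.1 hQ
    simp only [G, Prod.mk.injEq, decide_eq_decide] at hG
    have hR := hmem x hx
    obtain ⟨p, hp, q, hq, h⟩ := exists_rotation_of_gramForm_eq hR.2.2.2.2.1 hR.2.2.2.2.2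
      hG.1.symm (by
        have h1 := (hF x hx).det
        have h2 := (hF x' hx').det
        have h3 := hG.2
        lia)
    exact mem_image.2 ⟨(p, q), mem_product.2 ⟨hp, hq⟩, h.symm⟩
  have himg : #(((unitPairs n).image F).image G) ≤ Nat.card (ReducedForms n) * 2 := by
    have hsub : ((unitPairs n).image F).image G ⊆ hfin.toFinset ×ˢ univ := by
      intro f hf
      obtain ⟨Q, hQ, rfl⟩ := mem_image.1 hf
      obtain ⟨x, hx, rfl⟩ := mem_image.1 hQ
      exact mem_product.2 ⟨hfin.mem_toFinset.2 (hmem x hx), mem_univ _⟩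
    refine (card_le_card hsub).trans ?_
    rw [card_product, Nat.card_coe_set_eq, Set.ncard_eq_toFinset_card _ hfin]
    simp
  have htot : 0 < n.totient := Nat.totient_pos.2 (by lia)
  have hsq := totient_sq_le_card_unitPairs n
  refine Nat.le_of_mul_le_mul_left ?_ htot
  calc n.totient * n.totient = n.totient ^ 2 := (sq _).symm
    _ ≤ n.totient * #((unitPairs n).image F) := hsq.trans hfst
    _ ≤ n.totient * (18 * Nat.card (ReducedForms n)) := Nat.mul_le_mul_left _ (by lia)

end

/-- **Upper and lower bounds for the number of primitive root quadruples.**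
There are positive constants `C₁`, `C₂` such that for all `n ≥ 3`,
`C₁ n / log log n < N*_root(-n) < C₂ n log log n`. -/
theorem root_quadruple_count_bounds :
    ∃ C₁ C₂ : ℝ, 0 < C₁ ∧ 0 < C₂ ∧ ∀ n : ℕ, 3 ≤ n →
      C₁ * n / Real.log (Real.log n) < (Nat.card (PrimRootSet n) : ℝ) ∧
      (Nat.card (PrimRootSet n) : ℝ) < C₂ * n * Real.log (Real.log n) := by
  obtain ⟨C, hC, h⟩ := Nat.exists_self_le_mul_log_log_mul_totient
  refine ⟨1 / (19 * C), 19 * C, by positivity, by positivity, fun n hn ↦ ?_⟩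
  obtain ⟨hL, hnC⟩ := h n hn
  set L := Real.log (Real.log n)
  have hnR : (0 : ℝ) < n := by positivity
  have htot : (0 : ℝ) < n.totient := Nat.cast_pos.2 (Nat.totient_pos.2 (by lia))
  rw [card_primRootSet (by lia)]
  have hlow : (n.totient : ℝ) ≤ 18 * Nat.card (ReducedForms n) := by
    exact_mod_cast totient_le_card_reducedForms (n := n) (by lia)
  have hup : (Nat.card (ReducedForms n) : ℝ) ≤ 18 * (∑ d ∈ n.divisors, d : ℕ) := by
    exact_mod_cast (finite_reducedForms_and_card_le (n := n) (by lia)).2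
  have hsigma : ((∑ d ∈ n.divisors, d : ℕ) : ℝ) * n.totient ≤ (n : ℝ) ^ 2 := by
    exact_mod_cast Nat.sum_divisors_mul_totient_le n
  generalize ((∑ d ∈ n.divisors, d : ℕ) : ℝ) = σ at hup hsigma
  generalize (Nat.card (ReducedForms n) : ℝ) = R at *
  have hCL : 0 < C * L := by positivity
  constructor
  · rw [div_lt_iff₀ hL, div_mul_eq_mul_div, one_mul, div_lt_iff₀ (by positivity)]
    have hR : 0 < R := by linarith
    have h1 : C * L * n.totient ≤ C * L * (18 * R) := mul_le_mul_of_nonneg_left hlow hCL.le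
    have h2 : 0 < C * L * R := by positivity
    nlinarith
  · have h1 : σ ≤ n * (C * L) := by
      refine le_of_mul_le_mul_right (hsigma.trans ?_) htot
      nlinarith
    have h2 : 0 < n * (C * L) := by positivity
    nlinarith
end

section
/- For every integer n > 1, the total number of: (1) pairs (A,C) of positive integers with A ≤ C, AC = n², and gcd(A,C) = 1; plus (2) pairs (A,C) of positive integers with 2A ≤ C, A(2C − A) = n², and gcd(A,C) = 1; plus (3) pairs (A,B) of positive integers with 2B ≤ A, A² − B² = n², and gcd(A,B) = 1; equals 2^{ω(n)−1} if n ≡ 2 (mod 4) and equals 2^{ω(n)} otherwise, where ω(n) is the number of distinct prime divisors of n. -/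
/-- The pairs `(a, d)` of coprime natural numbers with `a < d` and `a * d = m ^ 2`. -/
def coprimeFactorPairs (m : ℕ) : Finset (ℕ × ℕ) :=
  {p ∈ (m ^ 2).divisorsAntidiagonal | Nat.Coprime p.1 p.2 ∧ p.1 < p.2}

theorem mem_coprimeFactorPairs {m a d : ℕ} (hm : 1 < m) :
    (a, d) ∈ coprimeFactorPairs m ↔ a * d = m ^ 2 ∧ Nat.Coprime a d ∧ a < d := by
  have : m ≠ 0 := by omega
  simp [coprimeFactorPairs, this]

theorem factorization_eq_of_coprime_mul {a d N p : ℕ} (hN : a * d = N) (hcop : Nat.Coprime a d)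
    (hp : p ∈ a.primeFactors) : a.factorization p = N.factorization p := by
  rw [← hN, Nat.factorization_mul_of_coprime hcop, Finsupp.add_apply]
  have : p ∉ d.primeFactors := fun h => Finset.disjoint_left.1 hcop.disjoint_primeFactors hp h
  rw [← Nat.support_factorization, Finsupp.notMem_support_iff] at this
  omega

theorem eq_prod_primeFactors_of_coprime_mul {a d N : ℕ} (ha : a ≠ 0) (hN : a * d = N)
    (hcop : Nat.Coprime a d) : a = ∏ p ∈ a.primeFactors, p ^ N.factorization p := by
  conv_lhs => rw [← Nat.prod_factorization_pow_eq_self ha]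
  rw [Finsupp.prod, Nat.support_factorization]
  exact Finset.prod_congr rfl fun p hp => by rw [factorization_eq_of_coprime_mul hN hcop hp]

theorem primeFactors_prod_pow {N : ℕ} {S : Finset ℕ} (hS : S ⊆ N.primeFactors) :
    (∏ p ∈ S, p ^ N.factorization p).primeFactors = S := by
  have hprime : ∀ p ∈ S, p.Prime := fun p hp => Nat.prime_of_mem_primeFactors (hS hp)
  ext q
  rw [Nat.mem_primeFactors]
  constructor
  · rintro ⟨hq, hdvd, -⟩
    obtain ⟨p, hp, hqp⟩ := (hq.prime.dvd_finsetProd_iff _).1 hdvd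
    rwa [(Nat.prime_dvd_prime_iff_eq hq (hprime p hp)).1 (hq.dvd_of_dvd_pow hqp)]
  · intro hq
    refine ⟨hprime q hq, ?_,
      Finset.prod_ne_zero_iff.2 fun p hp => pow_ne_zero _ (hprime p hp).ne_zero⟩
    refine (dvd_pow_self q ?_).trans (Finset.dvd_prod_of_mem _ hq)
    rw [← Finsupp.mem_support_iff, Nat.support_factorization]
    exact hS hq

theorem card_coprime_divisorsAntidiagonal {N : ℕ} (hN : N ≠ 0) :
    Finset.card {p ∈ N.divisorsAntidiagonal | Nat.Coprime p.1 p.2} =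
      2 ^ N.primeFactors.card := by
  rw [← Finset.card_powerset]
  refine Finset.card_bij (fun p _ => p.1.primeFactors) ?_ ?_ ?_
  · rintro ⟨a, d⟩ h
    simp only [Finset.mem_filter, Nat.mem_divisorsAntidiagonal] at h
    exact Finset.mem_powerset.2 (Nat.primeFactors_mono ⟨d, h.1.1.symm⟩ hN)
  · rintro ⟨a, d⟩ h ⟨b, e⟩ h' hab
    simp only [Finset.mem_filter, Nat.mem_divisorsAntidiagonal] at h h' hab
    have ha : a ≠ 0 := by rintro rfl; simp at h; omega
    have hb : b ≠ 0 := by rintro rfl; simp at h'; omega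
    have hba : a = b := by
      rw [eq_prod_primeFactors_of_coprime_mul ha h.1.1 h.2, hab,
        ← eq_prod_primeFactors_of_coprime_mul hb h'.1.1 h'.2]
    subst hba
    rw [Nat.eq_of_mul_eq_mul_left (Nat.pos_of_ne_zero ha) (h.1.1.trans h'.1.1.symm)]
  · intro S hS
    rw [Finset.mem_powerset] at hS
    refine ⟨(∏ p ∈ S, p ^ N.factorization p, ∏ p ∈ N.primeFactors \ S, p ^ N.factorization p),
      ?_, primeFactors_prod_pow hS⟩
    simp only [Finset.mem_filter, Nat.mem_divisorsAntidiagonal]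
    refine ⟨⟨?_, hN⟩, ?_⟩
    · rw [mul_comm, Finset.prod_sdiff hS]
      exact Nat.prod_factorization_pow_eq_self hN
    · refine Nat.Coprime.prod_left fun p hp => Nat.Coprime.prod_right fun q hq => ?_
      rw [Finset.mem_sdiff] at hq
      refine Nat.coprime_pow_primes _ _ (Nat.prime_of_mem_primeFactors (hS hp))
        (Nat.prime_of_mem_primeFactors hq.1) ?_
      rintro rfl
      exact hq.2 hp

theorem two_mul_card_coprimeFactorPairs {m : ℕ} (hm : 1 < m) :
    2 * (coprimeFactorPairs m).card = 2 ^ m.primeFactors.card := by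
  have hm0 : m ^ 2 ≠ 0 := by positivity
  rw [← Nat.primeFactors_pow m two_ne_zero, ← card_coprime_divisorsAntidiagonal hm0,
    ← Finset.card_filter_add_card_filter_not
      (s := Finset.filter (fun p : ℕ × ℕ => Nat.Coprime p.1 p.2) _) (fun p => p.1 < p.2),
    Finset.filter_filter, Finset.filter_filter, two_mul, coprimeFactorPairs]
  congr 1
  refine Finset.card_bij (fun p _ => p.swap) ?_ (fun _ _ _ _ h => Prod.swap_injective h) ?_
  · rintro ⟨a, d⟩ h
    simp only [Finset.mem_filter, Nat.mem_divisorsAntidiagonal, Prod.swap] at h ⊢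
    exact ⟨⟨by rw [mul_comm, h.1.1], hm0⟩, h.2.1.symm, by omega⟩
  · rintro ⟨a, d⟩ h
    simp only [Finset.mem_filter, Nat.mem_divisorsAntidiagonal] at h
    refine ⟨(d, a), ?_, rfl⟩
    simp only [Finset.mem_filter, Nat.mem_divisorsAntidiagonal]
    refine ⟨⟨by rw [mul_comm, h.1.1], hm0⟩, h.2.1.symm, lt_of_le_of_ne (by omega) ?_⟩
    rintro rfl
    have h1 : d = 1 := (Nat.coprime_self d).1 h.2.1
    have h2 := h.1.1
    subst h1
    nlinarith

theorem ne_three_mul_of_coprime {a d m : ℕ} (h : a * d = m ^ 2) (hcop : Nat.Coprime a d) :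
    d ≠ 3 * a := by
  rintro rfl
  have ha : a = 1 := by simpa using Nat.Coprime.coprime_mul_left_right hcop
  subst ha
  have : m < 2 := by nlinarith
  interval_cases m <;> omega

theorem coprime_add_self_half_iff {a c d : ℕ} (ha : Odd a) (h : 2 * c = a + d) :
    Nat.Coprime a c ↔ Nat.Coprime a d := by
  rw [← Nat.coprime_self_add_right (m := a) (n := d), ← h,
    Nat.coprime_mul_iff_right, and_iff_right ha.coprime_two_right]

theorem ncard_principal_forms {n : ℕ} (hn : 1 < n) :
    {p : ℕ × ℕ | 0 < p.1 ∧ 0 < p.2 ∧ p.1 ≤ p.2 ∧ p.1 * p.2 = n ^ 2 ∧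
      Nat.gcd p.1 p.2 = 1}.ncard = (coprimeFactorPairs n).card := by
  rw [← Set.ncard_coe_finset]
  congr 1
  ext ⟨a, d⟩
  rw [Finset.mem_coe, mem_coprimeFactorPairs hn]
  simp only [Set.mem_ofPred_eq]
  constructor
  · rintro ⟨-, -, hle, h, hcop⟩
    refine ⟨h, hcop, lt_of_le_of_ne hle ?_⟩
    rintro rfl
    rw [Nat.gcd_self] at hcop
    subst hcop
    nlinarith
  · rintro ⟨h, hcop, hlt⟩
    have ha : 0 < a := by
      rw [Nat.pos_iff_ne_zero]
      rintro rfl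
      have : 0 < n ^ 2 := by positivity
      omega
    exact ⟨ha, by omega, hlt.le, h, hcop⟩

theorem ncard_middle_forms_of_odd {n : ℕ} (hn : 1 < n) (hodd : Odd n) :
    {p : ℕ × ℕ | 0 < p.1 ∧ 0 < p.2 ∧ 2 * p.1 ≤ p.2 ∧ p.1 * (2 * p.2 - p.1) = n ^ 2 ∧
      Nat.gcd p.1 p.2 = 1}.ncard =
      ((coprimeFactorPairs n).filter fun p => 3 * p.1 ≤ p.2).card := by
  symm
  rw [← Set.ncard_coe_finset]
  have hodd2 : Odd (n ^ 2) := hodd.pow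
  refine Set.ncard_congr (fun p _ => (p.1, (p.1 + p.2) / 2)) ?_ ?_ ?_
  · rintro ⟨a, d⟩ h
    rw [Finset.mem_coe, Finset.mem_filter, mem_coprimeFactorPairs hn] at h
    obtain ⟨⟨h, hcop, hlt⟩, hle⟩ := h
    have h' := hodd2
    rw [← h, Nat.odd_mul] at h'
    obtain ⟨c, hc⟩ := h'.1.add_odd h'.2
    have hc2 : (a + d) / 2 = c := by omega
    have hd : 2 * c - a = d := by omega
    have ha := h'.1.pos
    simp only [Set.mem_ofPred_eq, hc2, hd] at hle ⊢
    exact ⟨ha, by omega, by omega, h, (coprime_add_self_half_iff h'.1 (by omega)).2 hcop⟩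
  · rintro ⟨a, d⟩ ⟨b, e⟩ h h' hab
    rw [Finset.mem_coe, Finset.mem_filter, mem_coprimeFactorPairs hn] at h h'
    have hb := h'.1.1
    have ha := h.1.1
    rw [Prod.mk.injEq] at hab
    obtain ⟨rfl, -⟩ := hab
    have hpos : 0 < a := by
      rw [← ha, Nat.odd_mul] at hodd2
      exact hodd2.1.pos
    rw [Nat.eq_of_mul_eq_mul_left hpos (ha.trans hb.symm)]
  · rintro ⟨a, c⟩ ⟨ha, -, hle, h, hcop⟩
    simp only at ha hle h hcop
    obtain ⟨d, hd⟩ : ∃ d, d = 2 * c - a := ⟨_, rfl⟩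
    rw [← hd] at h
    have h' := hodd2
    rw [← h, Nat.odd_mul] at h'
    refine ⟨(a, d), ?_, ?_⟩
    · rw [Finset.mem_coe, Finset.mem_filter, mem_coprimeFactorPairs hn]
      exact ⟨⟨h, (coprime_add_self_half_iff h'.1 (by omega)).1 hcop, by omega⟩,
        show 3 * a ≤ d by omega⟩
    · simp only [Prod.mk.injEq, true_and]
      omega

theorem ncard_edge_forms_of_odd {n : ℕ} (hn : 1 < n) (hodd : Odd n) :
    {p : ℕ × ℕ | 0 < p.1 ∧ 0 < p.2 ∧ 2 * p.2 ≤ p.1 ∧ p.1 ^ 2 - p.2 ^ 2 = n ^ 2 ∧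
      Nat.gcd p.1 p.2 = 1}.ncard =
      ((coprimeFactorPairs n).filter fun p => ¬ 3 * p.1 ≤ p.2).card := by
  symm
  rw [← Set.ncard_coe_finset]
  have hodd2 : Odd (n ^ 2) := hodd.pow
  have hiff : ∀ a b : ℕ, Odd a → (Nat.Coprime a (a + 2 * b) ↔ Nat.Coprime (a + b) b) := by
    intro a b ha
    rw [Nat.coprime_self_add_right, Nat.coprime_mul_iff_right, and_iff_right ha.coprime_two_right,
      Nat.coprime_add_self_left]
  refine Set.ncard_congr (fun p _ => ((p.1 + p.2) / 2, (p.2 - p.1) / 2)) ?_ ?_ ?_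
  · rintro ⟨a, d⟩ h
    rw [Finset.mem_coe, Finset.mem_filter, mem_coprimeFactorPairs hn] at h
    obtain ⟨⟨h, hcop, hlt⟩, hle⟩ := h
    have h' := hodd2
    rw [← h, Nat.odd_mul] at h'
    obtain ⟨b, rfl⟩ : ∃ b, d = a + 2 * b := by
      obtain ⟨k, hk⟩ := h'.1
      obtain ⟨l, hl⟩ := h'.2
      exact ⟨l - k, by omega⟩
    have h1 : (a + (a + 2 * b)) / 2 = a + b := by omega
    have h2 : (a + 2 * b - a) / 2 = b := by omega
    simp only [Set.mem_ofPred_eq, h1, h2] at hle ⊢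
    refine ⟨by omega, by omega, by omega, ?_, (hiff a b h'.1).1 hcop⟩
    rw [← h, Nat.sq_sub_sq, Nat.add_sub_cancel]
    ring
  · rintro ⟨a, d⟩ ⟨b, e⟩ h h' hab
    rw [Finset.mem_coe, Finset.mem_filter, mem_coprimeFactorPairs hn] at h h'
    have ha := hodd2
    have hb := hodd2
    rw [← h.1.1, Nat.odd_mul] at ha
    rw [← h'.1.1, Nat.odd_mul] at hb
    simp only [Prod.mk.injEq, Nat.odd_iff] at hab ha hb ⊢
    omega
  · rintro ⟨A, b⟩ ⟨-, hb, hle, h, hcop⟩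
    simp only at hb hle h hcop
    obtain ⟨a, rfl⟩ : ∃ a, A = a + b := ⟨A - b, by omega⟩
    have h1 : a * (a + 2 * b) = n ^ 2 := by
      rw [← h, Nat.sq_sub_sq, Nat.add_sub_cancel]
      ring
    have h' := hodd2
    rw [← h1, Nat.odd_mul] at h'
    have hcop' := (hiff a b h'.1).2 hcop
    have hne := ne_three_mul_of_coprime h1 hcop'
    refine ⟨(a, a + 2 * b), ?_, ?_⟩
    · rw [Finset.mem_coe, Finset.mem_filter, mem_coprimeFactorPairs hn]
      exact ⟨⟨h1, hcop', by omega⟩, show ¬ 3 * a ≤ a + 2 * b by omega⟩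
    · simp only [Prod.mk.injEq]
      omega

theorem odd_add_of_coprime_mul_eq_sq {a d m : ℕ} (hm : Even m) (h : a * d = m ^ 2)
    (hcop : Nat.Coprime a d) : Odd (a + d) := by
  have h2 : Even (a * d) := by
    rw [h]
    exact hm.pow_of_ne_zero two_ne_zero
  rw [← Nat.not_even_iff_odd]
  intro hsum
  rw [Nat.even_mul] at h2
  rw [Nat.even_add] at hsum
  have ha : 2 ∣ a := even_iff_two_dvd.1 (by tauto)
  have hd : 2 ∣ d := even_iff_two_dvd.1 (by tauto)
  exact Nat.not_coprime_of_dvd_of_dvd one_lt_two ha hd hcop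

theorem exists_of_middle_form {A C m : ℕ} (hle : 2 * A ≤ C)
    (h : A * (2 * C - A) = (2 * m) ^ 2) (hcop : Nat.Coprime A C) :
    ∃ a d, A = 2 * a ∧ C = a + d ∧ a * d = m ^ 2 ∧ Nat.Coprime a d ∧ Odd (a + d) := by
  have hA : Even A := by
    have h2 : Even (A * (2 * C - A)) := by
      rw [h]
      exact (even_two_mul m).pow_of_ne_zero two_ne_zero
    rw [Nat.even_mul, Nat.even_sub (by omega)] at h2
    simpa using h2
  obtain ⟨a, rfl⟩ := even_iff_exists_two_mul.1 hA
  obtain ⟨d, rfl⟩ : ∃ d, C = a + d := ⟨C - a, by omega⟩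
  have hsub : 2 * (a + d) - 2 * a = 2 * d := by omega
  rw [hsub] at h
  rw [Nat.coprime_mul_iff_left, Nat.coprime_self_add_right, Nat.coprime_two_left] at hcop
  exact ⟨a, d, rfl, rfl, by nlinarith, hcop.2, hcop.1⟩

theorem ncard_middle_forms_of_two_mul_odd {m : ℕ} (hodd : Odd m) :
    {p : ℕ × ℕ | 0 < p.1 ∧ 0 < p.2 ∧ 2 * p.1 ≤ p.2 ∧ p.1 * (2 * p.2 - p.1) = (2 * m) ^ 2 ∧
      Nat.gcd p.1 p.2 = 1}.ncard = 0 := by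
  convert Set.ncard_empty (ℕ × ℕ)
  refine Set.eq_empty_of_forall_notMem ?_
  rintro ⟨A, C⟩ ⟨-, -, hle, h, hcop⟩
  obtain ⟨a, d, -, -, had, -, hsum⟩ := exists_of_middle_form hle h hcop
  have h2 : Odd (m ^ 2) := hodd.pow
  rw [← had, Nat.odd_mul] at h2
  exact Nat.not_even_iff_odd.2 hsum (h2.1.add_odd h2.2)

theorem ncard_middle_forms_of_two_mul_even {m : ℕ} (hm : 1 < m) (heven : Even m) :
    {p : ℕ × ℕ | 0 < p.1 ∧ 0 < p.2 ∧ 2 * p.1 ≤ p.2 ∧ p.1 * (2 * p.2 - p.1) = (2 * m) ^ 2 ∧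
      Nat.gcd p.1 p.2 = 1}.ncard =
      ((coprimeFactorPairs m).filter fun p => 3 * p.1 ≤ p.2).card := by
  symm
  rw [← Set.ncard_coe_finset]
  refine Set.ncard_congr (fun p _ => (2 * p.1, p.1 + p.2)) ?_ ?_ ?_
  · rintro ⟨a, d⟩ h
    rw [Finset.mem_coe, Finset.mem_filter, mem_coprimeFactorPairs hm] at h
    obtain ⟨⟨h, hcop, hlt⟩, hle⟩ := h
    have hsum := odd_add_of_coprime_mul_eq_sq heven h hcop
    have hsub : 2 * (a + d) - 2 * a = 2 * d := by omega
    have ha : 0 < a := by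
      rw [Nat.pos_iff_ne_zero]
      rintro rfl
      have : 0 < m ^ 2 := by positivity
      omega
    simp only [Set.mem_ofPred_eq, hsub] at hle ⊢
    refine ⟨by omega, by omega, by omega, by nlinarith, ?_⟩
    rw [← Nat.coprime_iff_gcd_eq_one, Nat.coprime_mul_iff_left, Nat.coprime_self_add_right,
      Nat.coprime_two_left]
    exact ⟨hsum, hcop⟩
  · rintro ⟨a, d⟩ ⟨b, e⟩ - - hab
    simp only [Prod.mk.injEq] at hab ⊢
    omega
  · rintro ⟨A, C⟩ ⟨-, -, hle, h, hcop⟩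
    obtain ⟨a, d, rfl, rfl, had, hcop', -⟩ := exists_of_middle_form hle h hcop
    simp only at hle
    refine ⟨(a, d), ?_, rfl⟩
    rw [Finset.mem_coe, Finset.mem_filter, mem_coprimeFactorPairs hm]
    have hlt : a < d := by
      refine lt_of_le_of_ne (by omega) ?_
      rintro rfl
      have h1 : a = 1 := (Nat.coprime_self a).1 hcop'
      subst h1
      nlinarith
    exact ⟨⟨had, hcop', hlt⟩, show 3 * a ≤ d by omega⟩

theorem exists_of_edge_form {A B m : ℕ} (hle : 2 * B ≤ A)
    (h : A ^ 2 - B ^ 2 = (2 * m) ^ 2) (hcop : Nat.Coprime A B) :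
    ∃ a, A = 2 * a + B ∧ a * (a + B) = m ^ 2 ∧ Nat.Coprime a (a + B) ∧ Odd B := by
  obtain ⟨u, rfl⟩ : ∃ u, A = u + B := ⟨A - B, by omega⟩
  rw [Nat.sq_sub_sq, Nat.add_sub_cancel] at h
  have hu : Even u := by
    have h2 : Even ((u + B + B) * u) := by
      rw [h]
      exact (even_two_mul m).pow_of_ne_zero two_ne_zero
    rw [Nat.even_mul, add_assoc, Nat.even_add] at h2
    simpa using h2
  obtain ⟨a, rfl⟩ := even_iff_exists_two_mul.1 hu
  rw [Nat.coprime_add_self_left, Nat.coprime_mul_iff_left, Nat.coprime_two_left] at hcop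
  exact ⟨a, rfl, by nlinarith, Nat.coprime_self_add_right.2 hcop.2, hcop.1⟩

theorem ncard_edge_forms_of_two_mul_odd {m : ℕ} (hodd : Odd m) :
    {p : ℕ × ℕ | 0 < p.1 ∧ 0 < p.2 ∧ 2 * p.2 ≤ p.1 ∧ p.1 ^ 2 - p.2 ^ 2 = (2 * m) ^ 2 ∧
      Nat.gcd p.1 p.2 = 1}.ncard = 0 := by
  convert Set.ncard_empty (ℕ × ℕ)
  refine Set.eq_empty_of_forall_notMem ?_
  rintro ⟨A, B⟩ ⟨-, -, hle, h, hcop⟩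
  obtain ⟨a, -, had, -, hB⟩ := exists_of_edge_form hle h hcop
  have h2 : Odd (m ^ 2) := hodd.pow
  rw [← had, Nat.odd_mul] at h2
  exact Nat.not_even_iff_odd.2 h2.2 (h2.1.add_odd hB)

theorem ncard_edge_forms_of_two_mul_even {m : ℕ} (hm : 1 < m) (heven : Even m) :
    {p : ℕ × ℕ | 0 < p.1 ∧ 0 < p.2 ∧ 2 * p.2 ≤ p.1 ∧ p.1 ^ 2 - p.2 ^ 2 = (2 * m) ^ 2 ∧
      Nat.gcd p.1 p.2 = 1}.ncard =
      ((coprimeFactorPairs m).filter fun p => ¬ 3 * p.1 ≤ p.2).card := by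
  symm
  rw [← Set.ncard_coe_finset]
  refine Set.ncard_congr (fun p _ => (p.1 + p.2, p.2 - p.1)) ?_ ?_ ?_
  · rintro ⟨a, d⟩ h
    rw [Finset.mem_coe, Finset.mem_filter, mem_coprimeFactorPairs hm] at h
    obtain ⟨⟨h, hcop, hlt⟩, hle⟩ := h
    have hsum := odd_add_of_coprime_mul_eq_sq heven h hcop
    obtain ⟨b, rfl⟩ : ∃ b, d = a + b := ⟨d - a, by omega⟩
    rw [← add_assoc, ← two_mul] at hsum
    rw [Nat.coprime_self_add_right] at hcop
    have hb : Odd b := by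
      rw [Nat.odd_iff] at hsum ⊢
      omega
    simp only [Set.mem_ofPred_eq, Nat.add_sub_cancel_left, ← add_assoc, ← two_mul] at hle ⊢
    refine ⟨by omega, by omega, by omega, ?_, ?_⟩
    · rw [Nat.sq_sub_sq, Nat.add_sub_cancel, mul_pow, ← h]
      ring
    · rw [← Nat.coprime_iff_gcd_eq_one, Nat.coprime_add_self_left, Nat.coprime_mul_iff_left,
        Nat.coprime_two_left]
      exact ⟨hb, hcop⟩
  · rintro ⟨a, d⟩ ⟨b, e⟩ h h' hab
    rw [Finset.mem_coe, Finset.mem_filter, mem_coprimeFactorPairs hm] at h h'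
    simp only [Prod.mk.injEq] at hab ⊢
    omega
  · rintro ⟨A, b⟩ ⟨-, hb, hle, h, hcop⟩
    simp only at hle hb h hcop
    obtain ⟨a, rfl, had, hcop', -⟩ := exists_of_edge_form hle h hcop
    have hne := ne_three_mul_of_coprime had hcop'
    refine ⟨(a, a + b), ?_, ?_⟩
    · rw [Finset.mem_coe, Finset.mem_filter, mem_coprimeFactorPairs hm]
      exact ⟨⟨had, hcop', by omega⟩, show ¬ 3 * a ≤ a + b by omega⟩
    · simp only [Prod.mk.injEq]
      omega


/-- **Count of primitive reduced ambiguous forms of discriminant `-4n²`.**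
For `n > 1`, the total number of (1) pairs `(A,C)` of positive integers with
`A ≤ C`, `AC = n²`, `gcd(A,C)=1`; (2) pairs `(A,C)` of positive integers with
`2A ≤ C`, `A(2C-A) = n²`, `gcd(A,C)=1`; and (3) pairs `(A,B)` of positive
integers with `2B ≤ A`, `A² - B² = n²`, `gcd(A,B)=1`, equals `2^(ω(n)-1)` if
`n ≡ 2 (mod 4)` and `2^(ω(n))` otherwise. -/
theorem count_ambiguous_forms (n : ℕ) (hn : 1 < n) :
    Nat.card {p : ℕ × ℕ // 0 < p.1 ∧ 0 < p.2 ∧ p.1 ≤ p.2 ∧ p.1 * p.2 = n ^ 2 ∧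
        Nat.gcd p.1 p.2 = 1} +
    Nat.card {p : ℕ × ℕ // 0 < p.1 ∧ 0 < p.2 ∧ 2 * p.1 ≤ p.2 ∧
        p.1 * (2 * p.2 - p.1) = n ^ 2 ∧ Nat.gcd p.1 p.2 = 1} +
    Nat.card {p : ℕ × ℕ // 0 < p.1 ∧ 0 < p.2 ∧ 2 * p.2 ≤ p.1 ∧
        p.1 ^ 2 - p.2 ^ 2 = n ^ 2 ∧ Nat.gcd p.1 p.2 = 1} =
    if n % 4 = 2 then 2 ^ (n.primeFactors.card - 1) else 2 ^ n.primeFactors.card := by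
  change Set.ncard {p : ℕ × ℕ | _} + Set.ncard {p : ℕ × ℕ | _} + Set.ncard {p : ℕ × ℕ | _} = _
  rw [ncard_principal_forms hn]
  have hcard := two_mul_card_coprimeFactorPairs hn
  rcases Nat.even_or_odd n with heven | hodd
  · obtain ⟨m, rfl⟩ := even_iff_exists_two_mul.1 heven
    rcases Nat.even_or_odd m with hm | hm
    · have hm1 : 1 < m := by
        rw [Nat.even_iff] at hm
        omega
      rw [ncard_middle_forms_of_two_mul_even hm1 hm, ncard_edge_forms_of_two_mul_even hm1 hm,
        add_assoc, Finset.card_filter_add_card_filter_not, if_neg (by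
          rw [Nat.even_iff] at hm
          omega)]
      have hcard' := two_mul_card_coprimeFactorPairs hm1
      have hprime : (2 * m).primeFactors = m.primeFactors := by
        rw [Nat.primeFactors_mul two_ne_zero (by omega), Nat.prime_two.primeFactors,
          Finset.union_eq_right, Finset.singleton_subset_iff, Nat.mem_primeFactors]
        exact ⟨Nat.prime_two, even_iff_two_dvd.1 hm, by omega⟩
      rw [hprime] at hcard ⊢
      omega
    · rw [ncard_middle_forms_of_two_mul_odd hm, ncard_edge_forms_of_two_mul_odd hm, if_pos (by
        rw [Nat.odd_iff] at hm
        omega)]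
      have hpos : 0 < (2 * m).primeFactors.card :=
        Finset.card_pos.2 (Nat.nonempty_primeFactors.2 hn)
      obtain ⟨k, hk⟩ := Nat.exists_eq_add_of_lt hpos
      rw [hk, zero_add, pow_succ] at hcard
      rw [hk, zero_add, Nat.add_sub_cancel]
      omega
  · rw [ncard_middle_forms_of_odd hn hodd, ncard_edge_forms_of_odd hn hodd,
      add_assoc, Finset.card_filter_add_card_filter_not, if_neg (by
        rw [Nat.odd_iff] at hodd
        omega)]
    omega
end

section
/- Let M = S_{i_m}⋯S_{i_2}S_{i_1} be a reduced word of length m ≥ 1 in the generators of the Apollonian group (i.e. i_{k+1} ≠ i_k for all k). Then for every row index k: the entry M_{k,i₁} is ≤ 0, and for every column index j ≠ i₁ one has M_{kj} ≥ |M_{k,i₁}|. -/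
/-- The generators `S₁, S₂, S₃, S₄` of the Apollonian group.  `S i` agrees with
the identity matrix except in row `i`, which has `-1` on the diagonal and `2`
in the other positions. -/
def S (i : Fin 4) : Matrix (Fin 4) (Fin 4) ℤ :=
  Matrix.of fun k l => if k = i then (if l = i then -1 else 2) else (if k = l then 1 else 0)

theorem mul_S_apply_self (M : Matrix (Fin 4) (Fin 4) ℤ) (k i : Fin 4) :
    (M * S i) k i = -M k i := by
  rw [Matrix.mul_apply, Finset.sum_eq_single i]
  · simp [S]
  · intro b _ hb
    simp [S, hb]
  · simp

theorem mul_S_apply_of_ne (M : Matrix (Fin 4) (Fin 4) ℤ) (k : Fin 4) {i j : Fin 4} (hj : j ≠ i) :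
    (M * S i) k j = M k j + 2 * M k i := by
  rw [Matrix.mul_apply, Finset.sum_eq_add_of_mem j i (Finset.mem_univ _) (Finset.mem_univ _) hj]
  · simp [S, hj, mul_comm]
  · rintro b - ⟨hbj, hbi⟩
    simp [S, hbj, hbi]

/-- **Sign structure of reduced words in the Apollonian group.**
Let `M = S_{i_m} ⋯ S_{i_1}` be a reduced word (consecutive indices distinct),
encoded by the nonempty list `l = [i_m, …, i_1]` so that `M = (l.map S).prod`
and `i_1 = l.getLast`.  Then in each row `k` of `M`, the entry in column `i_1`
is `≤ 0`, and every entry in a column `j ≠ i_1` is `≥ |M_{k,i_1}|`. -/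
theorem reduced_word_column_sign (l : List (Fin 4)) (hne : l ≠ [])
    (hred : l.Chain' (· ≠ ·)) :
    ∀ k : Fin 4,
      (l.map S).prod k (l.getLast hne) ≤ 0 ∧
      ∀ j : Fin 4, j ≠ l.getLast hne →
        |(l.map S).prod k (l.getLast hne)| ≤ (l.map S).prod k j := by
  induction l using List.reverseRecOn with
  | nil => exact absurd rfl hne
  | append_singleton l i ih =>
    intro k
    simp only [List.getLast_append_singleton, List.map_append, List.map_cons, List.map_nil,
      List.prod_append, List.prod_singleton, mul_S_apply_self]
    rcases eq_or_ne l [] with rfl | hl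
    · simp only [List.map_nil, List.prod_nil]
      have nonneg : ∀ j, 0 ≤ (1 : Matrix (Fin 4) (Fin 4) ℤ) k j := fun j => by
        rw [Matrix.one_apply]; split_ifs <;> simp
      refine ⟨by linarith [nonneg i], fun j hj => ?_⟩
      rw [mul_S_apply_of_ne _ _ hj, abs_neg, abs_of_nonneg (nonneg i)]
      linarith [nonneg i, nonneg j]
    · obtain ⟨hchain, -, hlast⟩ := List.isChain_append.1 hred
      have hi : i ≠ l.getLast hl :=
        (hlast _ (List.getLast_mem_getLast? hl) i rfl).symm
      obtain ⟨hnonpos, habs⟩ := ih hl hchain k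
      rw [abs_of_nonpos hnonpos] at habs
      have hMi := habs i hi
      refine ⟨by linarith, fun j hj => ?_⟩
      rw [mul_S_apply_of_ne _ _ hj, abs_neg, abs_of_nonneg (by linarith)]
      rcases eq_or_ne j (l.getLast hl) with rfl | hj'
      · linarith
      · linarith [habs j hj']
end
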